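/- Let π be a set of primes with 2 ∈ π, and let G be a finite π-separable group. Let χ ∈ Irr(G) be such that χ^o ∈ I_π(G). Suppose U ≤ G and ψ ∈ Irr(U) is a π-factored character with ψ^G = χ. Then the π'-special factor of ψ is linear, and every Hall π'-subgroup Q of U is a vertex subgroup of χ^o. -/

import Mathlib

open scoped Classical

noncomputable section

/-- All prime divisors of `n` belong to the set of primes `σ`. -/
def IsPiNumber (σ : Set ℕ) (n : ℕ) : Prop :=
  ∀ q : ℕ, q.Prime → q ∣ n → q ∈ σ

/-- `g` is a `σ`-element: its order is a `σ`-number. -/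
def IsPiElt (σ : Set ℕ) {G : Type} [Group G] (g : G) : Prop :=
  IsPiNumber σ (orderOf g)

/-- The `p`-part of a natural number. -/
def pPart (p n : ℕ) : ℕ := p ^ (n.factorization p)

/-- `χ` is the character of a finite-dimensional complex representation of `G`. -/
def IsCharacter (G : Type) [Group G] (χ : G → ℂ) : Prop :=
  ∃ V : FDRep ℂ G, ∀ g, χ g = V.character g

/-- `χ` is an irreducible (ordinary, complex) character of `G`: a nonzero character
which is not the sum of two nonzero characters. -/
def IsIrrChar (G : Type) [Group G] (χ : G → ℂ) : Prop :=
  IsCharacter G χ ∧ χ ≠ 0 ∧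
    ¬ ∃ χ₁ χ₂ : G → ℂ, IsCharacter G χ₁ ∧ χ₁ ≠ 0 ∧ IsCharacter G χ₂ ∧ χ₂ ≠ 0 ∧ χ = χ₁ + χ₂

/-- Restriction of a class function on `G` to a subgroup `H`. -/
def resChar {G : Type} [Group G] (H : Subgroup G) (χ : G → ℂ) : ↥H → ℂ :=
  fun h => χ (h : G)

/-- Restriction of a class function between nested subgroups. -/
def resCharLe {G : Type} [Group G] {K H : Subgroup G} (hKH : K ≤ H) (χ : ↥H → ℂ) : ↥K → ℂ :=
  fun k => χ ⟨(k : G), hKH k.2⟩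

/-- The induced class function from a subgroup `H` of `G`, given by the usual
induction formula. -/
def indChar {G : Type} [Group G] [Fintype G] (H : Subgroup G) (ψ : ↥H → ℂ) : G → ℂ :=
  fun g => (Nat.card ↥H : ℂ)⁻¹ *
    ∑ x : G, if h : x * g * x⁻¹ ∈ H then ψ ⟨x * g * x⁻¹, h⟩ else 0

/-- Induction of a class function between nested subgroups. -/
def indCharLe {G : Type} [Group G] [Fintype G] {K H : Subgroup G} (_ : K ≤ H)
    (ψ : ↥K → ℂ) : ↥H → ℂ :=
  fun x => (Nat.card ↥K : ℂ)⁻¹ *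
    ∑ y : ↥H, if h : (y : G) * (x : G) * (y : G)⁻¹ ∈ K then ψ ⟨(y : G) * (x : G) * (y : G)⁻¹, h⟩ else 0

/-- `θ` is an irreducible constituent of the class function `χ`. -/
def IsConstituent {G : Type} [Group G] (θ χ : G → ℂ) : Prop :=
  IsIrrChar G θ ∧ ∃ ξ : G → ℂ, (ξ = 0 ∨ IsCharacter G ξ) ∧ χ = θ + ξ

/-- The restriction `χ^o` of a class function to the `σ`-elements of `G`
(extended by zero elsewhere). -/
def piRestrict (σ : Set ℕ) {G : Type} [Group G] (χ : G → ℂ) : G → ℂ :=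
  fun g => if IsPiElt σ g then χ g else 0

/-- `φ` is a `σ`-partial character of `G`: the restriction to the `σ`-elements of an
ordinary character. -/
def IsPartialChar (σ : Set ℕ) (G : Type) [Group G] (φ : G → ℂ) : Prop :=
  ∃ χ : G → ℂ, IsCharacter G χ ∧ χ ≠ 0 ∧ φ = piRestrict σ χ

/-- `φ ∈ I_σ(G)`: an irreducible `σ`-partial character, i.e. one which is not the
sum of two `σ`-partial characters. -/
def IsIPiChar (σ : Set ℕ) (G : Type) [Group G] (φ : G → ℂ) : Prop :=
  IsPartialChar σ G φ ∧
    ¬ ∃ φ₁ φ₂ : G → ℂ, IsPartialChar σ G φ₁ ∧ IsPartialChar σ G φ₂ ∧ φ = φ₁ + φ₂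

/-- `φ ∈ IBr(G)` (at the prime `p`): irreducible Brauer characters are the irreducible
`p'`-partial characters, where the `p`-regular elements are the `{p}ᶜ`-elements. -/
def IsIBrChar (p : ℕ) (G : Type) [Group G] (φ : G → ℂ) : Prop :=
  IsIPiChar ({p}ᶜ) G φ

/-- The restriction `χ^o` of `χ` to the `p`-regular elements of `G`. -/
def brRestrict (p : ℕ) {G : Type} [Group G] (χ : G → ℂ) : G → ℂ :=
  piRestrict ({p}ᶜ) χ

/-- `χ` is a lift of the `σ`-partial character `φ`. -/
def IsLiftOfPi (σ : Set ℕ) (G : Type) [Group G] (χ φ : G → ℂ) : Prop :=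
  IsIrrChar G χ ∧ piRestrict σ χ = φ

/-- `χ` is a lift: `χ` is irreducible and `χ^o` is an irreducible `σ`-partial character. -/
def IsLiftPi (σ : Set ℕ) (G : Type) [Group G] (χ : G → ℂ) : Prop :=
  IsIrrChar G χ ∧ IsIPiChar σ G (piRestrict σ χ)

/-- `H` is a subnormal subgroup of `G`. -/
def IsSubnormalSubgroup {G : Type} [Group G] (H : Subgroup G) : Prop :=
  ∃ (n : ℕ) (c : Fin (n + 1) → Subgroup G),
    c 0 = H ∧ c (Fin.last n) = ⊤ ∧
    ∀ i : Fin n, c i.castSucc ≤ c i.succ ∧ ((c i.castSucc).subgroupOf (c i.succ)).Normal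

/-- The determinantal order `o(det θ)` of `θ` is a `σ`-number. -/
def HasPiDetOrder (σ : Set ℕ) (G : Type) [Group G] (θ : G → ℂ) : Prop :=
  ∃ V : FDRep ℂ G, (∀ g, θ g = V.character g) ∧
    IsPiNumber σ (orderOf (fun g : G => LinearMap.det (V.ρ g)))

/-- `χ` is a `σ`-special character of `G`: `χ` is irreducible, `χ(1)` is a `σ`-number,
and for every subnormal subgroup `M` of `G`, every irreducible constituent of `χ_M`
has determinantal order a `σ`-number. -/
def IsPiSpecial (σ : Set ℕ) (G : Type) [Group G] (χ : G → ℂ) : Prop :=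
  IsIrrChar G χ ∧ (∃ n : ℕ, χ 1 = (n : ℂ) ∧ IsPiNumber σ n) ∧
    ∀ M : Subgroup G, IsSubnormalSubgroup M →
      ∀ θ : ↥M → ℂ, IsConstituent θ (resChar M χ) → HasPiDetOrder σ ↥M θ

/-- `χ` is `σ`-factored: `χ = αβ` with `α` `σ`-special and `β` `σ'`-special. -/
def IsPiFactored (σ : Set ℕ) (G : Type) [Group G] (χ : G → ℂ) : Prop :=
  ∃ α β : G → ℂ, IsPiSpecial σ G α ∧ IsPiSpecial σᶜ G β ∧ χ = α * β

/-- `G` is `σ`-separable: it has a subnormal series each of whose factors is a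
`σ`-group or a `σ'`-group (equivalently, every composition factor is a `σ`-group or a
`σ'`-group). -/
def IsPiSeparable (σ : Set ℕ) (G : Type) [Group G] : Prop :=
  ∃ (n : ℕ) (c : Fin (n + 1) → Subgroup G),
    c 0 = ⊥ ∧ c (Fin.last n) = ⊤ ∧
    ∀ i : Fin n, c i.castSucc ≤ c i.succ ∧ ((c i.castSucc).subgroupOf (c i.succ)).Normal ∧
      (IsPiNumber σ (Nat.card (↥(c i.succ) ⧸ (c i.castSucc).subgroupOf (c i.succ))) ∨
        IsPiNumber σᶜ (Nat.card (↥(c i.succ) ⧸ (c i.castSucc).subgroupOf (c i.succ))))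

/-- `G` is `p`-solvable: every composition factor is a `p`-group or a `p'`-group. -/
def IsPSolvable (p : ℕ) (G : Type) [Group G] : Prop :=
  IsPiSeparable {p} G

/-- The character `δ` of the subgroup `Q` is invariant under (conjugation by the
elements of) the subgroup `S`. -/
def InvariantUnder {G : Type} [Group G] (Q : Subgroup G) (δ : ↥Q → ℂ) (S : Subgroup G) : Prop :=
  ∀ g ∈ S, ∀ x : ↥Q, ∀ h : g * (x : G) * g⁻¹ ∈ Q, δ ⟨g * (x : G) * g⁻¹, h⟩ = δ x

/-- `(Q, δ)` is a vertex pair for `χ ∈ Irr(G)` (at the prime `p`): `Q` is a `p`-subgroup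
of `G`, `δ ∈ Irr(Q)`, and there are a subgroup `U ≤ G` and an irreducible character
`ψ = αβ` of `U` with `α` `p'`-special and `β` `p`-special, such that `ψ^G = χ`, `Q` is a
Sylow `p`-subgroup of `U`, and `β_Q = δ`. -/
def IsVertexPair (p : ℕ) {G : Type} [Group G] [Fintype G] (χ : G → ℂ)
    (Q : Subgroup G) (δ : ↥Q → ℂ) : Prop :=
  IsPGroup p ↥Q ∧ IsIrrChar ↥Q δ ∧
    ∃ (U : Subgroup G) (hQU : Q ≤ U) (α β : ↥U → ℂ),
      IsPiSpecial ({p}ᶜ) ↥U α ∧ IsPiSpecial {p} ↥U β ∧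
      IsIrrChar ↥U (α * β) ∧ indChar U (α * β) = χ ∧
      ¬ p ∣ (Q.subgroupOf U).index ∧
      ∀ x : ↥Q, δ x = β ⟨(x : G), hQU x.2⟩

/-- `(Q, δ)` is a generalized `σ`-vertex for `χ ∈ Irr(G)`: there are `U ≤ G` and an
irreducible `ψ = αβ ∈ Irr(U)` with `α` `σ`-special and `β` `σ'`-special such that
`ψ^G = χ`, `Q` is a Hall `σ'`-subgroup of `U` and `δ = β_Q`. -/
def IsGenPiVertex (σ : Set ℕ) {G : Type} [Group G] [Fintype G] (χ : G → ℂ)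
    (Q : Subgroup G) (δ : ↥Q → ℂ) : Prop :=
  ∃ (U : Subgroup G) (hQU : Q ≤ U) (α β : ↥U → ℂ),
    IsPiSpecial σ ↥U α ∧ IsPiSpecial σᶜ ↥U β ∧
    IsIrrChar ↥U (α * β) ∧ indChar U (α * β) = χ ∧
    IsPiNumber σᶜ (Nat.card ↥Q) ∧ IsPiNumber σ ((Q.subgroupOf U).index) ∧
    ∀ x : ↥Q, δ x = β ⟨(x : G), hQU x.2⟩

/-- The pair `(Q₂, δ₂)` is the conjugate of the pair `(Q₁, δ₁)` by the element `g`. -/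
def IsConjPair {G : Type} [Group G] (g : G)
    (Q₁ : Subgroup G) (δ₁ : ↥Q₁ → ℂ) (Q₂ : Subgroup G) (δ₂ : ↥Q₂ → ℂ) : Prop :=
  Q₂ = Subgroup.map (MulAut.conj g).toMonoidHom Q₁ ∧
    ∀ x : ↥Q₁, ∀ h : g * (x : G) * g⁻¹ ∈ Q₂, δ₂ ⟨g * (x : G) * g⁻¹, h⟩ = δ₁ x

/-- `Q` is a vertex (subgroup) of the irreducible `σ`-partial character `φ` of `G`:
`Q` is a Hall `σ'`-subgroup of a subgroup `U ≤ G` possessing an irreducible `σ`-partial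
character `κ` of `σ`-degree with `κ^G = φ`. -/
def IsVertexSubgroup (σ : Set ℕ) {G : Type} [Group G] [Fintype G] (φ : G → ℂ)
    (Q : Subgroup G) : Prop :=
  ∃ (U : Subgroup G) (κ : ↥U → ℂ), Q ≤ U ∧
    IsPiNumber σᶜ (Nat.card ↥Q) ∧ IsPiNumber σ ((Q.subgroupOf U).index) ∧
    IsIPiChar σ ↥U κ ∧ (∃ n : ℕ, κ 1 = (n : ℂ) ∧ IsPiNumber σ n) ∧
    indChar U κ = φ

/-- `θ ∈ I_σ(M)` is an irreducible constituent of the restriction `φ_M`. -/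
def IsIPiConstituent (σ : Set ℕ) {G : Type} [Group G] (M : Subgroup G)
    (θ : ↥M → ℂ) (φ : G → ℂ) : Prop :=
  IsIPiChar σ ↥M θ ∧ ∃ ξ : ↥M → ℂ, (ξ = 0 ∨ IsPartialChar σ ↥M ξ) ∧ resChar M φ = θ + ξ

section Basic

variable {G H : Type} [Group G] [Group H] {V : Type} [AddCommGroup V] [Module ℂ V]

theorem Representation.isCharacter_character [FiniteDimensional ℂ V] (ρ : Representation ℂ G V) :
    IsCharacter G ρ.character :=
  ⟨FDRep.of ρ, fun _ => rfl⟩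

theorem IsCharacter.exists_rep {χ : G → ℂ} (h : IsCharacter G χ) :
    ∃ (V : Type) (_ : AddCommGroup V) (_ : Module ℂ V) (_ : FiniteDimensional ℂ V)
      (ρ : Representation ℂ G V), χ = ρ.character := by
  obtain ⟨V, hV⟩ := h
  exact ⟨V, inferInstance, inferInstance, inferInstance, V.ρ, funext hV⟩

theorem IsCharacter.of_eq {χ χ' : G → ℂ} (h : IsCharacter G χ) (e : ∀ g, χ' g = χ g) :
    IsCharacter G χ' := (funext e : χ' = χ) ▸ h

theorem IsCharacter.add {χ χ' : G → ℂ} (h : IsCharacter G χ) (h' : IsCharacter G χ') :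
    IsCharacter G (χ + χ') := by
  obtain ⟨V, _, _, _, ρ, rfl⟩ := h.exists_rep
  obtain ⟨W, _, _, _, σ, rfl⟩ := h'.exists_rep
  refine (ρ.prod σ).isCharacter_character.of_eq fun g => ?_
  exact (LinearMap.trace_prodMap' (ρ g) (σ g)).symm

theorem IsCharacter.mul {χ χ' : G → ℂ} (h : IsCharacter G χ) (h' : IsCharacter G χ') :
    IsCharacter G (χ * χ') := by
  obtain ⟨V, _, _, _, ρ, rfl⟩ := h.exists_rep
  obtain ⟨W, _, _, _, σ, rfl⟩ := h'.exists_rep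
  rw [← Representation.char_tensor]
  exact (ρ.tprod σ).isCharacter_character

theorem IsCharacter.comp {χ : G → ℂ} (h : IsCharacter G χ) (f : H →* G) :
    IsCharacter H (fun x => χ (f x)) := by
  obtain ⟨V, _, _, _, ρ, rfl⟩ := h.exists_rep
  exact Representation.isCharacter_character (ρ.comp f)

theorem IsCharacter.star {χ : G → ℂ} (h : IsCharacter G χ) :
    IsCharacter G (fun x => χ x⁻¹) := by
  obtain ⟨V, _, _, _, ρ, rfl⟩ := h.exists_rep
  exact ρ.dual.isCharacter_character.of_eq fun g => (ρ.char_dual g).symm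

theorem IsCharacter.map_mul_comm {χ : G → ℂ} (h : IsCharacter G χ) (x y : G) :
    χ (x * y) = χ (y * x) := by
  obtain ⟨V, _, _, _, ρ, rfl⟩ := h.exists_rep
  exact ρ.char_mul_comm _ _

theorem IsCharacter.map_conj {χ : G → ℂ} (h : IsCharacter G χ) (x y : G) :
    χ (x * y * x⁻¹) = χ y := by
  obtain ⟨V, _, _, _, ρ, rfl⟩ := h.exists_rep
  exact ρ.char_conj _ _

theorem IsCharacter.exists_nat {χ : G → ℂ} (h : IsCharacter G χ) : ∃ n : ℕ, χ 1 = n := by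
  obtain ⟨V, _, _, _, ρ, rfl⟩ := h.exists_rep
  exact ⟨_, ρ.char_one⟩

theorem isCharacter_zero : IsCharacter G (0 : G → ℂ) := by
  refine (Representation.isCharacter_character (V := PUnit)
    (1 : Representation ℂ G PUnit)).of_eq fun g => ?_
  simp [Representation.character, Subsingleton.elim (1 : PUnit →ₗ[ℂ] PUnit) 0]

theorem IsCharacter.eq_zero_of_map_one {χ : G → ℂ} (h : IsCharacter G χ) (h1 : χ 1 = 0) :
    χ = 0 := by
  obtain ⟨V, _, _, _, ρ, rfl⟩ := h.exists_rep
  rw [Representation.char_one, Nat.cast_eq_zero, Module.finrank_zero_iff] at h1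
  funext g
  simp [Representation.character, Subsingleton.elim (ρ g) 0]

/-- The representation on the range of a commuting idempotent. -/
theorem Representation.exists_rep_range [FiniteDimensional ℂ V] (ρ : Representation ℂ G V)
    (T : V →ₗ[ℂ] V) (hT : T * T = T) (hc : ∀ g, ρ g * T = T * ρ g) :
    ∃ τ : Representation ℂ G (LinearMap.range T),
      (∀ g x, ((τ g x : LinearMap.range T) : V) = ρ g x) ∧
      ∀ g, τ.character g = LinearMap.trace ℂ V (ρ g * T) := by
  have hm : ∀ g, ∀ x ∈ LinearMap.range T, ρ g x ∈ LinearMap.range T := by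
    rintro g _ ⟨y, rfl⟩
    exact ⟨ρ g y, (LinearMap.congr_fun (hc g) y).symm⟩
  refine ⟨{ toFun := fun g => (ρ g).restrict (hm g), map_one' := ?_, map_mul' := ?_ },
    fun _ _ => rfl, fun g => ?_⟩
  · ext x; simp
  · intro a b; ext x; simp
  · have hf : ∀ x, (ρ g * T) x ∈ LinearMap.range T := fun x => hm g _ ⟨x, rfl⟩
    rw [← LinearMap.trace_restrict_eq_of_forall_mem (LinearMap.range T) (ρ g * T) hf]
    change LinearMap.trace ℂ _ ((ρ g).restrict (hm g)) = _
    congr 1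
    refine LinearMap.ext fun x => ?_
    obtain ⟨_, y, rfl⟩ := x
    have : T (T y) = T y := LinearMap.congr_fun hT y
    exact Subtype.ext (by simp [this])

theorem Representation.isCharacter_trace_mul [FiniteDimensional ℂ V] (ρ : Representation ℂ G V)
    (T : V →ₗ[ℂ] V) (hT : T * T = T) (hc : ∀ g, ρ g * T = T * ρ g) :
    IsCharacter G (fun g => LinearMap.trace ℂ V (ρ g * T)) := by
  obtain ⟨τ, -, h⟩ := ρ.exists_rep_range T hT hc
  exact τ.isCharacter_character.of_eq fun g => (h g).symm

theorem Representation.exists_of_surjective (f : G →* H) (hf : Function.Surjective f)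
    (τ : Representation ℂ G V) (h : ∀ k ∈ f.ker, τ k = 1) :
    ∃ τ' : Representation ℂ H V, ∀ g, τ' (f g) = τ g := by
  refine ⟨(QuotientGroup.lift f.ker τ h).comp
    (QuotientGroup.quotientKerEquivOfSurjective f hf).symm.toMonoidHom, fun g => ?_⟩
  have : (QuotientGroup.quotientKerEquivOfSurjective f hf).symm (f g) = (g : G ⧸ f.ker) := by
    rw [MulEquiv.symm_apply_eq]; rfl
  rw [MonoidHom.comp_apply]
  exact (congrArg _ this).trans (QuotientGroup.lift_mk _ _ _)

/-- Deflation along a surjective homomorphism. -/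
theorem IsCharacter.deflate [Fintype G] {χ : G → ℂ} (h : IsCharacter G χ) (f : G →* H)
    (hf : Function.Surjective f) :
    ∃ χ' : H → ℂ, IsCharacter H χ' ∧
      ∀ g, χ' (f g) = (Nat.card f.ker : ℂ)⁻¹ * ∑ k : f.ker, χ (g * k) := by
  obtain ⟨V, _, _, _, ρ, rfl⟩ := h.exists_rep
  set n : ℂ := (Nat.card f.ker : ℂ) with hn
  have hn0 : n ≠ 0 := Nat.cast_ne_zero.mpr Nat.card_pos.ne'
  set S : V →ₗ[ℂ] V := ∑ k : f.ker, ρ k with hS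
  have hl : ∀ k : f.ker, ρ k * S = S := by
    intro k
    rw [hS, Finset.mul_sum]
    refine Fintype.sum_equiv (Equiv.mulLeft k) _ _ fun x => ?_
    simp
  have hSS : S * S = n • S := by
    conv_lhs => rw [hS, Finset.sum_mul]
    rw [Finset.sum_congr rfl (fun k _ => hl k)]
    simp [hn, Nat.cast_smul_eq_nsmul]
  have hcS : ∀ g, ρ g * S = S * ρ g := by
    intro g
    rw [hS, Finset.mul_sum, Finset.sum_mul]
    refine Fintype.sum_equiv (MulAut.conjNormal g).toEquiv _ _ fun x => ?_
    simp [← map_mul]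
  obtain ⟨τ, h1, h2⟩ := ρ.exists_rep_range (n⁻¹ • S)
    (by rw [smul_mul_smul_comm, hSS, smul_smul]; congr 1; field_simp)
    (fun g => by rw [mul_smul_comm, smul_mul_assoc, hcS])
  obtain ⟨τ', h3⟩ := Representation.exists_of_surjective f hf τ (by
    intro k hk
    ext ⟨_, y, rfl⟩
    rw [h1]
    have := LinearMap.congr_fun (hl ⟨k, hk⟩) y
    simp only [Module.End.mul_apply] at this
    simp [this])
  refine ⟨τ'.character, τ'.isCharacter_character, fun g => ?_⟩
  have : τ'.character (f g) = τ.character g := by simp [Representation.character, h3]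
  rw [this, h2, mul_smul_comm, map_smul, hS, Finset.mul_sum, map_sum, smul_eq_mul]
  simp [Representation.character]

theorem isCharacter_card_fixed (X : Type) [Fintype X] [MulAction G X] :
    IsCharacter G (fun g => ((Finset.univ.filter fun x : X => g • x = x).card : ℂ)) := by
  refine (Representation.isCharacter_character (V := X → ℂ)
    { toFun := fun g => LinearMap.funLeft ℂ ℂ (fun x : X => g⁻¹ • x)
      map_one' := by ext; simp
      map_mul' := by
        intro a b; refine LinearMap.ext fun F => funext fun x => ?_
        simp [LinearMap.funLeft_apply, mul_smul] }).of_eq fun g => ?_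
  rw [Representation.character, LinearMap.trace_eq_matrix_trace ℂ (Pi.basisFun ℂ X)]
  simp only [Matrix.trace, Matrix.diag, LinearMap.toMatrix_apply, Pi.basisFun_apply,
    Pi.basisFun_repr, MonoidHom.coe_mk, OneHom.coe_mk, LinearMap.funLeft_apply, Pi.single_apply,
    Finset.sum_boole, inv_smul_eq_iff]
  congr 2
  ext x; simp [eq_comm]

theorem IsCharacter.indChar [Fintype G] {K : Subgroup G} {ψ : K → ℂ} (h : IsCharacter K ψ) :
    IsCharacter G (indChar K ψ) := by
  let _ : MulAction (G × K) G :=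
    { smul := fun p x => (p.2 : G) * x * p.1⁻¹
      one_smul := fun x => by change ((1 : K) : G) * x * (1 : G)⁻¹ = x; simp
      mul_smul := fun p q x => by
        change ((p.2 * q.2 : K) : G) * x * (p.1 * q.1)⁻¹
          = (p.2 : G) * ((q.2 : G) * x * q.1⁻¹) * p.1⁻¹
        simp [mul_assoc] }
  have hs : ∀ (p : G × K) (x : G), p • x = (p.2 : G) * x * p.1⁻¹ := fun _ _ => rfl
  have hX := (isCharacter_card_fixed (G := G × K) G).mul (h.comp (MonoidHom.snd G K))
  obtain ⟨χ, hχ, e⟩ := hX.deflate (MonoidHom.fst G K) Prod.fst_surjective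
  refine hχ.of_eq fun g => ?_
  let E : K ≃ (MonoidHom.fst G K).ker :=
    { toFun := fun k => ⟨(1, k), rfl⟩
      invFun := fun k => k.1.2
      left_inv := fun _ => rfl
      right_inv := by
        rintro ⟨⟨a, b⟩, hk⟩
        obtain rfl : a = 1 := hk
        rfl }
  refine Eq.trans ?_ (e (g, 1)).symm
  rw [← Nat.card_congr E,
    ← Fintype.sum_equiv E (fun k => ((Finset.univ.filter fun x : G => (g, k) • x = x).card : ℂ) * ψ k)
      _ (fun k => by simp [E])]
  rw [_root_.indChar]
  congr 1
  simp_rw [Finset.card_filter, Nat.cast_sum, Finset.sum_mul]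
  rw [Finset.sum_comm]
  refine Finset.sum_congr rfl fun x _ => ?_
  simp only [hs]
  by_cases hx : x * g * x⁻¹ ∈ K
  · rw [dif_pos hx, Finset.sum_eq_single ⟨x * g * x⁻¹, hx⟩]
    · simp
    · intro b _ hb
      have : ¬ ((b : G) * x * g⁻¹ = x) := by
        intro hbx
        apply hb
        ext
        simp only
        rw [mul_inv_eq_iff_eq_mul] at hbx
        rw [← hbx]; group
      simp [this]
    · simp
  · rw [dif_neg hx]
    symm
    refine Finset.sum_eq_zero fun b _ => ?_
    have : ¬ ((b : G) * x * g⁻¹ = x) := by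
      intro hbx
      apply hx
      rw [mul_inv_eq_iff_eq_mul] at hbx
      rw [← hbx]; simp
    simp [this]

end Basic

section Irreducible

variable {G : Type} [Group G] [Fintype G] {V : Type} [AddCommGroup V] [Module ℂ V]

theorem Nat.card_cast_ne_zero (G : Type) [Group G] [Fintype G] : (Nat.card G : ℂ) ≠ 0 :=
  Nat.cast_ne_zero.mpr Nat.card_pos.ne'

theorem Representation.exists_commuting_proj (ρ : Representation ℂ G V) (W : Submodule ℂ V)
    (hW : ∀ g, ∀ x ∈ W, ρ g x ∈ W) :
    ∃ T : V →ₗ[ℂ] V, T * T = T ∧ (∀ g, ρ g * T = T * ρ g) ∧ LinearMap.range T = W := by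
  obtain ⟨P, hP⟩ := W.exists_isCompl
  obtain ⟨P, hPW, hPid⟩ : ∃ P : V →ₗ[ℂ] V, (∀ x, P x ∈ W) ∧ ∀ x ∈ W, P x = x :=
    ⟨W.subtype ∘ₗ W.projectionOnto P hP, fun x => by simp, fun x hx =>
      congrArg Subtype.val (Submodule.projectionOnto_apply_left hP ⟨x, hx⟩)⟩
  set n : ℂ := (Nat.card G : ℂ) with hn
  have hn0 : n ≠ 0 := Nat.card_cast_ne_zero G
  set S : V →ₗ[ℂ] V := ∑ g : G, ρ g * P * ρ g⁻¹ with hS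
  have hSW : ∀ x, S x ∈ W := fun x => by
    simp only [hS, LinearMap.sum_apply, Module.End.mul_apply]
    exact Submodule.sum_mem _ fun g _ => hW _ _ (hPW _)
  have hSx : ∀ x ∈ W, S x = n • x := fun x hx => by
    simp only [hS, LinearMap.sum_apply, Module.End.mul_apply]
    rw [Finset.sum_congr rfl (g := fun _ => x) fun g _ => by
      rw [hPid _ (hW _ _ hx), ← Module.End.mul_apply, ← map_mul]; simp]
    simp [hn, Nat.cast_smul_eq_nsmul]
  have hTx : ∀ x ∈ W, (n⁻¹ • S) x = x := fun x hx => by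
    rw [LinearMap.smul_apply, hSx x hx, smul_smul, inv_mul_cancel₀ hn0, one_smul]
  have hTW : ∀ x, (n⁻¹ • S) x ∈ W := fun x => W.smul_mem _ (hSW x)
  refine ⟨n⁻¹ • S, LinearMap.ext fun x => hTx _ (hTW x), fun g => ?_, ?_⟩
  · rw [mul_smul_comm, smul_mul_assoc, hS, Finset.mul_sum, Finset.sum_mul]
    congr 1
    refine Fintype.sum_equiv (Equiv.mulLeft g) _ _ fun x => ?_
    simp only [Equiv.coe_mulLeft, map_mul, mul_inv_rev, mul_assoc]
    rw [← map_mul ρ g⁻¹ g]; simp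
  · ext x
    exact ⟨by rintro ⟨y, rfl⟩; exact hTW y, fun hx => ⟨x, hTx x hx⟩⟩

variable [FiniteDimensional ℂ V]

theorem Representation.eq_zero_of_trace_eq_zero (T : V →ₗ[ℂ] V) (hT : T * T = T)
    (h : LinearMap.trace ℂ V T = 0) : T = 0 := by
  obtain ⟨τ, -, hτ⟩ := (1 : Representation ℂ Unit V).exists_rep_range T hT (by simp)
  have h1 := hτ 1
  simp only [MonoidHom.one_apply, one_mul, h, char_one, Nat.cast_eq_zero,
    Submodule.finrank_eq_zero, LinearMap.range_eq_bot] at h1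
  exact h1

theorem Representation.eq_zero_or_one_of_isIrrChar (ρ : Representation ℂ G V)
    (h : IsIrrChar G ρ.character) (T : V →ₗ[ℂ] V) (hT : T * T = T)
    (hc : ∀ g, ρ g * T = T * ρ g) : T = 0 ∨ T = 1 := by
  by_contra! hne
  have hT' : (1 - T) * (1 - T) = 1 - T := by
    simp only [mul_sub, sub_mul, hT, one_mul, mul_one]; simp
  refine h.2.2 ⟨_, _, ρ.isCharacter_trace_mul T hT hc, fun h0 => hne.1 ?_,
    ρ.isCharacter_trace_mul (1 - T) hT' (fun g => by rw [mul_sub, sub_mul, hc]; simp),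
    fun h0 => hne.2 ?_, ?_⟩
  · refine eq_zero_of_trace_eq_zero T hT ?_
    simpa using congrFun h0 1
  · have := eq_zero_of_trace_eq_zero (1 - T) hT' (by simpa using congrFun h0 1)
    exact (sub_eq_zero.mp this).symm
  · funext g
    simp [← map_add, ← mul_add, character]

theorem Representation.isIrreducible_of_isIrrChar (ρ : Representation ℂ G V)
    (h : IsIrrChar G ρ.character) : ρ.IsIrreducible := by
  have hnt : Nontrivial V := by
    by_contra hV
    rw [not_nontrivial_iff_subsingleton] at hV
    apply h.2.1
    funext g
    simp [character, Subsingleton.elim (ρ g) 0]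
  refine { exists_pair_ne := ⟨⊥, ⊤, fun e => ?_⟩, eq_bot_or_eq_top := fun W => ?_ }
  · have : (⊥ : Submodule ℂ V) = ⊤ := congrArg Subrepresentation.toSubmodule e
    exact bot_ne_top this
  · obtain ⟨T, hT, hc, hr⟩ := ρ.exists_commuting_proj W.toSubmodule
      (fun g x hx => W.apply_mem_toSubmodule g hx)
    rcases ρ.eq_zero_or_one_of_isIrrChar h T hT hc with rfl | rfl
    · left
      apply Subrepresentation.toSubmodule_injective
      rw [← hr]; exact LinearMap.range_zero
    · right
      apply Subrepresentation.toSubmodule_injective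
      rw [← hr]; exact LinearMap.range_id

theorem Representation.exists_eq_smul (ρ : Representation ℂ G V) [hρ : ρ.IsIrreducible]
    (T : V →ₗ[ℂ] V) (hc : ∀ g, ρ g * T = T * ρ g) : ∃ c : ℂ, T = c • 1 := by
  obtain ⟨c, hcc⟩ := IsIrreducible.algebraMap_intertwiningMap_bijective_of_isAlgClosed (ρ := ρ)
    |>.2 ⟨T, fun g => (hc g).symm⟩
  refine ⟨c, ?_⟩
  have := congrArg IntertwiningMap.toLinearMap hcc
  exact this.symm

theorem IsIrrChar.exists_rep {δ : G → ℂ} (h : IsIrrChar G δ) :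
    ∃ (V : Type) (_ : AddCommGroup V) (_ : Module ℂ V) (_ : FiniteDimensional ℂ V)
      (ρ : Representation ℂ G V), δ = ρ.character ∧ ρ.IsIrreducible := by
  obtain ⟨V, _, _, _, ρ, rfl⟩ := h.1.exists_rep
  exact ⟨V, _, _, inferInstance, ρ, rfl, ρ.isIrreducible_of_isIrrChar h⟩

theorem IsIrrChar.map_one_ne_zero {G : Type} [Group G] {δ : G → ℂ} (h : IsIrrChar G δ) : δ 1 ≠ 0 :=
  fun h1 => h.2.1 (h.1.eq_zero_of_map_one h1)

theorem IsIrrChar.sum_mul {δ δ' : G → ℂ} (h : IsIrrChar G δ) (h' : IsIrrChar G δ') :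
    ∑ g, δ g * δ' g⁻¹ = if δ = δ' then (Nat.card G : ℂ) else 0 := by
  obtain ⟨V, _, _, _, ρ, rfl, _⟩ := h.exists_rep
  obtain ⟨W, _, _, _, σ, rfl, _⟩ := h'.exists_rep
  have hn0 := Nat.card_cast_ne_zero G
  let _ : Invertible (Nat.card G : ℂ) := invertibleOfNonzero hn0
  have key : ∀ (b : Prop) (x : ℂ), (Nat.card G : ℂ)⁻¹ * x = (if b then ((1 : ℕ) : ℂ) else ((0 : ℕ) : ℂ)) →
      x = if b then (Nat.card G : ℂ) else 0 := by
    intro b x hx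
    rw [inv_mul_eq_iff_eq_mul₀ hn0] at hx
    rw [hx]; split_ifs <;> simp
  split_ifs with he
  · have := key _ _ (by simpa using Representation.char_orthonormal ρ ρ)
    rw [← he, this, if_pos ⟨Representation.Equiv.refl ρ⟩]
  · have := key _ _ (by simpa using Representation.char_orthonormal ρ σ)
    rw [this, if_neg]
    rintro ⟨φ⟩
    exact he (Representation.char_iso φ).symm

theorem IsCharacter.exists_multiset {G : Type} [Group G] {χ : G → ℂ} (h : IsCharacter G χ) :
    ∃ s : Multiset (G → ℂ), (∀ δ ∈ s, IsIrrChar G δ) ∧ χ = s.sum := by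
  obtain ⟨n, hn⟩ := h.exists_nat
  induction n using Nat.strong_induction_on generalizing χ with
  | _ n ih =>
    by_cases h0 : χ = 0
    · exact ⟨0, by simp, by simpa using h0⟩
    by_cases hi : IsIrrChar G χ
    · exact ⟨{χ}, by simpa using hi, by simp⟩
    have : ∃ χ₁ χ₂ : G → ℂ, IsCharacter G χ₁ ∧ χ₁ ≠ 0 ∧ IsCharacter G χ₂ ∧ χ₂ ≠ 0 ∧
        χ = χ₁ + χ₂ := by
      by_contra hc
      exact hi ⟨h, h0, hc⟩
    obtain ⟨χ₁, χ₂, h1, h10, h2, h20, rfl⟩ := this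
    obtain ⟨a, ha⟩ := h1.exists_nat
    obtain ⟨b, hb⟩ := h2.exists_nat
    have ha0 : a ≠ 0 := fun e => h10 (h1.eq_zero_of_map_one (by simp [ha, e]))
    have hb0 : b ≠ 0 := fun e => h20 (h2.eq_zero_of_map_one (by simp [hb, e]))
    have hab : a + b = n := by
      have : (χ₁ + χ₂) 1 = ((a + b : ℕ) : ℂ) := by simp [ha, hb]
      rw [hn] at this
      exact_mod_cast this.symm
    obtain ⟨s, hs, rfl⟩ := ih a (by lia) h1 ha
    obtain ⟨t, ht, rfl⟩ := ih b (by lia) h2 hb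
    refine ⟨s + t, fun δ hδ => ?_, by simp⟩
    rcases Multiset.mem_add.mp hδ with hδ | hδ
    exacts [hs _ hδ, ht _ hδ]

end Irreducible

section Projectors

variable {G : Type} [Group G] [Fintype G] {V : Type} [AddCommGroup V] [Module ℂ V]

theorem Representation.comm_sum_of_class (ρ : Representation ℂ G V) {c : G → ℂ}
    (hc : ∀ x y, c (x * y * x⁻¹) = c y) (g : G) :
    ρ g * ∑ m, c m • ρ m = (∑ m, c m • ρ m) * ρ g := by
  rw [Finset.mul_sum, Finset.sum_mul]
  refine Fintype.sum_equiv (MulAut.conj g).toEquiv _ _ fun x => ?_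
  simp [hc, ← map_mul]

theorem IsCharacter.map_inv_conj {χ : G → ℂ} (h : IsCharacter G χ) (x y : G) :
    χ (x * y * x⁻¹)⁻¹ = χ y⁻¹ := by
  rw [← h.map_conj x y⁻¹]; congr 1; group

theorem IsIrrChar.sum_mul_conv {δ δ' : G → ℂ} (h : IsIrrChar G δ) (h' : IsIrrChar G δ') (n : G) :
    ∑ m, δ m⁻¹ * δ' (m * n) = if δ = δ' then (Nat.card G : ℂ) / δ 1 * δ n else 0 := by
  obtain ⟨W, _, _, _, σ, e, _⟩ := h'.exists_rep
  obtain ⟨c, hc⟩ := σ.exists_eq_smul _ (σ.comm_sum_of_class (c := fun m => δ m⁻¹)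
    h.1.map_inv_conj)
  have h1 : ∀ n, ∑ m, δ m⁻¹ * δ' (m * n) = c * δ' n := fun n => by
    have := congrArg (fun T => LinearMap.trace ℂ W (T * σ n)) hc
    simp only [Finset.sum_mul, map_sum, smul_mul_assoc, map_smul, smul_eq_mul, ← map_mul,
      one_mul] at this
    rw [e]; exact this
  have h2 := h1 1
  rw [Finset.sum_congr rfl (g := fun m => δ' m * δ m⁻¹) fun m _ => by rw [mul_one, mul_comm],
    h'.sum_mul h] at h2
  rw [h1]
  split_ifs with hd
  · subst hd
    rw [if_pos rfl] at h2
    rw [h2]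
    field_simp [h.map_one_ne_zero]
  · rw [if_neg (fun e => hd e.symm)] at h2
    rw [(mul_eq_zero.mp h2.symm).resolve_right h'.map_one_ne_zero, zero_mul]

/-- The projector of the representation `ρ` to the isotypic component of the irreducible
character `δ`. -/
def Representation.isoProj (ρ : Representation ℂ G V) (δ : G → ℂ) : V →ₗ[ℂ] V :=
  (δ 1 / Nat.card G) • ∑ m, δ m⁻¹ • ρ m

theorem Representation.isoProj_comm (ρ : Representation ℂ G V) {δ : G → ℂ} (h : IsIrrChar G δ)
    (g : G) : ρ g * ρ.isoProj δ = ρ.isoProj δ * ρ g := by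
  rw [isoProj, mul_smul_comm, smul_mul_assoc, ρ.comm_sum_of_class h.1.map_inv_conj]

theorem Representation.isoProj_mul (ρ : Representation ℂ G V) {δ δ' : G → ℂ} (h : IsIrrChar G δ)
    (h' : IsIrrChar G δ') :
    ρ.isoProj δ * ρ.isoProj δ' = if δ = δ' then ρ.isoProj δ else 0 := by
  have hn0 := Nat.card_cast_ne_zero G
  have key : (∑ m, δ m⁻¹ • ρ m) * ∑ m, δ' m⁻¹ • ρ m
      = ∑ x, (∑ m, δ m⁻¹ * δ' (m * x⁻¹)) • ρ x := by
    simp_rw [Finset.sum_mul, Finset.mul_sum, Finset.sum_smul]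
    rw [Finset.sum_comm' (t' := Finset.univ) (s' := fun _ => Finset.univ) (by simp)]
    conv_rhs => rw [Finset.sum_comm]
    rw [Finset.sum_comm]
    refine Finset.sum_congr rfl fun m _ => ?_
    refine Fintype.sum_equiv (Equiv.mulLeft m) _ _ fun x => ?_
    rw [smul_mul_smul_comm, ← map_mul, h'.1.map_mul_comm]
    simp
  rw [isoProj, isoProj, smul_mul_smul_comm, key]
  simp_rw [h.sum_mul_conv h']
  split_ifs with hd
  · subst hd
    rw [Finset.smul_sum, Finset.smul_sum]
    refine Finset.sum_congr rfl fun x _ => ?_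
    rw [smul_smul, smul_smul]
    congr 1
    have := h.map_one_ne_zero
    field_simp
  · simp

theorem Representation.trace_isoProj_mul (ρ : Representation ℂ G V) {s : Multiset (G → ℂ)}
    (hs : ∀ δ ∈ s, IsIrrChar G δ) (e : ρ.character = s.sum) {δ : G → ℂ} (h : IsIrrChar G δ)
    (n : G) : LinearMap.trace ℂ V (ρ.isoProj δ * ρ n) = s.count δ * δ n := by
  have hn0 := Nat.card_cast_ne_zero G
  have h1 : LinearMap.trace ℂ V (ρ.isoProj δ * ρ n)
      = δ 1 / Nat.card G * ∑ m, δ m⁻¹ * ρ.character (m * n) := by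
    simp only [isoProj, smul_mul_assoc, map_smul, Finset.sum_mul, map_sum, smul_eq_mul,
      ← map_mul]
    rfl
  rw [h1, e]
  clear e h1
  induction s using Multiset.induction_on with
  | empty => simp
  | cons a s ih =>
    have iha := ih fun δ hδ => hs δ (Multiset.mem_cons_of_mem hδ)
    have ha := hs a (Multiset.mem_cons_self _ _)
    simp only [Multiset.sum_cons, Pi.add_apply, mul_add, Finset.sum_add_distrib, iha]
    rw [h.sum_mul_conv ha]
    by_cases hd : δ = a
    · subst hd
      have := h.map_one_ne_zero
      simp
      field_simp
      ring
    · simp [hd]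

theorem Representation.trace_isoProj (ρ : Representation ℂ G V) {s : Multiset (G → ℂ)}
    (hs : ∀ δ ∈ s, IsIrrChar G δ) (e : ρ.character = s.sum) {δ : G → ℂ} (h : IsIrrChar G δ) :
    LinearMap.trace ℂ V (ρ.isoProj δ) = s.count δ * δ 1 := by
  simpa using ρ.trace_isoProj_mul hs e h 1

theorem Representation.isoProj_eq_one (ρ : Representation ℂ G V) [FiniteDimensional ℂ V]
    (h : IsIrrChar G ρ.character) : ρ.isoProj ρ.character = 1 := by
  refine (ρ.eq_zero_or_one_of_isIrrChar h _ (by simp [ρ.isoProj_mul h h])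
    (ρ.isoProj_comm h)).resolve_left fun h0 => ?_
  have := ρ.trace_isoProj (s := {ρ.character}) (by simpa using h) (by simp) h
  rw [h0] at this
  simp only [map_zero, Multiset.nodup_singleton, Multiset.mem_singleton,
    Multiset.count_eq_one_of_mem, Nat.cast_one, one_mul] at this
  exact h.map_one_ne_zero this.symm

/-- An element all of whose powers have the character value of `1` acts trivially. -/
theorem Representation.eq_one_of_char_pow (ρ : Representation ℂ G V) [FiniteDimensional ℂ V]
    (g : G) (hg : ∀ i : ℕ, ρ.character (g ^ i) = ρ.character 1) : ρ g = 1 := by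
  set n := orderOf g with hn
  have hn0 : (n : ℂ) ≠ 0 := Nat.cast_ne_zero.mpr (orderOf_pos g).ne'
  set S : V →ₗ[ℂ] V := ∑ i ∈ Finset.range n, ρ (g ^ i) with hS
  have h1 : ρ g * S = S := by
    rw [hS, Finset.mul_sum]
    simp_rw [← map_mul, ← pow_succ']
    have := (Finset.sum_range_succ' (fun i => ρ (g ^ i)) n).symm.trans
      (Finset.sum_range_succ (fun i => ρ (g ^ i)) n)
    simpa [hn, pow_orderOf_eq_one] using this
  have hp : ∀ i : ℕ, ρ (g ^ i) * S = S := by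
    intro i
    induction i with
    | zero => simp
    | succ i ih => rw [pow_succ, map_mul, mul_assoc, h1, ih]
  have hSS : S * S = (n : ℂ) • S := by
    conv_lhs => rw [hS, Finset.sum_mul]
    rw [Finset.sum_congr rfl fun i _ => hp i]
    simp [Nat.cast_smul_eq_nsmul]
  have hT : (n : ℂ)⁻¹ • S * (n : ℂ)⁻¹ • S = (n : ℂ)⁻¹ • S := by
    rw [smul_mul_smul_comm, hSS, smul_smul]; congr 1; field_simp
  have htr : LinearMap.trace ℂ V ((n : ℂ)⁻¹ • S) = LinearMap.trace ℂ V 1 := by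
    rw [map_smul, hS, map_sum]
    change (n : ℂ)⁻¹ • ∑ i ∈ Finset.range n, ρ.character (g ^ i) = _
    simp_rw [hg]
    simp [hn0]
  have h2 : 1 - (n : ℂ)⁻¹ • S = 0 := by
    refine eq_zero_of_trace_eq_zero _ ?_ (by rw [map_sub, htr, sub_self])
    simp only [mul_sub, sub_mul, hT, one_mul, mul_one]; simp
  have h3 := sub_eq_zero.mp h2
  rw [← mul_one (ρ g), h3, mul_smul_comm, h1]

/-- The degree of an irreducible character divides the group order. -/
theorem IsIrrChar.degree_dvd {δ : G → ℂ} (h : IsIrrChar G δ) {d : ℕ} (hd : δ 1 = d) :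
    d ∣ Nat.card G := by
  obtain ⟨V, _, _, _, ρ, rfl, hρ⟩ := h.exists_rep
  have hd0 : (d : ℂ) ≠ 0 := hd ▸ h.map_one_ne_zero
  have hn0 := Nat.card_cast_ne_zero G
  have hnt : Nontrivial V := by
    rw [Representation.char_one, Nat.cast_inj] at hd
    refine Module.nontrivial_of_finrank_pos (R := ℂ) (Nat.pos_of_ne_zero fun e => hd0 ?_)
    rw [← hd, e, Nat.cast_zero]
  set c : ℂ := (Nat.card G : ℂ) / d with hc
  have hconj : ∀ a : G, ∑ b, ρ (b * a⁻¹ * b⁻¹) = (c * ρ.character a⁻¹) • 1 := by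
    intro a
    obtain ⟨k, hk⟩ := ρ.exists_eq_smul (∑ b, ρ (b * a⁻¹ * b⁻¹)) (fun g => by
      rw [Finset.mul_sum, Finset.sum_mul]
      refine Fintype.sum_equiv (Equiv.mulLeft g) _ _ fun x => ?_
      simp only [Equiv.coe_mulLeft, ← map_mul]
      congr 1; group)
    rw [hk]
    have := congrArg (LinearMap.trace ℂ V) hk
    rw [map_sum, map_smul] at this
    have hcj : ∀ b, LinearMap.trace ℂ V (ρ (b * a⁻¹ * b⁻¹)) = ρ.character a⁻¹ :=
      fun b => h.1.map_conj b a⁻¹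
    simp_rw [hcj] at this
    rw [← hd, Representation.char_one] at hd0 hc
    simp only [Finset.sum_const, Finset.card_univ, nsmul_eq_mul, LinearMap.trace_one,
      smul_eq_mul, Fintype.card_eq_nat_card] at this
    congr 1
    rw [hc]
    field_simp
    rw [this]
  have hall : ∑ a, ∑ b, ρ (a * (b * a⁻¹ * b⁻¹)) = (c ^ 2) • 1 := by
    simp_rw [map_mul ρ _ (_ * _ * _), ← Finset.mul_sum, hconj]
    have := ρ.isoProj_eq_one h
    rw [Representation.isoProj, hd] at this
    simp only [mul_smul_comm, mul_one, mul_smul, ← Finset.smul_sum]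
    rw [← this, smul_smul]
    congr 1
    rw [hc]
    field_simp
  have hcint : IsIntegral ℤ (c ^ 2) := by
    let φ : MonoidAlgebra ℤ G →ₐ[ℤ] (V →ₗ[ℂ] V) := MonoidAlgebra.lift ℤ (V →ₗ[ℂ] V) G ρ
    have hz : IsIntegral ℤ (∑ a, ∑ b, MonoidAlgebra.of ℤ G (a * (b * a⁻¹ * b⁻¹))) :=
      Algebra.IsIntegral.isIntegral _
    have := hz.map φ
    simp only [map_sum, φ, MonoidAlgebra.lift_of] at this
    rw [hall, ← Algebra.algebraMap_eq_smul_one] at this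
    exact (isIntegral_algebraMap_iff (FaithfulSMul.algebraMap_injective ℂ (V →ₗ[ℂ] V))).mp this
  have hq : IsIntegral ℤ (((Nat.card G : ℚ) / d) ^ 2) := by
    rw [← isIntegral_algebraMap_iff (algebraMap ℚ ℂ).injective]
    simpa [hc] using hcint
  obtain ⟨k, hk⟩ := IsIntegrallyClosed.isIntegral_iff.mp hq
  have hd0' : (d : ℚ) ≠ 0 := by exact_mod_cast hd0
  have : (Nat.card G : ℤ) ^ 2 = k * (d : ℤ) ^ 2 := by
    have : (Nat.card G : ℚ) ^ 2 = k * (d : ℚ) ^ 2 := by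
      rw [show (k : ℚ) = _ from hk]; field_simp
    exact_mod_cast this
  have h2 : (d : ℤ) ^ 2 ∣ (Nat.card G : ℤ) ^ 2 := ⟨k, by rw [this, mul_comm]⟩
  rw [Int.pow_dvd_pow_iff two_ne_zero] at h2
  exact_mod_cast h2

end Projectors

section PiNumbers

variable {σ : Set ℕ} {m n : ℕ}

theorem IsPiNumber.of_dvd (h : IsPiNumber σ n) (hmn : m ∣ n) : IsPiNumber σ m :=
  fun q hq hqm => h q hq (hqm.trans hmn)

theorem IsPiNumber.mul (hm : IsPiNumber σ m) (hn : IsPiNumber σ n) : IsPiNumber σ (m * n) :=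
  fun q hq hqmn => (hq.dvd_mul.mp hqmn).elim (hm q hq) (hn q hq)

theorem isPiNumber_one : IsPiNumber σ 1 :=
  fun _ hq h => absurd (Nat.dvd_one.mp h) hq.one_lt.ne'

theorem IsPiNumber.coprime (hm : IsPiNumber σ m) (hn : IsPiNumber σᶜ n) : m.Coprime n :=
  Nat.coprime_of_dvd fun q hq h1 h2 => hn q hq h2 (hm q hq h1)

theorem IsPiNumber.eq_one (hm : IsPiNumber σ m) (hn : IsPiNumber σᶜ m) : m = 1 :=
  (Nat.coprime_self m).mp (hm.coprime hn)

end PiNumbers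

section PiElements

variable {σ : Set ℕ} {G H : Type} [Group G] [Group H]

theorem IsPiElt.map {g : G} (h : IsPiElt σ g) (f : G →* H) : IsPiElt σ (f g) :=
  IsPiNumber.of_dvd h (orderOf_map_dvd f g)

theorem isPiElt_one : IsPiElt σ (1 : G) := by
  rw [IsPiElt, orderOf_one]; exact isPiNumber_one

theorem IsPiElt.pow {g : G} (h : IsPiElt σ g) (k : ℕ) : IsPiElt σ (g ^ k) :=
  IsPiNumber.of_dvd h (orderOf_pow_dvd k)

theorem isPiElt_map_iff {f : G →* H} (hf : Function.Injective f) {g : G} :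
    IsPiElt σ (f g) ↔ IsPiElt σ g := by
  rw [IsPiElt, IsPiElt, orderOf_injective f hf]

theorem isPiElt_conj {x g : G} : IsPiElt σ (x * g * x⁻¹) ↔ IsPiElt σ g :=
  isPiElt_map_iff (f := (MulAut.conj x).toMonoidHom) (MulAut.conj x).injective

theorem isPiElt_coe {K : Subgroup G} {g : K} : IsPiElt σ (g : G) ↔ IsPiElt σ g :=
  isPiElt_map_iff (f := K.subtype) K.subtype_injective

theorem isPiElt_of_card (h : IsPiNumber σ (Nat.card G)) (g : G) : IsPiElt σ g :=
  h.of_dvd (orderOf_dvd_natCard g)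

theorem isPiElt_of_mem {K : Subgroup G} (h : IsPiNumber σ (Nat.card K)) {g : G} (hg : g ∈ K) :
    IsPiElt σ g :=
  (isPiElt_coe (g := ⟨g, hg⟩)).mpr (isPiElt_of_card h _)

theorem IsPiElt.eq_one {g : G} (h : IsPiElt σ g) (h' : IsPiElt σᶜ g) : g = 1 :=
  orderOf_eq_one_iff.mp (IsPiNumber.eq_one h h')

theorem isPiNumber_card_of_forall [Finite G] (h : ∀ g : G, IsPiElt σ g) :
    IsPiNumber σ (Nat.card G) := by
  intro q hq hd
  have := Fact.mk hq
  obtain ⟨x, hx⟩ := exists_prime_orderOf_dvd_card' q hd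
  exact h x q hq (hx ▸ dvd_rfl)

theorem isPiElt_of_ker [Finite G] (f : G →* H) (hf : IsPiNumber σ (Nat.card f.ker)) {g : G}
    (hg : IsPiElt σ (f g)) : IsPiElt σ g := by
  have h1 : g ^ orderOf (f g) ∈ f.ker := by
    rw [MonoidHom.mem_ker, map_pow, pow_orderOf_eq_one]
  have h2 : g ^ (orderOf (f g) * Nat.card f.ker) = 1 := by
    rw [pow_mul]
    exact congrArg Subtype.val (pow_card_eq_one' (x := (⟨_, h1⟩ : f.ker)))
  exact (IsPiNumber.mul hg hf).of_dvd (orderOf_dvd_of_pow_eq_one h2)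

theorem Subgroup.card_mul_relIndex' {K L : Subgroup G} (h : K ≤ L) :
    Nat.card K * K.relIndex L = Nat.card L := by
  rw [← relIndex_bot_left, ← relIndex_bot_left, relIndex_mul_relIndex _ _ _ bot_le h]

theorem Subgroup.card_sup_dvd' (K N : Subgroup G) [N.Normal] :
    Nat.card (K ⊔ N : Subgroup G) ∣ Nat.card N * Nat.card K := by
  rw [← card_mul_relIndex' (le_sup_right : N ≤ K ⊔ N), relIndex_sup_right]
  exact mul_dvd_mul_left _ (relIndex_dvd_card _ _)

theorem IsPiNumber.card_sup {K N : Subgroup G} [N.Normal] (hK : IsPiNumber σ (Nat.card K))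
    (hN : IsPiNumber σ (Nat.card N)) : IsPiNumber σ (Nat.card (K ⊔ N : Subgroup G)) :=
  (hN.mul hK).of_dvd (Subgroup.card_sup_dvd' K N)

/-- Sections over subgroups of order coprime to the kernel. -/
theorem exists_section_of_coprime [Finite G] (f : G →* H) (hf : Function.Surjective f)
    (P : Subgroup H) (hP : (Nat.card f.ker).Coprime (Nat.card P)) :
    ∃ s : P →* G, ∀ x, f (s x) = x := by
  set M := P.comap f
  let f' : M →* P := f.subgroupComap P
  have hf' : Function.Surjective f' := f.subgroupComap_surjective_of_surjective P hf
  have hidx : f'.ker.index = Nat.card P := by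
    rw [Subgroup.index_ker, MonoidHom.range_eq_top.mpr hf', Subgroup.card_top]
  have hker : Nat.card f'.ker ∣ Nat.card f.ker := by
    have e : f'.ker = f.ker.comap M.subtype := by
      ext x
      simp only [MonoidHom.mem_ker, Subgroup.mem_comap, Subgroup.coe_subtype, Subtype.ext_iff]
      rfl
    rw [e]
    exact Subgroup.card_comap_dvd_of_injective _ _ M.subtype_injective
  obtain ⟨C, hC⟩ := Subgroup.exists_right_complement'_of_coprime (N := f'.ker)
    (by rw [hidx]; exact Nat.Coprime.of_dvd_left hker hP)
  have hinj : Function.Injective (f'.comp C.subtype) := by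
    rw [injective_iff_map_eq_one]
    intro x hx
    have := hC.disjoint.le_bot ⟨(hx : (x : M) ∈ f'.ker), x.2⟩
    exact Subtype.ext (Subgroup.mem_bot.mp this)
  have hsurj : Function.Surjective (f'.comp C.subtype) := by
    intro y
    obtain ⟨x, rfl⟩ := hf' y
    obtain ⟨⟨k, c⟩, hkc⟩ := hC.2 x
    refine ⟨c, ?_⟩
    rw [← hkc]
    have hk : f' k = 1 := k.2
    simp [hk]
  let e := MulEquiv.ofBijective _ ⟨hinj, hsurj⟩
  refine ⟨(M.subtype.comp C.subtype).comp e.symm.toMonoidHom, fun x => ?_⟩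
  have := e.apply_symm_apply x
  exact congrArg Subtype.val this

theorem exists_piElt_map_eq [Finite G] (f : G →* H) (hf : Function.Surjective f)
    (hk : IsPiNumber σᶜ (Nat.card f.ker)) {b : H} (hb : IsPiElt σ b) :
    ∃ a, IsPiElt σ a ∧ f a = b := by
  obtain ⟨s, hs⟩ := exists_section_of_coprime f hf (Subgroup.zpowers b)
    (by rw [Nat.card_zpowers]; exact (IsPiNumber.coprime hb hk).symm)
  have hb' : IsPiElt σ (⟨b, Subgroup.mem_zpowers b⟩ : Subgroup.zpowers b) := isPiElt_coe.mp hb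
  exact ⟨_, hb'.map s, hs _⟩

/-- Elements of the same order coprime to the kernel, with the same image, are conjugate under
the kernel. -/
theorem exists_conj_of_map_eq (n : ℕ) : ∀ (A B : Type) [Group A] [Group B] [Finite A]
    (f : A →* B) (a a' : A), (Nat.card f.ker).Coprime n → orderOf a = n → orderOf a' = n →
    f a = f a' → ∃ e, f e = 1 ∧ e * a * e⁻¹ = a' := by
  induction n using Nat.recOnPosPrimePosCoprime with
  | zero =>
    intro A B _ _ _ f a a' _ h
    exact absurd h (orderOf_pos a).ne'
  | one =>
    intro A B _ _ _ f a a' _ h h' _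
    rw [orderOf_eq_one_iff] at h h'
    exact ⟨1, map_one f, by simp [h, h']⟩
  | prime_pow p k hp hk =>
    intro A B _ _ _ f a a' hc ha ha' hf
    have := Fact.mk hp
    set M := (Subgroup.zpowers (f a)).comap f
    have haM : a ∈ M := Subgroup.mem_zpowers (f a)
    have haM' : a' ∈ M := by
      rw [Subgroup.mem_comap, ← hf]; exact Subgroup.mem_zpowers (f a)
    have hz : ∀ (x : M), orderOf x = p ^ k → IsPGroup p (Subgroup.zpowers x) := fun x hx =>
      IsPGroup.of_card (n := k) (by rw [Nat.card_zpowers, hx])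
    obtain ⟨P, hP⟩ := (hz ⟨a, haM⟩ (by rwa [← Subgroup.orderOf_coe])).exists_le_sylow
    obtain ⟨P', hP'⟩ := (hz ⟨a', haM'⟩ (by rwa [← Subgroup.orderOf_coe])).exists_le_sylow
    obtain ⟨g, hg⟩ := MulAction.exists_smul_eq M P P'
    obtain ⟨i, hi⟩ := Subgroup.mem_zpowers_iff.mp (show f g ∈ Subgroup.zpowers (f a) from g.2)
    have h1 : g * ⟨a, haM⟩ * g⁻¹ ∈ P' := by
      rw [← hg]
      exact ⟨⟨a, haM⟩, hP (Subgroup.mem_zpowers _), rfl⟩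
    have h2 : (⟨a', haM'⟩ : M) ∈ P' := hP' (Subgroup.mem_zpowers _)
    have h3 : f ((g : A) * a * (g : A)⁻¹) = f a := by
      rw [map_mul, map_mul, map_inv, ← hi]; group
    refine ⟨g * a ^ (-i), by rw [map_mul, ← hi, map_zpow]; group, ?_⟩
    have h4 : (g : A) * a ^ (-i) * a * (g * a ^ (-i) : A)⁻¹ = g * a * (g : A)⁻¹ := by group
    rw [h4]
    obtain ⟨j, hj⟩ := P'.2 ⟨_, P'.1.mul_mem h1 (P'.1.inv_mem h2)⟩
    have h5 : ((g : A) * a * (g : A)⁻¹ * a'⁻¹) ^ p ^ j = 1 :=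
      congrArg (fun z : P' => ((z : M) : A)) hj
    have h6 : (g : A) * a * (g : A)⁻¹ * a'⁻¹ ∈ f.ker := by
      rw [MonoidHom.mem_ker, map_mul, h3, hf, map_inv, mul_inv_cancel]
    have h7 := Nat.eq_one_of_dvd_coprimes
      (Nat.Coprime.pow_right j ((Nat.coprime_pow_right_iff hk _ _).mp hc))
      (Subgroup.orderOf_dvd_natCard _ h6) (orderOf_dvd_of_pow_eq_one h5)
    rwa [orderOf_eq_one_iff, mul_inv_eq_one] at h7
  | coprime x y hx hy hxy ihx ihy =>
    intro A B _ _ _ f a a' hc ha ha' hf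
    have hox : ∀ g : A, orderOf g = x * y → orderOf (g ^ y) = x := fun g hg => by
      rw [orderOf_pow_of_dvd (by lia) (by rw [hg]; exact dvd_mul_left _ _), hg,
        Nat.mul_div_cancel _ (by lia)]
    have hoy : ∀ g : A, orderOf g = x * y → orderOf (g ^ x) = y := fun g hg => by
      rw [orderOf_pow_of_dvd (by lia) (by rw [hg]; exact dvd_mul_right _ _), hg,
        Nat.mul_div_cancel_left _ (by lia)]
    obtain ⟨e₁, he₁, h1⟩ := ihx A B f (a ^ y) (a' ^ y) hc.coprime_mul_right_right (hox a ha)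
      (hox a' ha') (by rw [map_pow, map_pow, hf])
    set b := e₁ * a * e₁⁻¹ with hb
    have hby : b ^ y = a' ^ y := by rw [hb, conj_pow, h1]
    have hob : orderOf b = x * y := by
      rw [← ha]; exact orderOf_injective (MulAut.conj e₁).toMonoidHom (MulAut.conj e₁).injective a
    set C := Subgroup.centralizer {a' ^ y}
    have hbC : b ^ x ∈ C := by
      rw [Subgroup.mem_centralizer_singleton_iff, ← hby, ← pow_add, ← pow_add, add_comm]
    have haC : a' ^ x ∈ C := by
      rw [Subgroup.mem_centralizer_singleton_iff, ← pow_add, ← pow_add, add_comm]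
    obtain ⟨⟨e₂, he₂C⟩, he₂, h2⟩ := ihy C B (f.comp C.subtype) ⟨_, hbC⟩ ⟨_, haC⟩
      (by
        refine Nat.Coprime.of_dvd_left ?_ hc.coprime_mul_left_right
        rw [← MonoidHom.comap_ker]
        exact Subgroup.card_comap_dvd_of_injective _ _ C.subtype_injective)
      (by rw [← Subgroup.orderOf_coe]; exact hoy b hob)
      (by rw [← Subgroup.orderOf_coe]; exact hoy a' ha')
      (by
        simp only [MonoidHom.comp_apply, Subgroup.coe_subtype, map_pow, hb, map_mul, he₁, map_inv]
        simp [hf])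
    replace he₂ : f e₂ = 1 := he₂
    replace h2 : e₂ * b ^ x * e₂⁻¹ = a' ^ x := congrArg Subtype.val h2
    have h3 : e₂ * b ^ y * e₂⁻¹ = a' ^ y := by
      rw [Subgroup.mem_centralizer_singleton_iff] at he₂C
      rw [hby, he₂C]; group
    refine ⟨e₂ * e₁, by rw [map_mul, he₁, he₂, one_mul], ?_⟩
    have h4 : e₂ * e₁ * a * (e₂ * e₁)⁻¹ = e₂ * b * e₂⁻¹ := by rw [hb]; group
    rw [h4]
    set c := e₂ * b * e₂⁻¹ with hcdef
    rw [← conj_pow, ← hcdef] at h2 h3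
    have hbez : (x : ℤ) * Nat.gcdA x y + y * Nat.gcdB x y = 1 := by
      rw [← Nat.gcd_eq_gcd_ab, hxy]; rfl
    rw [← zpow_one c, ← zpow_one a', ← hbez, zpow_add, zpow_add, zpow_mul, zpow_mul, zpow_mul,
      zpow_mul, zpow_natCast, zpow_natCast, zpow_natCast, zpow_natCast, h2, h3]

end PiElements

section Separable

variable {σ : Set ℕ}

/-- Subgroups reached from `⊥` by a series whose factors are `σ`-groups or `σ'`-groups. -/
inductive SepTo (σ : Set ℕ) {G : Type} [Group G] : Subgroup G → Prop
  | bot : SepTo σ ⊥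
  | step (H K : Subgroup G) : SepTo σ H → H ≤ K → (H.subgroupOf K).Normal →
      (IsPiNumber σ (H.relIndex K) ∨ IsPiNumber σᶜ (H.relIndex K)) → SepTo σ K

/-- Inductive form of `IsPiSeparable`. -/
def IsSep (σ : Set ℕ) (G : Type) [Group G] : Prop := SepTo σ (⊤ : Subgroup G)

variable {G H : Type} [Group G] [Group H]

theorem IsPiSeparable.isSep (h : IsPiSeparable σ G) : IsSep σ G := by
  obtain ⟨n, c, h0, h1, hc⟩ := h
  have : ∀ i : Fin (n + 1), SepTo σ (c i) := by
    intro i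
    induction i using Fin.induction with
    | zero => rw [h0]; exact .bot
    | succ i ih => exact .step _ _ ih (hc i).1 (hc i).2.1 (hc i).2.2
  unfold IsSep
  rw [← h1]
  exact this _

theorem SepTo.map {K : Subgroup G} (h : SepTo σ K) (f : G →* H) : SepTo σ (K.map f) := by
  induction h with
  | bot => rw [Subgroup.map_bot]; exact .bot
  | step K L _ hle hn hs ih =>
    have hd : (K.map f).relIndex (L.map f) ∣ K.relIndex L := by
      rw [Subgroup.relIndex, ← Subgroup.index_comap_of_surjective _ (f.subgroupMap_surjective L)]
      exact Subgroup.index_dvd_of_le fun x hx => ⟨x, hx, rfl⟩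
    refine .step _ _ ih (Subgroup.map_mono hle) ?_ (hs.imp (·.of_dvd hd) (·.of_dvd hd))
    rw [Subgroup.normal_subgroupOf_iff (Subgroup.map_mono hle)]
    rw [Subgroup.normal_subgroupOf_iff hle] at hn
    rintro _ _ ⟨x, hx, rfl⟩ ⟨y, hy, rfl⟩
    exact ⟨y * x * y⁻¹, hn _ _ hx hy, by simp⟩

theorem SepTo.comap {K : Subgroup H} (h : SepTo σ K) (f : G →* H) (hk : SepTo σ f.ker) :
    SepTo σ (K.comap f) := by
  induction h with
  | bot => rwa [MonoidHom.comap_bot]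
  | step K L _ hle hn hs ih =>
    have hd : (K.comap f).relIndex (L.comap f) ∣ K.relIndex L := by
      rw [Subgroup.relIndex_comap, Subgroup.map_comap_eq, inf_comm,
        ← Subgroup.relIndex_subgroupOf inf_le_left]
      exact Subgroup.relIndex_dvd_index_of_normal _ _
    refine .step _ _ ih (Subgroup.comap_mono hle) ?_ (hs.imp (·.of_dvd hd) (·.of_dvd hd))
    rw [Subgroup.normal_subgroupOf_iff (Subgroup.comap_mono hle)]
    rw [Subgroup.normal_subgroupOf_iff hle] at hn
    intro x y hx hy
    simpa using hn _ _ hx hy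

theorem IsSep.of_injective (h : IsSep σ H) (f : G →* H) (hf : Function.Injective f) :
    IsSep σ G := by
  have := SepTo.comap h f (by rw [(MonoidHom.ker_eq_bot_iff f).mpr hf]; exact .bot)
  rwa [Subgroup.comap_top] at this

theorem IsSep.subgroup (h : IsSep σ G) (K : Subgroup G) : IsSep σ K :=
  h.of_injective K.subtype K.subtype_injective

theorem IsSep.of_surjective (h : IsSep σ G) (f : G →* H) (hf : Function.Surjective f) :
    IsSep σ H := by
  have := SepTo.map h f
  rwa [Subgroup.map_top_of_surjective f hf] at this

theorem IsSep.of_ker (h : IsSep σ H) (f : G →* H) (hf : IsPiNumber σ (Nat.card f.ker)) :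
    IsSep σ G := by
  have hk : SepTo σ f.ker := .step ⊥ _ .bot bot_le (by
    rw [Subgroup.bot_subgroupOf]; infer_instance) (Or.inl (by rwa [Subgroup.relIndex_bot_left]))
  have := SepTo.comap h f hk
  rwa [Subgroup.comap_top] at this

/-- The largest normal `τ`-subgroup of `K`, as a subgroup invariant under all automorphisms
preserving `K`. -/
theorem exists_max_normal [Finite G] (τ : Set ℕ) (K : Subgroup G) :
    ∃ M ≤ K, IsPiNumber τ (Nat.card M) ∧ (∀ x ∈ K, ∀ m ∈ M, x * m * x⁻¹ ∈ M) ∧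
      ∀ M' ≤ K, IsPiNumber τ (Nat.card M') → (∀ x ∈ K, ∀ m ∈ M', x * m * x⁻¹ ∈ M') → M' ≤ M := by
  let P : Subgroup G → Prop := fun M => M ≤ K ∧ IsPiNumber τ (Nat.card M) ∧
    ∀ x ∈ K, ∀ m ∈ M, x * m * x⁻¹ ∈ M
  obtain ⟨M, hM, hmax⟩ := (Set.toFinite {M | P M}).exists_maximal
    ⟨⊥, bot_le, by rw [Subgroup.card_bot]; exact isPiNumber_one, by simp⟩
  refine ⟨M, hM.1, hM.2.1, hM.2.2, fun M' h1 h2 h3 => ?_⟩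
  have hP : P (M' ⊔ M) := by
    refine ⟨sup_le h1 hM.1, ?_, fun x hx => ?_⟩
    · have hn : (M.subgroupOf K).Normal := by
        rw [Subgroup.normal_subgroupOf_iff hM.1]
        exact fun m x hm hx => hM.2.2 x hx m hm
      have e : ∀ L ≤ K, Nat.card (L.subgroupOf K) = Nat.card L := fun L hL =>
        Nat.card_congr (Subgroup.subgroupOfEquivOfLe hL).toEquiv
      rw [← e _ (sup_le h1 hM.1), Subgroup.subgroupOf_sup h1 hM.1]
      exact IsPiNumber.card_sup (by rwa [e _ h1]) (by rw [e _ hM.1]; exact hM.2.1)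
    · change M' ⊔ M ≤ (M' ⊔ M).comap (MulAut.conj x).toMonoidHom
      exact sup_le (fun m hm => Subgroup.mem_sup_left (h3 x hx m hm))
        fun m hm => Subgroup.mem_sup_right (hM.2.2 x hx m hm)
  exact le_sup_left.trans (hmax hP le_sup_right)

theorem SepTo.exists_normal [Finite G] {K : Subgroup G} (h : SepTo σ K) (hK : K ≠ ⊥) :
    ∃ M ≤ K, M ≠ ⊥ ∧ (IsPiNumber σ (Nat.card M) ∨ IsPiNumber σᶜ (Nat.card M)) ∧
      ∀ g : G, (∀ x ∈ K, g * x * g⁻¹ ∈ K) → ∀ m ∈ M, g * m * g⁻¹ ∈ M := by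
  induction h with
  | bot => exact absurd rfl hK
  | step L K _ hle hn hs ih =>
    by_cases hL : L = ⊥
    · subst hL
      rw [Subgroup.relIndex_bot_left] at hs
      exact ⟨K, le_rfl, hK, hs, fun g hg => hg⟩
    obtain ⟨M, hML, hM0, hMs, hMi⟩ := ih hL
    rw [Subgroup.normal_subgroupOf_iff hle] at hn
    obtain ⟨τ, hτ, hMτ⟩ : ∃ τ : Set ℕ, (τ = σ ∨ τ = σᶜ) ∧ IsPiNumber τ (Nat.card M) := by
      rcases hMs with h | h
      exacts [⟨_, Or.inl rfl, h⟩, ⟨_, Or.inr rfl, h⟩]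
    obtain ⟨O, hOK, hOτ, hOn, hOmax⟩ := exists_max_normal τ K
    refine ⟨O, hOK, fun hO => hM0 ?_, ?_, fun g hg m hm => ?_⟩
    · rw [← le_bot_iff, ← hO]
      exact hOmax M (hML.trans hle) hMτ fun x hx => hMi x fun y hy => hn y x hy hx
    · rcases hτ with rfl | rfl
      exacts [Or.inl hOτ, Or.inr hOτ]
    · have hle' : K.map (MulAut.conj g).toMonoidHom ≤ K := by
        rintro _ ⟨x, hx, rfl⟩; exact hg x hx
      have heq : K.map (MulAut.conj g).toMonoidHom = K :=
        Subgroup.eq_of_le_of_card_ge hle'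
          (Subgroup.card_map_of_injective (MulAut.conj g).injective).ge
      refine hOmax (O.map (MulAut.conj g).toMonoidHom) ?_ ?_ ?_ ⟨m, hm, rfl⟩
      · rw [← heq]; exact Subgroup.map_mono hOK
      · exact hOτ.of_dvd (Subgroup.card_map_dvd _ _)
      · rintro x hx _ ⟨y, hy, rfl⟩
        rw [← heq] at hx
        obtain ⟨z, hz, rfl⟩ := hx
        exact ⟨z * y * z⁻¹, hOn z hz y hy, by simp [mul_assoc]⟩

theorem IsSep.exists_normal_lt [Finite G] (h : IsSep σ G) (E : Subgroup G) [E.Normal]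
    (hE : E ≠ ⊤) : ∃ L : Subgroup G, L.Normal ∧ E < L ∧
      (IsPiNumber σ (E.relIndex L) ∨ IsPiNumber σᶜ (E.relIndex L)) := by
  have hq := h.of_surjective (QuotientGroup.mk' E) (QuotientGroup.mk'_surjective E)
  obtain ⟨M, -, hM0, hMs, hMi⟩ := SepTo.exists_normal hq (fun e => hE (by
    rw [← QuotientGroup.ker_mk' E, ← MonoidHom.comap_bot, ← e, Subgroup.comap_top]))
  have hMn : M.Normal := ⟨fun m hm g => hMi g (fun _ _ => Subgroup.mem_top _) m hm⟩
  have hidx : E.relIndex (M.comap (QuotientGroup.mk' E)) = Nat.card M := by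
    have h0 : (⊥ : Subgroup (G ⧸ E)).comap (QuotientGroup.mk' E) = E := by
      rw [MonoidHom.comap_bot, QuotientGroup.ker_mk']
    have := Subgroup.relIndex_comap ⊥ (QuotientGroup.mk' E) (M.comap (QuotientGroup.mk' E))
    rwa [h0, Subgroup.map_comap_eq_self_of_surjective (QuotientGroup.mk'_surjective E),
      Subgroup.relIndex_bot_left] at this
  refine ⟨M.comap (QuotientGroup.mk' E), inferInstance, lt_of_le_of_ne ?_ fun e => hM0 ?_, ?_⟩
  · intro x hx
    rw [Subgroup.mem_comap, QuotientGroup.mk'_apply, (QuotientGroup.eq_one_iff x).mpr hx]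
    exact M.one_mem
  · rw [← e, Subgroup.relIndex_self] at hidx
    exact Subgroup.card_eq_one.mp hidx.symm
  · rwa [hidx]

end Separable

section LocalCharacters

variable {σ : Set ℕ} {G H : Type} [Group G] [Group H]

/-- Class functions supported on `σ`-elements whose restrictions to `σ`-subgroups are
characters. -/
structure IsLocChar (σ : Set ℕ) (G : Type) [Group G] (φ : G → ℂ) : Prop where
  conj : ∀ x g, φ (x * g * x⁻¹) = φ g
  zero : ∀ g, ¬ IsPiElt σ g → φ g = 0
  res : ∀ P : Subgroup G, IsPiNumber σ (Nat.card P) → IsCharacter P (resChar P φ)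

theorem IsCharacter.isLocChar {χ : G → ℂ} (h : IsCharacter G χ) :
    IsLocChar σ G (piRestrict σ χ) where
  conj x g := by simp only [piRestrict, isPiElt_conj, h.map_conj]
  zero g hg := if_neg hg
  res P hP := (h.comp P.subtype).of_eq fun g => if_pos (isPiElt_of_mem hP g.2)

theorem IsPiNumber.card_range [Finite G] (h : IsPiNumber σ (Nat.card G)) (f : G →* H) :
    IsPiNumber σ (Nat.card f.range) :=
  h.of_dvd (Subgroup.card_range_dvd f)

theorem IsLocChar.comp_hom [Finite G] {φ : H → ℂ} (h : IsLocChar σ H φ)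
    (hG : IsPiNumber σ (Nat.card G)) (f : G →* H) : IsCharacter G (fun g => φ (f g)) :=
  (h.res f.range (hG.card_range f)).comp f.rangeRestrict

theorem IsLocChar.mul {φ φ' : G → ℂ} (h : IsLocChar σ G φ) (h' : IsLocChar σ G φ') :
    IsLocChar σ G (φ * φ') where
  conj x g := by simp only [Pi.mul_apply, h.conj, h'.conj]
  zero g hg := by simp only [Pi.mul_apply, h.zero g hg, zero_mul]
  res P hP := (h.res P hP).mul (h'.res P hP)

theorem IsLocChar.comp_injective [Finite G] {φ : H → ℂ} (h : IsLocChar σ H φ) (f : G →* H)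
    (hf : Function.Injective f) : IsLocChar σ G (fun g => φ (f g)) where
  conj x g := by simp only [map_mul, map_inv, h.conj]
  zero g hg := h.zero _ (by rwa [isPiElt_map_iff hf])
  res P hP := h.comp_hom hP (f.comp P.subtype)

theorem IsLocChar.exists_nat {φ : G → ℂ} (h : IsLocChar σ G φ) : ∃ n : ℕ, φ 1 = n :=
  (h.res ⊥ (by rw [Subgroup.card_bot]; exact isPiNumber_one)).exists_nat

theorem IsLocChar.eq_zero [Finite G] {φ : G → ℂ} (h : IsLocChar σ G φ) (h1 : φ 1 = 0) :
    φ = 0 := by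
  funext g
  by_cases hg : IsPiElt σ g
  · have := (h.res (Subgroup.zpowers g) (by rwa [Nat.card_zpowers])).eq_zero_of_map_one h1
    exact congrFun this ⟨g, Subgroup.mem_zpowers g⟩
  · exact h.zero g hg

theorem IsPiElt.orderOf_map {f : G →* H} [Finite G] (hk : IsPiNumber σᶜ (Nat.card f.ker)) {g : G}
    (hg : IsPiElt σ g) : orderOf (f g) = orderOf g := by
  refine Nat.dvd_antisymm (orderOf_map_dvd f g) (orderOf_dvd_of_pow_eq_one ?_)
  exact (hg.pow _).eq_one (isPiElt_of_mem hk (by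
    rw [MonoidHom.mem_ker, map_pow, pow_orderOf_eq_one]))

theorem IsLocChar.eq_of_map_eq [Finite G] {φ : G → ℂ} (h : IsLocChar σ G φ) {f : G →* H}
    (hk : IsPiNumber σᶜ (Nat.card f.ker)) {a a' : G} (ha : IsPiElt σ a) (ha' : IsPiElt σ a')
    (e : f a = f a') : φ a = φ a' := by
  obtain ⟨x, -, rfl⟩ := exists_conj_of_map_eq (orderOf a) G H f a a'
    (IsPiNumber.coprime ha hk).symm rfl
    (by rw [← ha'.orderOf_map hk, ← e, ha.orderOf_map hk]) e
  exact (h.conj x a).symm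

/-- Local characters factor through quotients with `σ'`-kernel. -/
theorem IsLocChar.exists_quotient [Finite G] {φ : G → ℂ} (h : IsLocChar σ G φ) (f : G →* H)
    (hf : Function.Surjective f) (hk : IsPiNumber σᶜ (Nat.card f.ker)) :
    ∃ φ', IsLocChar σ H φ' ∧ ∀ a, IsPiElt σ a → φ a = φ' (f a) := by
  choose s hs1 hs2 using fun b : {b : H // IsPiElt σ b} => exists_piElt_map_eq f hf hk b.2
  have hφ : ∀ a, IsPiElt σ a →
      φ a = (fun b => if hb : IsPiElt σ b then φ (s ⟨b, hb⟩) else 0) (f a) := fun a ha => by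
    simp only [ha.map f, dite_true]
    exact h.eq_of_map_eq hk ha (hs1 _) (hs2 ⟨f a, ha.map f⟩).symm
  refine ⟨fun b => if hb : IsPiElt σ b then φ (s ⟨b, hb⟩) else 0,
    ⟨fun x b => ?_, fun b hb => dif_neg hb, fun P hP => ?_⟩, hφ⟩
  · by_cases hb : IsPiElt σ b
    · obtain ⟨a, ha, rfl⟩ := exists_piElt_map_eq f hf hk hb
      obtain ⟨y, rfl⟩ := hf x
      refine Eq.trans ?_ ((h.conj y a).trans (hφ a ha))
      rw [hφ _ (isPiElt_conj.mpr ha), map_mul, map_mul, map_inv]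
    · rw [dif_neg hb, dif_neg (by rwa [isPiElt_conj])]
  · obtain ⟨t, ht⟩ := exists_section_of_coprime f hf P (hP.coprime hk).symm
    have := Finite.of_surjective f hf
    refine (h.comp_hom hP t).of_eq fun x => ?_
    rw [hφ _ ((isPiElt_of_card hP x).map t), ht]
    rfl

theorem exists_comp_surjective {A B C : Type} {f : A → B} (hf : Function.Surjective f) (F : A → C)
    (h : ∀ a a', f a = f a' → F a = F a') : ∃ F' : B → C, ∀ a, F' (f a) = F a :=
  ⟨fun b => F (Function.surjInv hf b), fun a => h _ _ (Function.surjInv_eq hf (f a))⟩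

theorem card_comap_of_surjective {f : G →* H} (hf : Function.Surjective f) (P : Subgroup H) :
    Nat.card (P.comap f) = Nat.card f.ker * Nat.card P := by
  have hle : f.ker ≤ P.comap f := fun x hx => by
    rw [Subgroup.mem_comap, MonoidHom.mem_ker.mp hx]; exact P.one_mem
  rw [← Subgroup.card_mul_relIndex' hle]
  have := Subgroup.relIndex_comap ⊥ f (P.comap f)
  rw [MonoidHom.comap_bot, Subgroup.map_comap_eq_self_of_surjective hf,
    Subgroup.relIndex_bot_left] at this
  rw [this]

/-- Averaging over a `σ`-kernel. -/
theorem IsLocChar.deflate [Fintype G] {φ : G → ℂ} (h : IsLocChar σ G φ) (f : G →* H)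
    (hf : Function.Surjective f) (hk : IsPiNumber σ (Nat.card f.ker)) :
    ∃ φ', IsLocChar σ H φ' ∧
      ∀ a, φ' (f a) = (Nat.card f.ker : ℂ)⁻¹ * ∑ k : f.ker, φ (a * k) := by
  obtain ⟨φ', hφ'⟩ := exists_comp_surjective hf
    (fun a => (Nat.card f.ker : ℂ)⁻¹ * ∑ k : f.ker, φ (a * k)) (fun a a' e => by
      have hm : a⁻¹ * a' ∈ f.ker := by rw [MonoidHom.mem_ker, map_mul, map_inv, e]; group
      congr 1
      refine Fintype.sum_equiv (Equiv.mulLeft (⟨_, hm⟩ : f.ker)⁻¹) _ _ fun k => ?_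
      simp [mul_assoc])
  refine ⟨φ', ⟨fun x b => ?_, fun b hb => ?_, fun P hP => ?_⟩, hφ'⟩
  · obtain ⟨a, rfl⟩ := hf b
    obtain ⟨y, rfl⟩ := hf x
    rw [← map_mul, ← map_inv, ← map_mul, hφ', hφ']
    congr 1
    refine Fintype.sum_equiv (MulAut.conjNormal y⁻¹ : MulAut f.ker).toEquiv _ _ fun k => ?_
    rw [← h.conj y (a * _)]
    congr 1
    simp [mul_assoc]
  · obtain ⟨a, rfl⟩ := hf b
    rw [hφ', Finset.sum_eq_zero, mul_zero]
    intro k _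
    refine h.zero _ fun hak => hb ?_
    have := hak.map f
    rwa [map_mul, MonoidHom.mem_ker.mp k.2, mul_one] at this
  · have hM : IsPiNumber σ (Nat.card (P.comap f)) := by
      rw [card_comap_of_surjective hf]; exact hk.mul hP
    have hsurj : Function.Surjective (f.subgroupComap P) := fun x => by
      obtain ⟨a, ha⟩ := hf x
      exact ⟨⟨a, by rw [Subgroup.mem_comap, ha]; exact x.2⟩, Subtype.ext ha⟩
    obtain ⟨χ, hχ, hχ'⟩ := (h.res _ hM).deflate (f.subgroupComap P) hsurj
    refine hχ.of_eq fun x => ?_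
    obtain ⟨a, rfl⟩ := hsurj x
    rw [hχ']
    change φ' (f a) = _
    rw [hφ']
    have hmem : ∀ k : f.ker, (k : G) ∈ P.comap f := fun k => by
      rw [Subgroup.mem_comap, MonoidHom.mem_ker.mp k.2]; exact P.one_mem
    let eqv : (f.subgroupComap P).ker ≃ f.ker :=
      { toFun := fun k => ⟨k.1.1, by
          have := MonoidHom.mem_ker.mp k.2
          exact congrArg Subtype.val this⟩
        invFun := fun k => ⟨⟨k.1, hmem k⟩, Subtype.ext (MonoidHom.mem_ker.mp k.2)⟩
        left_inv := fun _ => rfl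
        right_inv := fun _ => rfl }
    rw [Nat.card_congr eqv]
    congr 1
    exact @Fintype.sum_equiv _ _ ℂ (_) (_) _ eqv.symm (fun k => φ (a.1 * k.1))
      (fun k => resChar (P.comap f) φ (a * k.1)) fun k => rfl

/-- Every local character comes from a character. -/
def HasLifts (σ : Set ℕ) (G : Type) [Group G] : Prop :=
  ∀ φ, IsLocChar σ G φ → ∃ χ, IsCharacter G χ ∧ φ = piRestrict σ χ

theorem HasLifts.of_quotient [Finite G] (f : G →* H)
    (hf : Function.Surjective f) (hk : IsPiNumber σᶜ (Nat.card f.ker)) (h : HasLifts σ H) :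
    HasLifts σ G := by
  intro φ hφ
  obtain ⟨φ', hφ', e⟩ := hφ.exists_quotient f hf hk
  obtain ⟨χ, hχ, rfl⟩ := h φ' hφ'
  refine ⟨_, hχ.comp f, funext fun a => ?_⟩
  by_cases ha : IsPiElt σ a
  · rw [e a ha]
    simp only [piRestrict, ha, ha.map f, if_true]
  · rw [hφ.zero a ha, piRestrict, if_neg ha]

theorem isPiElt_mul_iff [Finite G] {N : Subgroup G} [N.Normal] (hN : IsPiNumber σ (Nat.card N))
    (g : G) {n : G} (hn : n ∈ N) : IsPiElt σ (g * n) ↔ IsPiElt σ g := by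
  have hk : IsPiNumber σ (Nat.card (QuotientGroup.mk' N).ker) := by rwa [QuotientGroup.ker_mk']
  have e : QuotientGroup.mk' N (g * n) = QuotientGroup.mk' N g := by
    rw [map_mul, QuotientGroup.mk'_apply N n, (QuotientGroup.eq_one_iff n).mpr hn, mul_one]
  exact ⟨fun h => isPiElt_of_ker _ hk (e ▸ h.map _), fun h => isPiElt_of_ker _ hk (e ▸ h.map _)⟩

end LocalCharacters

section IsotypicParts

variable {σ : Set ℕ} {E G : Type} [Group E] [Group G]

theorem IsIrrChar.comp_mulEquiv {δ : E → ℂ} (h : IsIrrChar E δ) (f : G ≃* E) :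
    IsIrrChar G (fun x => δ (f x)) := by
  refine ⟨h.1.comp f.toMonoidHom, fun h0 => h.2.1 (funext fun x => ?_), ?_⟩
  · simpa using congrFun h0 (f.symm x)
  · rintro ⟨χ₁, χ₂, h1, h1', h2, h2', e⟩
    have hne : ∀ χ : G → ℂ, χ ≠ 0 → (fun x => χ (f.symm x)) ≠ 0 := fun χ hχ h0 =>
      hχ (funext fun x => by simpa using congrFun h0 (f x))
    exact h.2.2 ⟨_, _, h1.comp f.symm.toMonoidHom, hne _ h1', h2.comp f.symm.toMonoidHom,
      hne _ h2', funext fun x => by simpa using congrFun e (f.symm x)⟩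

variable [Fintype E]

/-- The `δ`-isotypic part of a class function with respect to `ι : E →* G`. -/
def isoPart (ι : E →* G) (δ : E → ℂ) (φ : G → ℂ) : G → ℂ :=
  fun g => δ 1 / Nat.card E * ∑ e, δ e⁻¹ * φ (g * ι e)

variable {ι : E →* G} {a : G →* MulAut E}

theorem isoPart_conj {δ : E → ℂ} {φ : G → ℂ} (hφ : ∀ x g, φ (x * g * x⁻¹) = φ g)
    (ha : ∀ g e, ι (a g e) = g * ι e * g⁻¹) (x g : G) :
    isoPart ι δ φ (x * g * x⁻¹) = isoPart ι (fun e => δ (a x e)) φ g := by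
  unfold isoPart
  beta_reduce
  rw [map_one]
  congr 1
  refine (Fintype.sum_equiv (a x).toEquiv _ _ fun e => ?_).symm
  change _ = δ (a x e)⁻¹ * φ (x * g * x⁻¹ * ι (a x e))
  rw [ha, ← hφ x (g * ι e), map_inv]
  congr 2
  group

theorem normal_range (ha : ∀ g e, ι (a g e) = g * ι e * g⁻¹) : ι.range.Normal :=
  ⟨by rintro _ ⟨e, rfl⟩ g; exact ⟨a g e, ha g e⟩⟩

theorem Representation.mul_isoProj {V : Type} [AddCommGroup V] [Module ℂ V] {M : Subgroup G}
    (hM : ∀ e, ι e ∈ M) (ρ : Representation ℂ M V) (δ : E → ℂ)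
    (ha : ∀ g e, ι (a g e) = g * ι e * g⁻¹) (m : M) :
    ρ m * isoProj (ρ.comp (ι.codRestrict M hM)) (fun e => δ (a m e)) =
      isoProj (ρ.comp (ι.codRestrict M hM)) δ * ρ m := by
  unfold isoProj
  beta_reduce
  rw [map_one, mul_smul_comm, smul_mul_assoc, Finset.mul_sum, Finset.sum_mul]
  congr 1
  refine Fintype.sum_equiv (a m).toEquiv _ _ fun e => ?_
  change _ = (δ (a m e)⁻¹ • ρ (ι.codRestrict M hM (a m e))) * ρ m
  rw [smul_mul_assoc, ← map_mul, mul_smul_comm, map_inv]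
  change _ • (ρ m * ρ _) = _
  rw [← map_mul]
  congr 2
  ext
  simp [ha]

theorem Representation.trace_mul_isoProj {V : Type} [AddCommGroup V] [Module ℂ V] {M : Subgroup G}
    (hM : ∀ e, ι e ∈ M) (ρ : Representation ℂ M V) (δ : E → ℂ) {φ : G → ℂ}
    (hρ : resChar M φ = ρ.character) (m : M) :
    LinearMap.trace ℂ V (ρ m * isoProj (ρ.comp (ι.codRestrict M hM)) δ) = isoPart ι δ φ m := by
  unfold isoProj isoPart
  rw [mul_smul_comm, Finset.mul_sum, map_smul, map_sum, smul_eq_mul]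
  congr 1
  refine Finset.sum_congr rfl fun e _ => ?_
  rw [mul_smul_comm, map_smul, smul_eq_mul]
  congr 1
  have := congrFun hρ (m * ι.codRestrict M hM e)
  rw [resChar, Representation.character, map_mul] at this
  exact this.symm

variable [Finite G]

/-- The subgroup generated by a `σ`-subgroup and a normal `σ`-subgroup, with a representation. -/
theorem IsLocChar.exists_rep_sup {φ : G → ℂ} (hφ : IsLocChar σ G φ)
    (ha : ∀ g e, ι (a g e) = g * ι e * g⁻¹) (hE : IsPiNumber σ (Nat.card E)) {P : Subgroup G}
    (hP : IsPiNumber σ (Nat.card P)) :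
    ∃ (M : Subgroup G) (_ : ∀ e, ι e ∈ M) (_ : P ≤ M) (V : Type) (_ : AddCommGroup V)
      (_ : Module ℂ V) (_ : FiniteDimensional ℂ V) (ρ : Representation ℂ M V),
      resChar M φ = ρ.character := by
  have := normal_range ha
  have hM : IsPiNumber σ (Nat.card (P ⊔ ι.range : Subgroup G)) :=
    IsPiNumber.card_sup hP (hE.card_range ι)
  obtain ⟨V, _, _, _, ρ, e⟩ := (hφ.res _ hM).exists_rep
  exact ⟨_, fun e => Subgroup.mem_sup_right (MonoidHom.mem_range.mpr ⟨e, rfl⟩), le_sup_left, V, _, _, inferInstance, ρ, e⟩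

theorem isoPart_zero {δ : E → ℂ} {φ : G → ℂ} (hφ : IsLocChar σ G φ)
    (ha : ∀ g e, ι (a g e) = g * ι e * g⁻¹) (hE : IsPiNumber σ (Nat.card E)) (g : G)
    (hg : ¬ IsPiElt σ g) : isoPart ι δ φ g = 0 := by
  have := normal_range ha
  unfold isoPart
  rw [Finset.sum_eq_zero, mul_zero]
  intro e _
  rw [hφ.zero, mul_zero]
  rwa [isPiElt_mul_iff (hE.card_range ι) g ⟨e, rfl⟩]

theorem IsLocChar.split {φ : G → ℂ} (hφ : IsLocChar σ G φ)
    (ha : ∀ g e, ι (a g e) = g * ι e * g⁻¹) (hE : IsPiNumber σ (Nat.card E))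
    (O : Finset (E → ℂ)) (hO : ∀ δ ∈ O, IsIrrChar E δ)
    (hst : ∀ g, ∀ δ ∈ O, (fun e => δ (a g e)) ∈ O) :
    IsLocChar σ G (∑ δ ∈ O, isoPart ι δ φ) ∧ IsLocChar σ G (φ - ∑ δ ∈ O, isoPart ι δ φ) := by
  have hre : ∀ {A : Type} [AddCommMonoid A] (F : (E → ℂ) → A) (g : G),
      ∑ δ ∈ O, F (fun e => δ (a g e)) = ∑ δ ∈ O, F δ := by
    intro A _ F g
    refine Finset.sum_nbij' (fun δ e => δ (a g e)) (fun δ e => δ (a g⁻¹ e)) (hst g) (hst g⁻¹)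
      ?_ ?_ fun _ _ => rfl
    · intro δ _; funext e; simp
    · intro δ _; funext e; simp
  have hconj : ∀ x g, (∑ δ ∈ O, isoPart ι δ φ) (x * g * x⁻¹) = (∑ δ ∈ O, isoPart ι δ φ) g := by
    intro x g
    rw [Finset.sum_apply, Finset.sum_apply]
    simp only [isoPart_conj hφ.conj ha]
    exact hre (fun δ => isoPart ι δ φ g) x
  have hzero : ∀ g, ¬ IsPiElt σ g → (∑ δ ∈ O, isoPart ι δ φ) g = 0 := by
    intro g hg
    rw [Finset.sum_apply]
    exact Finset.sum_eq_zero fun δ _ => isoPart_zero hφ ha hE g hg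
  have key : ∀ P : Subgroup G, IsPiNumber σ (Nat.card P) →
      IsCharacter P (resChar P (∑ δ ∈ O, isoPart ι δ φ)) ∧
        IsCharacter P (resChar P (φ - ∑ δ ∈ O, isoPart ι δ φ)) := by
    intro P hP
    obtain ⟨M, hM, hPM, V, _, _, _, ρ, e⟩ := hφ.exists_rep_sup ha hE hP
    set ρE := Representation.isoProj (ρ.comp (ι.codRestrict M hM)) with hρE
    set T := ∑ δ ∈ O, ρE δ with hTdef
    have hT : T * T = T := by
      rw [hTdef, Finset.sum_mul_sum]
      refine Finset.sum_congr rfl fun δ hδ => ?_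
      rw [Finset.sum_congr rfl fun δ' hδ' =>
        Representation.isoProj_mul _ (hO δ hδ) (hO δ' hδ'), Finset.sum_ite_eq, if_pos hδ]
    have hc : ∀ m, ρ m * T = T * ρ m := by
      intro m
      rw [hTdef, ← hre ρE m, Finset.mul_sum, hre ρE m, Finset.sum_mul]
      exact Finset.sum_congr rfl fun δ _ => ρ.mul_isoProj hM δ ha m
    have htr : ∀ m : M, LinearMap.trace ℂ V (ρ m * T) = (∑ δ ∈ O, isoPart ι δ φ) m := by
      intro m
      rw [hTdef, Finset.mul_sum, map_sum, Finset.sum_apply]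
      exact Finset.sum_congr rfl fun δ _ => ρ.trace_mul_isoProj hM δ e m
    constructor
    · refine ((ρ.isCharacter_trace_mul T hT hc).comp (Subgroup.inclusion hPM)).of_eq fun x => ?_
      rw [htr]; rfl
    · refine ((ρ.isCharacter_trace_mul (1 - T) ?_ fun m => ?_).comp
        (Subgroup.inclusion hPM)).of_eq fun x => ?_
      · rw [mul_sub, mul_one, sub_mul, one_mul, hT, sub_self, sub_zero]
      · rw [mul_sub, sub_mul, hc, mul_one, one_mul]
      · rw [mul_sub, map_sub, htr, mul_one]
        have := congrFun e (Subgroup.inclusion hPM x)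
        rw [Representation.character] at this
        rw [← this]; rfl
  refine ⟨⟨hconj, hzero, fun P hP => (key P hP).1⟩, ⟨fun x g => ?_, fun g hg => ?_,
    fun P hP => (key P hP).2⟩⟩
  · rw [Pi.sub_apply, Pi.sub_apply, hconj, hφ.conj]
  · rw [Pi.sub_apply, hzero g hg, hφ.zero g hg, sub_zero]

theorem isoPart_apply_eq_zero {δ : E → ℂ} {φ : G → ℂ} (hφ : IsLocChar σ G φ)
    (ha : ∀ g e, ι (a g e) = g * ι e * g⁻¹) (hE : IsPiNumber σ (Nat.card E))
    (hδ : IsIrrChar E δ) {g : G} (hg : (fun e => δ (a g e)) ≠ δ) : isoPart ι δ φ g = 0 := by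
  by_cases hgs : IsPiElt σ g
  swap
  · exact isoPart_zero hφ ha hE g hgs
  obtain ⟨M, hM, hPM, V, _, _, _, ρ, e⟩ :=
    hφ.exists_rep_sup ha hE (P := Subgroup.zpowers g) (by rwa [Nat.card_zpowers])
  set m : M := ⟨g, hPM (Subgroup.mem_zpowers g)⟩
  have hδ' : IsIrrChar E (fun e => δ (a g e)) := hδ.comp_mulEquiv (a g)
  have h1 := Representation.isoProj_mul (ρ.comp (ι.codRestrict M hM)) hδ hδ
  have h2 := Representation.isoProj_mul (ρ.comp (ι.codRestrict M hM)) hδ' hδ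
  have h3 := ρ.mul_isoProj hM δ ha m
  rw [if_pos rfl] at h1
  rw [if_neg hg] at h2
  have := ρ.trace_mul_isoProj hM δ e m
  rw [← this, ← h1, ← mul_assoc, LinearMap.trace_mul_comm, ← mul_assoc, ← h3, mul_assoc, h2,
    mul_zero, map_zero]

theorem isoPart_isoPart {δ : E → ℂ} {φ : G → ℂ} (hφ : IsLocChar σ G φ)
    (ha : ∀ g e, ι (a g e) = g * ι e * g⁻¹) (hE : IsPiNumber σ (Nat.card E))
    (hδ : IsIrrChar E δ) : isoPart ι δ (isoPart ι δ φ) = isoPart ι δ φ := by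
  funext g
  by_cases hgs : IsPiElt σ g
  swap
  · have := normal_range ha
    rw [isoPart, Finset.sum_eq_zero, mul_zero, isoPart_zero hφ ha hE g hgs]
    intro e _
    rw [isoPart_zero hφ ha hE, mul_zero]
    rwa [isPiElt_mul_iff (hE.card_range ι) g ⟨e, rfl⟩]
  obtain ⟨M, hM, hPM, V, _, _, _, ρ, e⟩ :=
    hφ.exists_rep_sup ha hE (P := Subgroup.zpowers g) (by rwa [Nat.card_zpowers])
  set m : M := ⟨g, hPM (Subgroup.mem_zpowers g)⟩
  have h1 := Representation.isoProj_mul (ρ.comp (ι.codRestrict M hM)) hδ hδ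
  rw [if_pos rfl] at h1
  have h2 : isoPart ι δ φ g = _ := (ρ.trace_mul_isoProj hM δ e m).symm
  have h3 := ρ.trace_mul_isoProj hM δ e
  rw [h2, ← h1]
  generalize hp : Representation.isoProj (ρ.comp (ι.codRestrict M hM)) δ = p at h3 ⊢
  have hp' : p * p = _ := congrArg (· * p) hp.symm
  rw [hp', Representation.isoProj, smul_mul_assoc, Finset.sum_mul, mul_smul_comm,
    Finset.mul_sum, map_smul, map_sum, smul_eq_mul, isoPart]
  congr 1
  refine Finset.sum_congr rfl fun x _ => ?_
  rw [smul_mul_assoc, mul_smul_comm, map_smul, smul_eq_mul, ← mul_assoc]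
  congr 1
  have := h3 (m * ι.codRestrict M hM x)
  rw [map_mul ρ] at this
  exact this.symm

theorem isoPart_apply_map {δ : E → ℂ} {φ : G → ℂ} (hφ : IsLocChar σ G φ)
    (hE : IsPiNumber σ (Nat.card E)) {s : Multiset (E → ℂ)} (hs : ∀ δ ∈ s, IsIrrChar E δ)
    (e : (fun x => φ (ι x)) = s.sum) (hδ : IsIrrChar E δ) (n : E) :
    isoPart ι δ φ (ι n) = s.count δ * δ n := by
  obtain ⟨V, _, _, _, ρ, h⟩ := (hφ.comp_hom hE ι).exists_rep
  rw [h] at e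
  rw [← ρ.trace_isoProj_mul hs e hδ n, Representation.isoProj, smul_mul_assoc, Finset.sum_mul,
    map_smul, map_sum, smul_eq_mul, isoPart]
  congr 1
  refine Finset.sum_congr rfl fun x _ => ?_
  have := congrFun h (n * x)
  rw [Representation.character, map_mul, map_mul] at this
  rw [smul_mul_assoc, map_smul, smul_eq_mul, LinearMap.trace_mul_comm, this]

end IsotypicParts

section Schur

variable {E : Type} [Group E] [Fintype E] {U : Type} [AddCommGroup U] [Module ℂ U]
  [FiniteDimensional ℂ U]

/-- The elementary endomorphisms of the chosen basis. -/
def LinearMap.elem (U : Type) [AddCommGroup U] [Module ℂ U] [FiniteDimensional ℂ U]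
    (i j : Fin (Module.finrank ℂ U)) : U →ₗ[ℂ] U :=
  ((Module.finBasis ℂ U).coord j).smulRight (Module.finBasis ℂ U i)

theorem LinearMap.trace_elem (i j : Fin (Module.finrank ℂ U)) :
    LinearMap.trace ℂ U (LinearMap.elem U i j) = if i = j then 1 else 0 := by
  rw [elem, LinearMap.trace_smulRight, Module.Basis.coord_apply, Module.Basis.repr_self,
    Finsupp.single_apply]

theorem LinearMap.trace_eq_sum_coord (A : U →ₗ[ℂ] U) :
    LinearMap.trace ℂ U A = ∑ i, (Module.finBasis ℂ U).coord i (A (Module.finBasis ℂ U i)) := by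
  rw [LinearMap.trace_eq_matrix_trace ℂ (Module.finBasis ℂ U), Matrix.trace]
  simp [LinearMap.toMatrix_apply]

theorem LinearMap.trace_mul_trace (A B : U →ₗ[ℂ] U) :
    LinearMap.trace ℂ U A * LinearMap.trace ℂ U B =
      ∑ i, ∑ j, LinearMap.trace ℂ U (A * elem U i j * B * elem U j i) := by
  rw [trace_eq_sum_coord A, trace_eq_sum_coord B, Finset.sum_mul_sum]
  refine Finset.sum_congr rfl fun i _ => Finset.sum_congr rfl fun j _ => ?_
  have : A * elem U i j * B * elem U j i = ((Module.finBasis ℂ U).coord i).smulRight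
      ((Module.finBasis ℂ U).coord j (B (Module.finBasis ℂ U j)) • A (Module.finBasis ℂ U i)) := by
    ext x
    simp only [elem, Module.End.mul_apply, LinearMap.smulRight_apply, map_smul]
  rw [this, LinearMap.trace_smulRight, map_smul, smul_eq_mul, mul_comm]

theorem Representation.average_comm (ρ ρ' : Representation ℂ E U) (X : U →ₗ[ℂ] U) (x : E) :
    ρ' x * (∑ e, ρ' e * X * ρ e⁻¹) = (∑ e, ρ' e * X * ρ e⁻¹) * ρ x := by
  rw [Finset.mul_sum, Finset.sum_mul]
  refine Fintype.sum_equiv (Equiv.mulLeft x) _ _ fun e => ?_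
  have h : ρ e⁻¹ = ρ (x * e)⁻¹ * ρ x := by rw [← map_mul]; congr 1; group
  rw [h, Equiv.coe_mulLeft, map_mul ρ']
  simp only [mul_assoc]

theorem Representation.sum_trace_mul_trace (ρ : Representation ℂ E U) [ρ.IsIrreducible]
    (T : (Module.End ℂ U)ˣ) :
    ∑ e, LinearMap.trace ℂ U (T.val * ρ e) * LinearMap.trace ℂ U (ρ e⁻¹ * T.inv) =
      Nat.card E := by
  have hnt : Nontrivial U := by
    by_contra hU
    rw [not_nontrivial_iff_subsingleton] at hU
    have h1 : ρ.character = 0 := funext fun g => by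
      rw [Representation.character, Subsingleton.elim (ρ g) 0, map_zero]; rfl
    have := IsIrreducible.algebraMap_intertwiningMap_bijective_of_isAlgClosed (ρ := ρ)
    have h2 : (0 : ℂ) = 1 := this.1 (by ext x; exact Subsingleton.elim _ _)
    exact zero_ne_one h2
  have hd : (Module.finrank ℂ U : ℂ) ≠ 0 := Nat.cast_ne_zero.mpr Module.finrank_pos.ne'
  have key : ∀ X : U →ₗ[ℂ] U, ∑ e, ρ e * X * ρ e⁻¹ =
      ((Nat.card E : ℂ) / Module.finrank ℂ U * LinearMap.trace ℂ U X) • 1 := by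
    intro X
    obtain ⟨c, hc⟩ := ρ.exists_eq_smul _ (ρ.average_comm ρ X)
    have h1 := congrArg (LinearMap.trace ℂ U) hc
    rw [map_sum, Finset.sum_congr rfl fun e _ => show _ = LinearMap.trace ℂ U X by
      rw [LinearMap.trace_mul_comm, ← mul_assoc, ← map_mul, inv_mul_cancel, map_one, one_mul]] at h1
    rw [map_smul, LinearMap.trace_one, Finset.sum_const, Finset.card_univ,
      ← Nat.card_eq_fintype_card, nsmul_eq_mul, smul_eq_mul] at h1
    rw [hc]
    congr 1
    field_simp
    exact h1.symm
  have h2 : ∀ i j, ∑ e, LinearMap.trace ℂ U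
      (T.val * ρ e * LinearMap.elem U i j * (ρ e⁻¹ * T.inv) * LinearMap.elem U j i) =
      (Nat.card E : ℂ) / Module.finrank ℂ U * if i = j then 1 else 0 := by
    intro i j
    have h3 : ∀ e, T.val * ρ e * LinearMap.elem U i j * (ρ e⁻¹ * T.inv) * LinearMap.elem U j i =
        T.val * (ρ e * LinearMap.elem U i j * ρ e⁻¹) * T.inv * LinearMap.elem U j i := fun e => by
      simp only [mul_assoc]
    rw [Finset.sum_congr rfl fun e _ => by rw [h3 e], ← map_sum, ← Finset.sum_mul,
      ← Finset.sum_mul, ← Finset.mul_sum, key, mul_smul_comm, mul_one, smul_mul_assoc, T.val_inv,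
      smul_mul_assoc, one_mul, map_smul, LinearMap.trace_elem, LinearMap.trace_elem]
    by_cases hij : i = j
    · simp [hij]
    · simp [hij, Ne.symm hij]
  rw [Finset.sum_congr rfl fun e _ => LinearMap.trace_mul_trace _ _, Finset.sum_comm]
  rw [Finset.sum_congr rfl fun i _ => Finset.sum_comm]
  simp only [h2]
  simp
  field_simp

theorem Representation.exists_intertwiner (ρ ρ' : Representation ℂ E U)
    (h : IsIrrChar E ρ.character) (e : ρ'.character = ρ.character) :
    ∃ S : (Module.End ℂ U)ˣ, ∀ x, S.val * ρ x = ρ' x * S.val := by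
  obtain ⟨X, hX⟩ : ∃ X : U →ₗ[ℂ] U, ∑ x, ρ' x * X * ρ x⁻¹ ≠ 0 := by
    by_contra! h0
    have h1 := h.sum_mul h
    rw [if_pos rfl] at h1
    refine Nat.card_cast_ne_zero E (h1.symm.trans ?_)
    have h2 : ∀ g, ρ.character g * ρ.character g⁻¹ = ∑ i, ∑ j, LinearMap.trace ℂ U
        (ρ' g * LinearMap.elem U i j * ρ g⁻¹ * LinearMap.elem U j i) := fun g => by
      rw [← LinearMap.trace_mul_trace]
      conv_lhs => rw [← e]
      conv_lhs => arg 2; rw [e]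
      rfl
    rw [Finset.sum_congr rfl fun g _ => h2 g, Finset.sum_comm]
    refine Finset.sum_eq_zero fun i _ => ?_
    rw [Finset.sum_comm]
    refine Finset.sum_eq_zero fun j _ => ?_
    rw [← map_sum, ← Finset.sum_mul, h0, zero_mul, map_zero]
  set S := ∑ x, ρ' x * X * ρ x⁻¹ with hS
  have hc := ρ.average_comm ρ' X
  rw [← hS] at hc
  obtain ⟨P, hP, hPc, hPr⟩ := ρ.exists_commuting_proj (LinearMap.ker S) (fun g x hx => by
    rw [LinearMap.mem_ker] at hx ⊢
    have := LinearMap.congr_fun (hc g) x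
    simp only [Module.End.mul_apply, hx, map_zero] at this
    exact this.symm)
  rcases ρ.eq_zero_or_one_of_isIrrChar h P hP hPc with rfl | rfl
  · rw [LinearMap.range_zero] at hPr
    have hinj : Function.Injective S := LinearMap.ker_eq_bot.mp hPr.symm
    obtain ⟨u, hu⟩ : IsUnit S := (Module.End.isUnit_iff S).mpr
      ⟨hinj, LinearMap.injective_iff_surjective.mp hinj⟩
    exact ⟨u, fun x => by rw [hu, hc]⟩
  · refine absurd (LinearMap.ker_eq_top.mp ?_) hX
    rw [← hPr]
    exact LinearMap.range_eq_top.mpr Function.surjective_id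

theorem Representation.exists_eq_mul_trace (ρ : Representation ℂ E U) [ρ.IsIrreducible]
    (α : MulAut E) (T : (Module.End ℂ U)ˣ) (hT : ∀ y, T.val * ρ y = ρ (α y) * T.val) (h : E → ℂ)
    (hc : ∀ y e, h (y * e * (α y)⁻¹) = h e)
    (hh : ∀ e, h e = ρ.character 1 / Nat.card E * ∑ m, ρ.character m⁻¹ * h (e * m)) :
    ∃ κ : ℂ, ∀ e, h e = κ * LinearMap.trace ℂ U (T.val * ρ e) := by
  set B : U →ₗ[ℂ] U := (ρ.character 1 / Nat.card E) • ∑ m, h m • ρ m⁻¹ with hB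
  have hBc : ∀ y, B * ρ y = ρ (α y) * B := by
    intro y
    rw [hB, smul_mul_assoc, mul_smul_comm, Finset.sum_mul, Finset.mul_sum]
    congr 1
    refine (Fintype.sum_equiv ((Equiv.mulRight (α y)⁻¹).trans (Equiv.mulLeft y)) _ _
      fun e => ?_).symm
    have : ((Equiv.mulRight (α y)⁻¹).trans (Equiv.mulLeft y)) e = y * e * (α y)⁻¹ := by
      simp [mul_assoc]
    rw [this, hc, mul_smul_comm, smul_mul_assoc, ← map_mul, ← map_mul]
    congr 2
    group
  obtain ⟨κ, hκ⟩ := ρ.exists_eq_smul (T.inv * B) fun y => by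
    have h1 : ρ y * T.inv = T.inv * ρ (α y) := by
      calc ρ y * T.inv = T.inv * (T.val * ρ y) * T.inv := by
            rw [← mul_assoc, T.inv_val, one_mul]
        _ = T.inv * ρ (α y) * (T.val * T.inv) := by rw [hT]; simp only [mul_assoc]
        _ = _ := by rw [T.val_inv, mul_one]
    rw [← mul_assoc, h1, mul_assoc, mul_assoc, hBc]
  have hBT : B = κ • T.val := by
    calc B = T.val * (T.inv * B) := by rw [← mul_assoc, T.val_inv, one_mul]
      _ = _ := by rw [hκ, mul_smul_comm, mul_one]
  refine ⟨κ, fun e => ?_⟩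
  rw [← smul_eq_mul, ← map_smul, ← smul_mul_assoc, ← hBT, hB, smul_mul_assoc, map_smul,
    Finset.sum_mul, map_sum, hh, smul_eq_mul]
  congr 1
  refine Fintype.sum_equiv (Equiv.mulLeft e) _ _ fun m => ?_
  rw [smul_mul_assoc, map_smul, ← map_mul, smul_eq_mul, mul_comm]
  congr 1
  change _ = ρ.character _
  congr 1
  simp

end Schur

section CentralComplement

variable {σ : Set ℕ} {B : Type} [Group B]

theorem Subgroup.mul_pow_of_le_center {N : Type} [Group N] [Finite N] {Z : Subgroup N}
    (hZ : Z ≤ center N) (x y : N) : (x * y) ^ Z.index = x ^ Z.index * y ^ Z.index := by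
  have h1 : Z.index = (center N).index * Z.relIndex (center N) := by
    rw [mul_comm, relIndex_mul_index hZ]
  have h2 : (x * y) ^ (center N).index = x ^ (center N).index * y ^ (center N).index :=
    congrArg Subtype.val (map_mul (MonoidHom.transferCenterPow N) x y)
  have h3 : Commute (x ^ (center N).index) (y ^ (center N).index) :=
    (mem_center_iff.mp ((center N).pow_index_mem x) _).symm
  rw [h1, pow_mul, h2, h3.mul_pow, ← pow_mul, ← pow_mul]

/-- A central `σ`-subgroup of `σ'`-index has a normal complement. -/
theorem exists_normal_of_central [Finite B] {N Z : Subgroup B} [N.Normal] (hZN : Z ≤ N)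
    (hc : ∀ z ∈ Z, ∀ n ∈ N, z * n = n * z) (hZ : IsPiNumber σ (Nat.card Z))
    (hi : IsPiNumber σᶜ (Z.relIndex N)) :
    ∃ S : Subgroup B, S.Normal ∧ S ≤ N ∧ IsPiNumber σᶜ (Nat.card S) ∧
      IsPiNumber σ (S.relIndex N) := by
  have hcent : Z.subgroupOf N ≤ Subgroup.center N := fun z hz =>
    Subgroup.mem_center_iff.mpr fun n => Subtype.ext (hc z hz n n.2).symm
  have hnorm : (Z.subgroupOf N).Normal :=
    ⟨fun z hz n => by
      have := Subgroup.mem_center_iff.mp (hcent hz) n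
      rwa [this, mul_assoc, mul_inv_cancel, mul_one]⟩
  let pw : N →* N := MonoidHom.mk' (fun g => g ^ (Z.subgroupOf N).index)
    (Subgroup.mul_pow_of_le_center hcent)
  have hmem : ∀ {x}, x ∈ pw.ker.map N.subtype ↔ x ∈ N ∧ x ^ Z.relIndex N = 1 := by
    intro x
    constructor
    · rintro ⟨y, hy, rfl⟩
      exact ⟨y.2, congrArg Subtype.val (MonoidHom.mem_ker.mp hy)⟩
    · rintro ⟨hx, h⟩
      exact ⟨⟨x, hx⟩, MonoidHom.mem_ker.mpr (Subtype.ext h), rfl⟩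
  refine ⟨pw.ker.map N.subtype, ⟨fun x hx g => ?_⟩, fun x hx => (hmem.mp hx).1, ?_, ?_⟩
  · rw [hmem] at hx ⊢
    exact ⟨‹N.Normal›.conj_mem _ hx.1 g, by rw [conj_pow, hx.2]; group⟩
  · refine isPiNumber_card_of_forall fun g => isPiElt_coe.mp ?_
    exact hi.of_dvd (orderOf_dvd_of_pow_eq_one (hmem.mp g.2).2)
  · have h1 : (pw.ker.map N.subtype).relIndex N = pw.ker.index := by
      rw [Subgroup.relIndex, Subgroup.subgroupOf,
        Subgroup.comap_map_eq_self_of_injective N.subtype_injective]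
    rw [h1, Subgroup.index_ker]
    have h2 : pw.range ≤ Z.subgroupOf N := by
      rintro _ ⟨x, rfl⟩
      exact Subgroup.pow_index_mem _ x
    refine hZ.of_dvd ((Subgroup.card_dvd_of_le h2).trans ?_)
    rw [Nat.card_congr (Subgroup.subgroupOfEquivOfLe hZN).toEquiv]

theorem Subgroup.relIndex_map_dvd {A : Type} [Group A] (f : A →* B) (K L : Subgroup A) :
    (K.map f).relIndex (L.map f) ∣ K.relIndex L := by
  rw [Subgroup.relIndex, ← Subgroup.index_comap_of_surjective _ (f.subgroupMap_surjective L)]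
  exact Subgroup.index_dvd_of_le fun x hx => ⟨x, hx, rfl⟩

end CentralComplement

section Covering

variable {G : Type} [Group G] {E : Subgroup G} [E.Normal]
  {U : Type} [AddCommGroup U] [Module ℂ U]

/-- The pairs of a group element and an operator implementing its conjugation action on a
representation of a normal subgroup, with restricted determinant. -/
def Representation.covering (ρ : Representation ℂ E U) : Subgroup (G × (Module.End ℂ U)ˣ) where
  carrier := {x | (∀ e, x.2.val * ρ e = ρ (MulAut.conjNormal x.1 e) * x.2.val) ∧
    LinearMap.det x.2.val ^ Nat.card E = 1}
  one_mem' := ⟨fun e => by simp, by simp⟩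
  mul_mem' := by
    rintro x y ⟨hx, hx'⟩ ⟨hy, hy'⟩
    refine ⟨fun e => ?_, ?_⟩
    · rw [Prod.snd_mul, Units.val_mul, mul_assoc, hy, ← mul_assoc, hx, Prod.fst_mul, map_mul,
        MulAut.mul_apply, mul_assoc]
    · rw [Prod.snd_mul, Units.val_mul, map_mul, mul_pow, hx', hy', one_mul]
  inv_mem' := by
    rintro x ⟨hx, hx'⟩
    refine ⟨fun e => ?_, ?_⟩
    · have := hx (MulAut.conjNormal x.1⁻¹ e)
      rw [← MulAut.mul_apply, ← map_mul, mul_inv_cancel, map_one, MulAut.one_apply] at this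
      rw [Prod.snd_inv, Prod.fst_inv, Units.inv_mul_eq_iff_eq_mul, ← mul_assoc, this, mul_assoc,
        Units.mul_inv, mul_one]
    · have h1 : LinearMap.det (x⁻¹).2.val * LinearMap.det x.2.val = 1 := by
        rw [← map_mul, Prod.snd_inv, Units.inv_mul, map_one]
      have h2 := congrArg (· ^ Nat.card E) h1
      simpa only [mul_pow, hx', mul_one, one_pow] using h2

variable (ρ : Representation ℂ E U)

/-- Projection of the covering to the group. -/
def Representation.coverFst : ρ.covering →* G := (MonoidHom.fst _ _).comp ρ.covering.subtype

/-- Projection of the covering to the operators. -/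
def Representation.coverSnd : ρ.covering →* (Module.End ℂ U)ˣ :=
  (MonoidHom.snd _ _).comp ρ.covering.subtype

/-- The representation of the covering. -/
def Representation.coverRep : Representation ℂ ρ.covering U :=
  (Units.coeHom (Module.End ℂ U)).comp ρ.coverSnd

/-- The copy of the normal subgroup in the covering. -/
def Representation.coverIncl : E →* ρ.covering :=
  (E.subtype.prod ρ.toHomUnits).codRestrict ρ.covering fun e => by
    refine ⟨fun e' => ?_, ?_⟩
    · change ρ e * ρ e' = ρ (MulAut.conjNormal (e : G) e') * ρ e
      rw [← map_mul, ← map_mul]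
      congr 1
      ext
      simp
    · change LinearMap.det (ρ e) ^ Nat.card E = 1
      rw [← map_pow, ← map_pow, pow_card_eq_one', map_one, map_one]

theorem Representation.coverFst_incl (e : E) : ρ.coverFst (ρ.coverIncl e) = e := rfl

theorem Representation.coverRep_incl (e : E) : ρ.coverRep (ρ.coverIncl e) = ρ e := rfl

theorem Representation.cover_ext {γ γ' : ρ.covering} (h1 : ρ.coverFst γ = ρ.coverFst γ')
    (h2 : ρ.coverRep γ = ρ.coverRep γ') : γ = γ' :=
  Subtype.ext (Prod.ext h1 (Units.ext h2))

theorem Representation.coverRep_comm (γ : ρ.covering) (e : E) :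
    ρ.coverRep γ * ρ e = ρ (MulAut.conjNormal (ρ.coverFst γ) e) * ρ.coverRep γ :=
  γ.2.1 e

theorem Representation.coverIncl_conj (γ : ρ.covering) (e : E) :
    ρ.coverIncl (MulAut.conjNormal (ρ.coverFst γ) e) = γ * ρ.coverIncl e * γ⁻¹ := by
  refine ρ.cover_ext ?_ ?_
  · rw [coverFst_incl, map_mul, map_mul, coverFst_incl, map_inv]; rfl
  · rw [map_mul, map_mul, coverRep_incl, coverRep_incl, coverRep_comm, mul_assoc, ← map_mul,
      mul_inv_cancel, map_one, mul_one]

variable [FiniteDimensional ℂ U] [Fintype E]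

theorem Representation.coverFst_surjective (h : IsIrrChar E ρ.character)
    (hinv : ∀ (g : G) e, ρ.character (MulAut.conjNormal g e) = ρ.character e) :
    Function.Surjective ρ.coverFst := by
  intro g
  obtain ⟨S, hS⟩ := ρ.exists_intertwiner (ρ.comp (MulAut.conjNormal g : MulAut E).toMonoidHom) h
    (funext fun e => hinv g e)
  have hdet : IsUnit (LinearMap.det S.val) := S.isUnit.map LinearMap.det
  have hd : Module.finrank ℂ U ≠ 0 := fun h0 => h.map_one_ne_zero (by
    rw [char_one, h0, Nat.cast_zero])
  obtain ⟨c, hc⟩ := IsAlgClosed.exists_pow_nat_eq (LinearMap.det S.val)⁻¹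
    (Nat.pos_of_ne_zero hd)
  have hc0 : c ≠ 0 := by
    rintro rfl
    rw [zero_pow hd] at hc
    exact inv_ne_zero hdet.ne_zero hc.symm
  refine ⟨⟨(g, Units.mk0 c hc0 • S), fun e => ?_, ?_⟩, rfl⟩
  · change (c • S.val) * ρ e = ρ (MulAut.conjNormal g e) * (c • S.val)
    rw [smul_mul_assoc, mul_smul_comm, hS]
    rfl
  · change LinearMap.det (c • S.val) ^ _ = 1
    rw [LinearMap.det_smul, hc, inv_mul_cancel₀ hdet.ne_zero, one_pow]

theorem Representation.exists_coverRep_eq_smul (h : IsIrrChar E ρ.character) {γ : ρ.covering}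
    (hγ : γ ∈ ρ.coverFst.ker) :
    ∃ c : ℂ, ρ.coverRep γ = c • 1 ∧ c ^ (Module.finrank ℂ U * Nat.card E) = 1 := by
  have := ρ.isIrreducible_of_isIrrChar h
  obtain ⟨c, hc⟩ := ρ.exists_eq_smul (ρ.coverRep γ) fun e => by
    rw [coverRep_comm, MonoidHom.mem_ker.mp hγ, map_one, MulAut.one_apply]
  refine ⟨c, hc, ?_⟩
  have h1 : LinearMap.det (ρ.coverRep γ) ^ Nat.card E = 1 := γ.2.2
  rwa [hc, LinearMap.det_smul, map_one, mul_one, ← pow_mul] at h1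

theorem Representation.finite_covering [Finite G] (h : IsIrrChar E ρ.character) :
    Finite ρ.covering := by
  rw [ρ.coverFst.finite_iff_finite_ker_range]
  refine ⟨?_, inferInstance⟩
  choose c hc hc' using fun γ : ρ.coverFst.ker => ρ.exists_coverRep_eq_smul h γ.2
  have hd : 0 < Module.finrank ℂ U * Nat.card E :=
    Nat.mul_pos (Nat.pos_of_ne_zero fun h0 => h.map_one_ne_zero (by
      rw [char_one, h0, Nat.cast_zero])) Nat.card_pos
  have hfin : Finite {z : ℂ // z ^ (Module.finrank ℂ U * Nat.card E) = 1} := by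
    have hS : {z : ℂ | z ^ (Module.finrank ℂ U * Nat.card E) = 1}.Finite := by
      refine ((Polynomial.nthRoots (Module.finrank ℂ U * Nat.card E)
        (1 : ℂ)).toFinset.finite_toSet).subset fun z hz => ?_
      rw [Finset.mem_coe, Multiset.mem_toFinset, Polynomial.mem_nthRoots hd]
      exact hz
    exact hS.to_subtype
  refine Finite.of_injective (fun γ => (⟨c γ, hc' γ⟩ :
    {z : ℂ // z ^ (Module.finrank ℂ U * Nat.card E) = 1})) fun γ γ' e => Subtype.ext ?_
  refine ρ.cover_ext ((MonoidHom.mem_ker.mp γ.2).trans (MonoidHom.mem_ker.mp γ'.2).symm) ?_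
  rw [hc, hc, show c γ = c γ' from congrArg Subtype.val e]

theorem Representation.isPiNumber_card_ker_coverFst [Finite G] {σ : Set ℕ}
    (hE : IsPiNumber σ (Nat.card E)) (h : IsIrrChar E ρ.character) :
    IsPiNumber σ (Nat.card ρ.coverFst.ker) := by
  have := ρ.finite_covering h
  refine isPiNumber_card_of_forall fun γ => ?_
  obtain ⟨c, hc, hc'⟩ := ρ.exists_coverRep_eq_smul h γ.2
  refine ((hE.of_dvd (h.degree_dvd ρ.char_one)).mul hE).of_dvd (orderOf_dvd_of_pow_eq_one ?_)
  refine Subtype.ext (ρ.cover_ext ?_ ?_)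
  · exact MonoidHom.mem_ker.mp (γ ^ _).2
  · rw [Subgroup.coe_pow, map_pow, hc, smul_pow, hc', one_pow, one_smul]
    exact (map_one _).symm

end Covering

section InvariantCase

variable {σ : Set ℕ} {G H : Type} [Group G] [Group H]

theorem IsLocChar.comp_of_ker [Finite G] {φ : H → ℂ} (h : IsLocChar σ H φ) (f : G →* H)
    (hk : IsPiNumber σ (Nat.card f.ker)) : IsLocChar σ G (fun g => φ (f g)) where
  conj x g := by simp only [map_mul, map_inv, h.conj]
  zero g hg := h.zero _ fun h' => hg (isPiElt_of_ker f hk h')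
  res P hP := h.comp_hom hP (f.comp P.subtype)

variable {E : Subgroup G} [E.Normal] [Fintype E]
  {U : Type} [AddCommGroup U] [Module ℂ U] [FiniteDimensional ℂ U] (ρ : Representation ℂ E U)

theorem Representation.coverIncl_injective : Function.Injective ρ.coverIncl := fun _ _ e =>
  Subtype.ext (congrArg ρ.coverFst e)

instance Representation.normal_range_coverIncl : ρ.coverIncl.range.Normal :=
  normal_range (a := MulAut.conjNormal.comp ρ.coverFst) fun γ e => ρ.coverIncl_conj γ e

/-- A local character lying over an invariant character of a normal `σ`-subgroup factors over
the covering. -/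
theorem IsLocChar.exists_factor [Finite G] {φ : G → ℂ} (hφ : IsLocChar σ G φ)
    (hE : IsPiNumber σ (Nat.card E)) (h : IsIrrChar E ρ.character)
    (hiso : isoPart E.subtype ρ.character φ = φ) :
    ∃ τ, IsLocChar σ (ρ.covering ⧸ ρ.coverIncl.range) τ ∧
      ∀ γ, φ (ρ.coverFst γ) =
        ρ.coverRep.character γ * τ (QuotientGroup.mk' ρ.coverIncl.range γ) := by
  have := ρ.isIrreducible_of_isIrrChar h
  have := ρ.finite_covering h
  have := Fintype.ofFinite ρ.covering
  have hk := ρ.isPiNumber_card_ker_coverFst hE h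
  have hstar := (ρ.coverRep.isCharacter_character.star).isLocChar (σ := σ)
  have hF := (hφ.comp_of_ker ρ.coverFst hk).mul hstar
  have hFe : ∀ γ : ρ.covering, ((fun g => φ (ρ.coverFst g)) *
      piRestrict σ (fun x => ρ.coverRep.character x⁻¹)) γ =
      φ (ρ.coverFst γ) * ρ.coverRep.character γ⁻¹ := by
    intro γ
    rw [Pi.mul_apply, piRestrict]
    split_ifs with hγ
    · rfl
    · rw [hφ.zero _ fun h' => hγ (isPiElt_of_ker _ hk h'), zero_mul, zero_mul]
  have hker : (QuotientGroup.mk' ρ.coverIncl.range).ker = ρ.coverIncl.range :=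
    QuotientGroup.ker_mk' _
  have hcard : Nat.card (QuotientGroup.mk' ρ.coverIncl.range).ker = Nat.card E := by
    rw [hker]
    exact (Nat.card_congr (Equiv.ofInjective _ ρ.coverIncl_injective)).symm
  obtain ⟨τ, hτ, e⟩ := hF.deflate (QuotientGroup.mk' ρ.coverIncl.range)
    (QuotientGroup.mk'_surjective _) (by rwa [hcard])
  refine ⟨τ, hτ, fun γ => ?_⟩
  obtain ⟨κ, hκ⟩ := ρ.exists_eq_mul_trace (MulAut.conjNormal (ρ.coverFst γ)) (ρ.coverSnd γ)
    (fun y => ρ.coverRep_comm γ y) (fun e => φ (ρ.coverFst γ * e)) (fun y e => by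
      have h1 : ρ.coverFst γ * ((y * e * (MulAut.conjNormal (ρ.coverFst γ) y)⁻¹ : E) : G) =
          (ρ.coverFst γ * y) * ((ρ.coverFst γ)⁻¹ * (ρ.coverFst γ * e) * (ρ.coverFst γ)⁻¹⁻¹) *
            (ρ.coverFst γ * y)⁻¹ := by
        rw [Subgroup.coe_mul, Subgroup.coe_mul, Subgroup.coe_inv, MulAut.conjNormal_apply]
        group
      rw [h1, hφ.conj, hφ.conj]) (fun e => by
      refine (congrFun hiso _).symm.trans ?_
      unfold isoPart
      simp only [Subgroup.coe_mul, Subgroup.coe_subtype, mul_assoc])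
  have hτγ : τ (QuotientGroup.mk' ρ.coverIncl.range γ) = κ := by
    rw [e]
    refine (congrArg _ (?_ : _ = ∑ e : E, κ *
        (LinearMap.trace ℂ U ((ρ.coverSnd γ).val * ρ e) *
          LinearMap.trace ℂ U (ρ e⁻¹ * (ρ.coverSnd γ).inv)))).trans ?_
    · symm
      refine @Fintype.sum_bijective E (QuotientGroup.mk' ρ.coverIncl.range).ker ℂ _ (_) _
        (fun e => ⟨ρ.coverIncl e, hker.symm ▸ ⟨e, rfl⟩⟩) ⟨?_, ?_⟩ _ _ ?_
      · exact fun _ _ h => ρ.coverIncl_injective (congrArg Subtype.val h)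
      · rintro ⟨x, hx⟩
        rw [hker] at hx
        obtain ⟨e, rfl⟩ := hx
        exact ⟨e, rfl⟩
      · intro e
        have h1 : φ (ρ.coverFst (γ * ρ.coverIncl e)) = _ := hκ e
        have h2 : ρ.coverRep.character (γ * ρ.coverIncl e)⁻¹ =
            LinearMap.trace ℂ U (ρ e⁻¹ * (ρ.coverSnd γ).inv) := by
          rw [mul_inv_rev, ← map_inv]
          change LinearMap.trace ℂ U (ρ.coverRep _) = _
          rw [map_mul, ρ.coverRep_incl]
          rfl
        refine Eq.trans ?_ (hFe (γ * ρ.coverIncl e)).symm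
        rw [h1, h2, mul_assoc]
    rw [← Finset.mul_sum, ρ.sum_trace_mul_trace, hcard]
    field_simp [Nat.card_cast_ne_zero E]
  rw [hτγ, mul_comm]
  have := hκ 1
  rwa [Subgroup.coe_one, mul_one, map_one, mul_one] at this

/-- Lifting local characters over an invariant character of a normal `σ`-subgroup. -/
theorem IsLocChar.exists_lift_of_covering [Finite G] {φ : G → ℂ} (hφ : IsLocChar σ G φ)
    (hE : IsPiNumber σ (Nat.card E)) (h : IsIrrChar E ρ.character)
    (hinv : ∀ (g : G) e, ρ.character (MulAut.conjNormal g e) = ρ.character e)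
    (hiso : isoPart E.subtype ρ.character φ = φ)
    (hl : HasLifts σ (ρ.covering ⧸ ρ.coverIncl.range)) :
    ∃ χ, IsCharacter G χ ∧ φ = piRestrict σ χ := by
  have := ρ.finite_covering h
  have := Fintype.ofFinite ρ.covering
  have hk := ρ.isPiNumber_card_ker_coverFst hE h
  have hsurj := ρ.coverFst_surjective h hinv
  obtain ⟨τ, hτ, e⟩ := hφ.exists_factor ρ hE h hiso
  obtain ⟨ξ, hξ, rfl⟩ := hl τ hτ
  obtain ⟨χ, hχ, e'⟩ := (ρ.coverRep.isCharacter_character.mul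
    (hξ.comp (QuotientGroup.mk' ρ.coverIncl.range))).deflate ρ.coverFst hsurj
  refine ⟨χ, hχ, funext fun g => ?_⟩
  rw [piRestrict]
  split_ifs with hg
  swap
  · exact hφ.zero g hg
  obtain ⟨γ, rfl⟩ := hsurj g
  rw [e']
  have hs : ∀ k : ρ.coverFst.ker, (ρ.coverRep.character * fun x =>
      ξ (QuotientGroup.mk' ρ.coverIncl.range x)) (γ * k) = φ (ρ.coverFst γ) := by
    intro k
    have hk1 : ρ.coverFst (γ * k) = ρ.coverFst γ := by
      rw [map_mul, MonoidHom.mem_ker.mp k.2, mul_one]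
    have hpi : IsPiElt σ (γ * k) := isPiElt_of_ker _ hk (hk1.symm ▸ hg)
    rw [← hk1, e, piRestrict, if_pos (hpi.map _)]
    rfl
  rw [Finset.sum_congr rfl fun k _ => hs k, Finset.sum_const, Finset.card_univ,
    ← Nat.card_eq_fintype_card, nsmul_eq_mul]
  have := Nat.card_cast_ne_zero ρ.coverFst.ker
  field_simp

theorem IsLocChar.exists_lift_of_invariant [Finite G] {φ : G → ℂ} (hφ : IsLocChar σ G φ)
    (hG : IsSep σ G) (hE : IsPiNumber σ (Nat.card E)) {L : Subgroup G} [L.Normal] (hEL : E ≤ L)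
    (hi : IsPiNumber σᶜ (E.relIndex L))
    (IH : ∀ (G' : Type) [Group G'] [Finite G'] (E' : Subgroup G') [E'.Normal], IsSep σ G' →
      IsPiNumber σ (Nat.card E') → E'.index = L.index → HasLifts σ G')
    (h : IsIrrChar E ρ.character)
    (hinv : ∀ (g : G) e, ρ.character (MulAut.conjNormal g e) = ρ.character e)
    (hiso : isoPart E.subtype ρ.character φ = φ) :
    ∃ χ, IsCharacter G χ ∧ φ = piRestrict σ χ := by
  refine hφ.exists_lift_of_covering ρ hE h hinv hiso ?_
  have := ρ.finite_covering h
  have := ρ.isIrreducible_of_isIrrChar h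
  have hk := ρ.isPiNumber_card_ker_coverFst hE h
  have hsurj := ρ.coverFst_surjective h hinv
  set p := ρ.coverFst with hp
  set f := QuotientGroup.mk' ρ.coverIncl.range with hf
  have hfs : Function.Surjective f := QuotientGroup.mk'_surjective _
  have hN : ((L.comap p).map f).Normal := Subgroup.Normal.map inferInstance f hfs
  have hZN : (E.comap p).map f ≤ (L.comap p).map f :=
    Subgroup.map_mono (Subgroup.comap_mono hEL)
  obtain ⟨S, hSn, hSN, hSc, hSi⟩ := exists_normal_of_central (σ := σ) hZN (by
    rintro _ ⟨γ, hγ, rfl⟩ n -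
    obtain ⟨δ, rfl⟩ := hfs n
    obtain ⟨ε, hε, hε'⟩ : ∃ ε, f ε = 1 ∧ p ε = p γ :=
      ⟨ρ.coverIncl ⟨p γ, hγ⟩, (QuotientGroup.eq_one_iff _).mpr ⟨_, rfl⟩, rfl⟩
    have h1 : f γ = f (γ * ε⁻¹) := by rw [map_mul, map_inv, hε, inv_one, mul_one]
    have h2 : γ * ε⁻¹ ∈ p.ker := by
      rw [MonoidHom.mem_ker, map_mul, map_inv, hε', mul_inv_cancel]
    obtain ⟨c, hc, -⟩ := ρ.exists_coverRep_eq_smul h h2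
    rw [h1, ← map_mul, ← map_mul]
    refine congrArg f (ρ.cover_ext ?_ ?_)
    · rw [← hp, map_mul p _ δ, map_mul p δ, MonoidHom.mem_ker.mp h2, one_mul, mul_one]
    · rw [map_mul ρ.coverRep _ δ, map_mul ρ.coverRep δ, hc, smul_one_mul, mul_smul_one]) (by
    refine (hk.mul hE).of_dvd ((Subgroup.card_map_dvd _ f).trans ?_)
    rw [card_comap_of_surjective hsurj]) (by
    refine hi.of_dvd ((Subgroup.relIndex_map_dvd f _ _).trans ?_)
    rw [Subgroup.relIndex_comap, Subgroup.map_comap_eq_self_of_surjective hsurj])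
  have hS : IsPiNumber σᶜ (Nat.card (QuotientGroup.mk' S).ker) := by
    rwa [QuotientGroup.ker_mk']
  refine HasLifts.of_quotient (QuotientGroup.mk' S) (QuotientGroup.mk'_surjective S) hS ?_
  have hE' : (((L.comap p).map f).map (QuotientGroup.mk' S)).Normal :=
    Subgroup.Normal.map inferInstance _ (QuotientGroup.mk'_surjective S)
  refine IH _ (((L.comap p).map f).map (QuotientGroup.mk' S)) ?_ ?_ ?_
  · exact ((hG.of_ker p hk).of_surjective f hfs).of_surjective _ (QuotientGroup.mk'_surjective S)
  · rwa [← Subgroup.relIndex_ker, QuotientGroup.ker_mk']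
  · rw [Subgroup.index_map_eq _ (QuotientGroup.mk'_surjective S)
      (by rwa [QuotientGroup.ker_mk']), Subgroup.index_map_eq _ hfs,
      Subgroup.index_comap_of_surjective _ hsurj]
    rw [QuotientGroup.ker_mk']
    rintro _ ⟨e, rfl⟩
    exact hEL e.2

end InvariantCase

section FongSwan

variable {σ : Set ℕ} {G : Type} [Group G]

theorem HasLifts.of_isPiNumber_card (h : IsPiNumber σ (Nat.card G)) : HasLifts σ G := by
  intro φ hφ
  refine ⟨φ, ?_, funext fun g => ?_⟩
  · exact (hφ.res ⊤ (by rwa [Subgroup.card_top])).comp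
      (Subgroup.topEquiv (G := G)).symm.toMonoidHom
  · rw [piRestrict, if_pos (isPiElt_of_card h g)]

/-- The elements fixing a function on a normal subgroup under conjugation. -/
def conjStabilizer (E : Subgroup G) [E.Normal] (δ : E → ℂ) : Subgroup G where
  carrier := {g | (fun e => δ (MulAut.conjNormal g e)) = δ}
  one_mem' := by simp
  mul_mem' {x y} hx hy := by
    have hx' : ∀ e, δ (MulAut.conjNormal x e) = δ e := congrFun hx
    have hy' : ∀ e, δ (MulAut.conjNormal y e) = δ e := congrFun hy
    exact funext fun e => by rw [map_mul, MulAut.mul_apply, hx', hy']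
  inv_mem' {x} hx := by
    have hx' : ∀ e, δ (MulAut.conjNormal x e) = δ e := congrFun hx
    exact funext fun e => by
      rw [← hx', ← MulAut.mul_apply, ← map_mul, mul_inv_cancel, map_one, MulAut.one_apply]

theorem mem_conjStabilizer {E : Subgroup G} [E.Normal] {δ : E → ℂ} {g : G} :
    g ∈ conjStabilizer E δ ↔ (fun e => δ (MulAut.conjNormal g e)) = δ := Iff.rfl

theorem IsCharacter.le_conjStabilizer {E : Subgroup G} [E.Normal] {δ : E → ℂ}
    (h : IsCharacter E δ) : E ≤ conjStabilizer E δ := fun x hx => funext fun e =>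
  h.map_conj ⟨x, hx⟩ e

theorem card_conj_fiber [Fintype G] {E : Subgroup G} [E.Normal] (δ : E → ℂ) (x₀ : G) :
    (Finset.univ.filter fun x : G => (fun e => δ (MulAut.conjNormal x e)) =
      fun e => δ (MulAut.conjNormal x₀ e)).card = Nat.card (conjStabilizer E δ) := by
  have h : ∀ x : G, x * x₀⁻¹ ∈ conjStabilizer E δ ↔ (fun e => δ (MulAut.conjNormal x e)) =
      fun e => δ (MulAut.conjNormal x₀ e) := by
    intro x
    rw [mem_conjStabilizer, funext_iff, funext_iff]
    constructor
    · intro h e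
      rw [← h (MulAut.conjNormal x₀ e), ← MulAut.mul_apply, ← map_mul, inv_mul_cancel_right]
    · intro h e
      rw [map_mul, MulAut.mul_apply, h, ← MulAut.mul_apply, ← map_mul, mul_inv_cancel, map_one,
        MulAut.one_apply]
  rw [Nat.card_eq_fintype_card, ← Fintype.card_subtype]
  exact Fintype.card_congr ((Equiv.mulRight x₀⁻¹).subtypeEquiv fun x => (h x).symm)

theorem isoPart_comp_hom {E H : Type} [Group E] [Fintype E] [Group H] (ι : E →* H) (f : H →* G)
    (δ : E → ℂ) (φ : G → ℂ) :
    isoPart ι δ (fun g => φ (f g)) = fun g => isoPart (f.comp ι) δ φ (f g) := by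
  unfold isoPart
  simp only [map_mul, MonoidHom.comp_apply]

/-- Clifford correspondence for the orbit part of a local character. -/
theorem sum_isoPart_eq_piRestrict_indChar [Fintype G] {E : Subgroup G} [E.Normal]
    {φ : G → ℂ} (hφ : IsLocChar σ G φ) (hE : IsPiNumber σ (Nat.card E)) {δ : E → ℂ}
    (hδ : IsIrrChar E δ) {χ : conjStabilizer E δ → ℂ}
    (hχ : (fun t : conjStabilizer E δ => isoPart E.subtype δ φ t) = piRestrict σ χ) :
    ∑ θ ∈ Finset.univ.image (fun x : G => fun e => δ (MulAut.conjNormal x e)),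
      isoPart E.subtype θ φ = piRestrict σ (indChar (conjStabilizer E δ) χ) := by
  have ha : ∀ (g : G) (e : E), E.subtype (MulAut.conjNormal g e) = g * E.subtype e * g⁻¹ :=
    fun g e => MulAut.conjNormal_apply g e
  funext g
  rw [piRestrict, Finset.sum_apply]
  split_ifs with hg
  swap
  · exact Finset.sum_eq_zero fun θ _ => isoPart_zero hφ ha hE g hg
  have h1 : ∀ x : G, (if h : x * g * x⁻¹ ∈ conjStabilizer E δ then χ ⟨x * g * x⁻¹, h⟩ else 0) =
      isoPart E.subtype (fun e => δ (MulAut.conjNormal x e)) φ g := by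
    intro x
    rw [← isoPart_conj hφ.conj ha]
    split_ifs with h
    · refine Eq.trans ?_ (congrFun hχ ⟨_, h⟩).symm
      rw [piRestrict, if_pos (isPiElt_coe.mp (by rwa [isPiElt_conj]))]
    · exact (isoPart_apply_eq_zero hφ ha hE hδ h).symm
  rw [indChar, Finset.sum_congr rfl fun x _ => h1 x,
    Finset.sum_comp (fun θ => isoPart E.subtype θ φ g) (fun x : G => fun e =>
      δ (MulAut.conjNormal x e)), Finset.mul_sum]
  refine Finset.sum_congr rfl fun θ hθ => ?_
  obtain ⟨x₀, -, rfl⟩ := Finset.mem_image.mp hθ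
  have := Nat.card_cast_ne_zero (conjStabilizer E δ)
  rw [nsmul_eq_mul, card_conj_fiber]
  field_simp

theorem HasLifts.of_isSep_of_index (n : ℕ) : ∀ (G : Type) [Group G] [Finite G] (E : Subgroup G)
    [E.Normal], IsSep σ G → IsPiNumber σ (Nat.card E) → E.index = n → HasLifts σ G := by
  induction n using Nat.strong_induction_on with
  | _ n IH =>
  intro G _ _ E _ hG hE hn
  by_cases hEt : E = ⊤
  · subst hEt
    exact .of_isPiNumber_card (by rwa [Subgroup.card_top] at hE)
  obtain ⟨L, hL, hEL, hi | hi⟩ := hG.exists_normal_lt E hEt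
  · refine IH L.index (hn ▸ Subgroup.index_strictAnti hEL) G L hG ?_ rfl
    rw [← Subgroup.card_mul_relIndex' hEL.le]
    exact hE.mul hi
  have := Fintype.ofFinite G
  have ha : ∀ (g : G) (e : E), E.subtype (MulAut.conjNormal g e) = g * E.subtype e * g⁻¹ :=
    fun g e => MulAut.conjNormal_apply g e
  suffices h : ∀ (d : ℕ) (φ : G → ℂ), IsLocChar σ G φ → φ 1 = d →
      ∃ χ, IsCharacter G χ ∧ φ = piRestrict σ χ by
    intro φ hφ
    obtain ⟨d, hd⟩ := hφ.exists_nat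
    exact h d φ hφ hd
  intro d
  induction d using Nat.strong_induction_on with
  | _ d IHd =>
  intro φ hφ hd
  by_cases hd0 : d = 0
  · refine ⟨0, isCharacter_zero, ?_⟩
    rw [hφ.eq_zero (by rw [hd, hd0, Nat.cast_zero])]
    funext g
    simp [piRestrict]
  obtain ⟨s, hs, hsum⟩ := (hφ.comp_hom hE E.subtype).exists_multiset
  obtain ⟨δ, hδs⟩ : ∃ δ, δ ∈ s := by
    by_contra! h0
    rw [Multiset.eq_zero_of_forall_notMem h0] at hsum
    have := congrFun hsum 1
    simp only [map_one, hd, Multiset.sum_zero, Pi.zero_apply, Nat.cast_eq_zero] at this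
    exact hd0 this
  have hδ := hs δ hδs
  set O := Finset.univ.image (fun x : G => fun e => δ (MulAut.conjNormal x e)) with hO
  have hOirr : ∀ θ ∈ O, IsIrrChar E θ := by
    intro θ hθ
    obtain ⟨x, -, rfl⟩ := Finset.mem_image.mp hθ
    exact hδ.comp_mulEquiv (MulAut.conjNormal x)
  have hδO : δ ∈ O := Finset.mem_image.mpr ⟨1, Finset.mem_univ _, by simp⟩
  obtain ⟨h1, h2⟩ := hφ.split ha hE O hOirr (by
    intro g θ hθ
    obtain ⟨x, -, rfl⟩ := Finset.mem_image.mp hθ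
    exact Finset.mem_image.mpr ⟨x * g, Finset.mem_univ _, by simp⟩)
  suffices h : ∃ χ, IsCharacter G χ ∧ ∑ θ ∈ O, isoPart E.subtype θ φ = piRestrict σ χ by
    obtain ⟨χ₁, hχ₁, e₁⟩ := h
    obtain ⟨k, hk⟩ := h1.exists_nat
    obtain ⟨m, hm⟩ := h2.exists_nat
    have hkm : k + m = d := by
      rw [Pi.sub_apply, hk, hd, sub_eq_iff_eq_add] at hm
      exact_mod_cast (add_comm _ _).trans hm.symm
    have hk0 : k ≠ 0 := by
      rintro rfl
      choose f hf using fun θ : O => (hOirr θ θ.2).1.exists_nat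
      have h3 : ∑ θ : O, (s.count θ.1 * f θ : ℕ) = 0 := by
        have h4 : (∑ θ ∈ O, isoPart E.subtype θ φ) 1 = ∑ θ : O, (s.count θ.1 * f θ : ℂ) := by
          rw [Finset.sum_apply, ← Finset.sum_coe_sort]
          refine Finset.sum_congr rfl fun θ _ => ?_
          rw [← hf]
          exact isoPart_apply_map hφ hE hs hsum (hOirr θ θ.2) 1
        rw [hk, Nat.cast_zero] at h4
        exact_mod_cast h4.symm
      have h5 := Finset.sum_eq_zero_iff.mp h3 ⟨δ, hδO⟩ (Finset.mem_univ _)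
      rcases Nat.mul_eq_zero.mp h5 with h6 | h6
      · exact absurd (Multiset.count_pos.mpr hδs) (by lia)
      · exact hδ.map_one_ne_zero ((hf ⟨δ, hδO⟩).trans (by rw [h6, Nat.cast_zero]))
    obtain ⟨χ₂, hχ₂, e₂⟩ := IHd m (by lia) _ h2 hm
    refine ⟨χ₁ + χ₂, hχ₁.add hχ₂, ?_⟩
    rw [← add_sub_cancel (∑ θ ∈ O, isoPart E.subtype θ φ) φ, e₂, e₁]
    funext g
    simp only [piRestrict, Pi.add_apply]
    split_ifs <;> simp
  by_cases hT : conjStabilizer E δ = ⊤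
  · have hinv : ∀ (g : G) e, δ (MulAut.conjNormal g e) = δ e := fun g =>
      congrFun (mem_conjStabilizer.mp (hT ▸ Subgroup.mem_top g))
    have hO1 : O = {δ} := by
      ext θ
      rw [hO, Finset.mem_image, Finset.mem_singleton]
      constructor
      · rintro ⟨x, -, rfl⟩
        exact funext (hinv x)
      · rintro rfl
        exact ⟨1, Finset.mem_univ _, by simp⟩
    rw [hO1, Finset.sum_singleton] at h1 ⊢
    obtain ⟨V, _, _, _, ρ, rfl, hρ⟩ := hδ.exists_rep
    exact h1.exists_lift_of_invariant ρ hG hE hEL.le hi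
      (fun G' _ _ E' _ hG' hE' h => IH L.index (hn ▸ Subgroup.index_strictAnti hEL) G' E' hG' hE' h)
      hδ hinv (isoPart_isoPart hφ ha hE hδ)
  · have hET := hδ.1.le_conjStabilizer
    have h3 := ((hφ.comp_injective (conjStabilizer E δ).subtype
      (Subgroup.subtype_injective _)).split (ι := Subgroup.inclusion hET)
      (a := MulAut.conjNormal.comp (conjStabilizer E δ).subtype)
      (fun g e => Subtype.ext (ha g e)) hE {δ} (by simpa using hδ) (by
        intro g θ hθ
        rw [Finset.mem_singleton] at hθ ⊢
        subst hθ
        exact g.2)).1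
    rw [Finset.sum_singleton] at h3
    have hlt : (E.subgroupOf (conjStabilizer E δ)).index < n := by
      have h4 := Subgroup.relIndex_mul_index hET
      have h5 : 1 < (conjStabilizer E δ).index := by
        have := (conjStabilizer E δ).index_ne_zero_of_finite
        have : (conjStabilizer E δ).index ≠ 1 := fun h => hT (Subgroup.index_eq_one.mp h)
        lia
      have h6 : E.relIndex (conjStabilizer E δ) ≠ 0 := Subgroup.index_ne_zero_of_finite
      rw [hn] at h4
      change E.relIndex (conjStabilizer E δ) < n
      nlinarith [Nat.pos_of_ne_zero h6]
    obtain ⟨χ, hχ, e⟩ := IH _ hlt (conjStabilizer E δ) (E.subgroupOf _) (hG.subgroup _) (by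
      rwa [Nat.card_congr (Subgroup.subgroupOfEquivOfLe hET).toEquiv]) rfl _ h3
    exact ⟨_, hχ.indChar, sum_isoPart_eq_piRestrict_indChar hφ hE hδ (by
      rw [← e, isoPart_comp_hom]
      rfl)⟩

/-- The Fong–Swan theorem for `σ`-separable groups, in terms of local characters. -/
theorem IsSep.hasLifts [Finite G] (h : IsSep σ G) : HasLifts σ G :=
  .of_isSep_of_index _ G ⊥ h (by rw [Subgroup.card_bot]; exact isPiNumber_one) rfl

end FongSwan

section Irreducible

variable {σ : Set ℕ} {G H : Type} [Group G] [Group H]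

theorem IsLocChar.ext_of_eq {φ φ' : G → ℂ} (h : IsLocChar σ G φ) (h' : IsLocChar σ G φ')
    (e : ∀ g, IsPiElt σ g → φ g = φ' g) : φ = φ' := funext fun g => by
  by_cases hg : IsPiElt σ g
  · exact e g hg
  · rw [h.zero g hg, h'.zero g hg]

theorem IsLocChar.add {φ φ' : G → ℂ} (h : IsLocChar σ G φ) (h' : IsLocChar σ G φ') :
    IsLocChar σ G (φ + φ') where
  conj x g := by simp only [Pi.add_apply, h.conj, h'.conj]
  zero g hg := by simp only [Pi.add_apply, h.zero g hg, h'.zero g hg, add_zero]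
  res P hP := (h.res P hP).add (h'.res P hP)

theorem IsPartialChar.of_isSep [Finite G] (hG : IsSep σ G) {φ : G → ℂ} (h : IsLocChar σ G φ)
    (h0 : φ ≠ 0) : IsPartialChar σ G φ := by
  obtain ⟨χ, hχ, rfl⟩ := hG.hasLifts φ h
  refine ⟨χ, hχ, ?_, rfl⟩
  rintro rfl
  exact h0 (funext fun g => by simp [piRestrict])

theorem piRestrict_one (χ : G → ℂ) : piRestrict σ χ 1 = χ 1 := if_pos isPiElt_one

theorem IsPartialChar.map_one_ne_zero {φ : G → ℂ} (h : IsPartialChar σ G φ) : φ 1 ≠ 0 := by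
  obtain ⟨χ, hχ, h0, rfl⟩ := h
  rw [piRestrict_one]
  exact fun h => h0 (hχ.eq_zero_of_map_one h)

/-- Local characters on a quotient by a normal `σ'`-subgroup inherit irreducibility. -/
theorem IsIPiChar.exists_quotient [Finite G] (hG : IsSep σ G) {β : G → ℂ} (hβ : IsCharacter G β)
    (h : IsIPiChar σ G (piRestrict σ β)) (f : G →* H) (hf : Function.Surjective f)
    (hk : IsPiNumber σᶜ (Nat.card f.ker)) :
    ∃ φ, IsLocChar σ H φ ∧ (∀ a, IsPiElt σ a → β a = φ (f a)) ∧
      ∀ φ₁ φ₂, IsLocChar σ H φ₁ → IsLocChar σ H φ₂ → φ = φ₁ + φ₂ → φ₁ = 0 ∨ φ₂ = 0 := by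
  have := Finite.of_surjective f hf
  obtain ⟨φ, hφ, e⟩ := hβ.isLocChar.exists_quotient f hf hk
  have e' : ∀ a, IsPiElt σ a → β a = φ (f a) := fun a ha => by
    rw [← e a ha, piRestrict, if_pos ha]
  refine ⟨φ, hφ, e', fun φ₁ φ₂ h1 h2 hs => ?_⟩
  obtain ⟨ξ₁, hξ₁, rfl⟩ := (hG.of_surjective f hf).hasLifts φ₁ h1
  obtain ⟨ξ₂, hξ₂, rfl⟩ := (hG.of_surjective f hf).hasLifts φ₂ h2
  by_contra! h0
  refine h.2 ⟨_, _, ⟨_, hξ₁.comp f, ?_, rfl⟩, ⟨_, hξ₂.comp f, ?_, rfl⟩, funext fun a => ?_⟩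
  · intro h3
    refine h0.1 (h1.eq_zero ?_)
    rw [piRestrict_one]
    simpa using congrFun h3 1
  · intro h3
    refine h0.2 (h2.eq_zero ?_)
    rw [piRestrict_one]
    simpa using congrFun h3 1
  · simp only [piRestrict, Pi.add_apply]
    split_ifs with ha
    · rw [e' a ha, hs, Pi.add_apply, piRestrict, piRestrict, if_pos (ha.map f), if_pos (ha.map f)]
    · rw [add_zero]

/-- The restriction to a supplement of a normal `σ'`-subgroup remains irreducible. -/
theorem IsIPiChar.isIrrChar_resChar [Finite G] (hG : IsSep σ G) {β : G → ℂ}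
    (hβ : IsCharacter G β) (h : IsIPiChar σ G (piRestrict σ β)) {N : Subgroup G} [N.Normal]
    (hN : IsPiNumber σᶜ (Nat.card N)) {Y : Subgroup G} (hY : N ⊔ Y = ⊤) :
    IsIrrChar Y (resChar Y β) := by
  obtain ⟨φ, hφ, e, hirr⟩ := h.exists_quotient hG hβ (QuotientGroup.mk' N)
    (QuotientGroup.mk'_surjective N) (by rwa [QuotientGroup.ker_mk'])
  have hf : Function.Surjective ((QuotientGroup.mk' N).comp Y.subtype) := by
    rw [← MonoidHom.range_eq_top, MonoidHom.range_comp, Subgroup.range_subtype, ← top_le_iff]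
    rintro x -
    obtain ⟨g, rfl⟩ := QuotientGroup.mk'_surjective N x
    obtain ⟨n, hn, y, hy, rfl⟩ := Subgroup.mem_sup_of_normal_left.mp
      (hY.symm ▸ Subgroup.mem_top g : g ∈ N ⊔ Y)
    refine ⟨y, hy, ?_⟩
    rw [map_mul, QuotientGroup.mk'_apply N n, (QuotientGroup.eq_one_iff n).mpr hn, one_mul]
  have hk : IsPiNumber σᶜ (Nat.card ((QuotientGroup.mk' N).comp Y.subtype).ker) := by
    refine isPiNumber_card_of_forall fun k => ?_
    rw [← isPiElt_coe, ← isPiElt_coe]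
    refine isPiElt_of_mem hN ?_
    have := MonoidHom.mem_ker.mp k.2
    rwa [MonoidHom.comp_apply, QuotientGroup.mk'_apply, QuotientGroup.eq_one_iff] at this
  refine ⟨hβ.comp Y.subtype, fun h0 => h.1.map_one_ne_zero ?_, ?_⟩
  · rw [piRestrict_one]
    exact congrFun h0 1
  rintro ⟨χ₁, χ₂, h1, h1', h2, h2', hs⟩
  obtain ⟨ψ₁, hψ₁, e₁⟩ := h1.isLocChar.exists_quotient _ hf hk
  obtain ⟨ψ₂, hψ₂, e₂⟩ := h2.isLocChar.exists_quotient _ hf hk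
  have hsum : φ = ψ₁ + ψ₂ := hφ.ext_of_eq (hψ₁.add hψ₂) fun b hb => by
    obtain ⟨a, ha, rfl⟩ := exists_piElt_map_eq _ hf hk hb
    have h3 := e a (isPiElt_coe.mpr ha)
    rw [Pi.add_apply, ← e₁ a ha, ← e₂ a ha, piRestrict, piRestrict, if_pos ha, if_pos ha]
    exact h3.symm.trans (congrFun hs a)
  rcases hirr ψ₁ ψ₂ hψ₁ hψ₂ hsum with h0 | h0
  · refine h1' (h1.eq_zero_of_map_one ?_)
    rw [← piRestrict_one  (σ := σ) χ₁, e₁ 1 isPiElt_one, h0, Pi.zero_apply]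
  · refine h2' (h2.eq_zero_of_map_one ?_)
    rw [← piRestrict_one  (σ := σ) χ₂, e₂ 1 isPiElt_one, h0, Pi.zero_apply]

end Irreducible

section Palindrome

variable {E : Type} [Group E]

theorem List.Perm.prod_mul_reverse_prod (hE : commutator E ≤ Subgroup.center E) {l l' : List E}
    (h : l.Perm l') : l.prod * l.reverse.prod = l'.prod * l'.reverse.prod := by
  induction h with
  | nil => rfl
  | cons a _ ih =>
    simp only [List.prod_cons, List.reverse_cons, List.prod_append, List.prod_nil, mul_one]
    rw [mul_assoc, ← mul_assoc _ _ a, ih]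
    simp only [mul_assoc]
  | swap a b l =>
    simp only [List.prod_cons, List.reverse_cons, List.prod_append, List.prod_nil, mul_one]
    have hz : (a * b * a⁻¹ * b⁻¹) ∈ Subgroup.center E :=
      hE (Subgroup.commutator_mem_commutator (Subgroup.mem_top a) (Subgroup.mem_top b))
    rw [Subgroup.mem_center_iff] at hz
    have h1 : a * b = (a * b * a⁻¹ * b⁻¹) * (b * a) := by group
    calc b * (a * l.prod) * (l.reverse.prod * a * b)
        = b * a * (l.prod * l.reverse.prod) * (a * b) := by simp only [mul_assoc]
      _ = b * a * (l.prod * l.reverse.prod) * (a * b * a⁻¹ * b⁻¹) * (b * a) := by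
        group
      _ = (a * b * a⁻¹ * b⁻¹) * (b * a) * (l.prod * l.reverse.prod) * (b * a) := by
        rw [hz]; simp only [mul_assoc]
      _ = a * (b * l.prod) * (l.reverse.prod * b * a) := by rw [← h1]; simp only [mul_assoc]
  | trans _ _ ih ih' => exact ih.trans ih'

/-- The product of the images of `u` under `f`, taken once in order and once in reverse order. -/
def palindrome {Q : Type} [Fintype Q] (f : Q → E) : E :=
  (Finset.univ.toList.map f).prod * (Finset.univ.toList.map f).reverse.prod

theorem palindrome_comp_equiv (hE : commutator E ≤ Subgroup.center E) {Q : Type} [Fintype Q]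
    (f : Q → E) (e : Q ≃ Q) : palindrome (fun x => f (e x)) = palindrome f := by
  refine List.Perm.prod_mul_reverse_prod hE ?_
  have : (fun x => f (e x)) = f ∘ e := rfl
  rw [this, ← List.map_map]
  refine List.Perm.map f ?_
  rw [List.perm_ext_iff_of_nodup ((Finset.nodup_toList _).map e.injective) (Finset.nodup_toList _)]
  intro x
  simp only [List.mem_map, Finset.mem_toList, Finset.mem_univ, true_and, iff_true]
  exact e.surjective x

theorem map_palindrome {E' : Type} [Group E'] (φ : E →* E') {Q : Type} [Fintype Q] (f : Q → E) :
    φ (palindrome f) = palindrome fun x => φ (f x) := by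
  rw [palindrome, palindrome, map_mul, map_list_prod, map_list_prod, List.map_reverse, List.map_map]
  rfl

theorem palindrome_eq_sq {A : Type} [CommGroup A] {Q : Type} [Fintype Q] (f : Q → A) :
    palindrome f = (∏ x, f x) ^ 2 := by
  rw [palindrome, List.prod_reverse, Finset.prod_map_toList, sq]

theorem Representation.palindrome_smul {V : Type} [AddCommGroup V] [Module ℂ V]
    (τ : Representation ℂ E V) {Q : Type} [Fintype Q] (f g : Q → E) (ω : ℂ)
    (hg : ∀ x, τ (g x) = ω • 1) :
    τ (palindrome fun x => g x * f x) = ω ^ (2 * Fintype.card Q) • τ (palindrome f) := by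
  have key : ∀ l : List Q, τ ((l.map fun x => g x * f x).prod) =
      ω ^ l.length • τ ((l.map f).prod) := fun l => by
    induction l with
    | nil => simp
    | cons a l ih =>
      simp only [List.map_cons, List.prod_cons, map_mul, ih, hg, List.length_cons]
      rw [smul_mul_assoc, one_mul, mul_smul_comm, smul_mul_assoc, smul_smul, pow_succ]
  rw [palindrome, palindrome, map_mul, map_mul, ← List.map_reverse, ← List.map_reverse, key, key,
    smul_mul_assoc, mul_smul_comm, smul_smul, List.length_reverse, Finset.length_toList,
    Finset.card_univ, ← pow_add, two_mul]

end Palindrome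

section Core

variable {E Y : Type} [Group E] [Fintype E] [Group Y] [Fintype Y]
  {V : Type} [AddCommGroup V] [Module ℂ V] [FiniteDimensional ℂ V]

theorem Representation.scalar_of_invariant (τ : Representation ℂ E V) (h : IsIrrChar E τ.character)
    (β : E →* E) (hβ : ∀ e, τ.character (β e) = τ.character e) {g : E} {ω : ℂ}
    (hg : τ g = ω • 1) : τ (β g) = ω • 1 := by
  obtain ⟨S, hS⟩ := τ.exists_intertwiner (τ.comp β) h (funext hβ)
  have h1 := hS g
  rw [hg, mul_smul_comm, mul_one] at h1
  change _ = τ (β g) * S.val at h1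
  calc τ (β g) = τ (β g) * S.val * S.inv := by rw [mul_assoc, S.val_inv, mul_one]
    _ = _ := by rw [← h1, smul_mul_assoc, S.val_inv]

theorem Representation.exists_scalar_of_ne_zero (τ : Representation ℂ E V)
    (h : IsIrrChar E τ.character) (hE : commutator E ≤ Subgroup.center E) {g : E}
    (hg : τ.character g ≠ 0) : ∃ ω : ℂ, τ g = ω • 1 := by
  have := τ.isIrreducible_of_isIrrChar h
  refine τ.exists_eq_smul _ fun n => ?_
  have hz : (n * g * n⁻¹ * g⁻¹) ∈ Subgroup.center E :=
    hE (Subgroup.commutator_mem_commutator (Subgroup.mem_top n) (Subgroup.mem_top g))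
  rw [Subgroup.mem_center_iff] at hz
  obtain ⟨ω, hω⟩ := τ.exists_eq_smul (τ (n * g * n⁻¹ * g⁻¹)) fun x => by rw [← map_mul, hz, map_mul]
  have h1 : τ.character (n * g * n⁻¹) = ω * τ.character g := by
    have : n * g * n⁻¹ = (n * g * n⁻¹ * g⁻¹) * g := by group
    rw [this, Representation.character, map_mul, hω, smul_mul_assoc, one_mul, map_smul]
    rfl
  rw [h.1.map_conj] at h1
  have h2 : ω = 1 := by
    have : (ω - 1) * τ.character g = 0 := by rw [sub_mul, ← h1]; ring
    exact sub_eq_zero.mp ((mul_eq_zero.mp this).resolve_right hg)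
  have h3 : n * g = (n * g * n⁻¹ * g⁻¹) * (g * n) := by group
  rw [← map_mul, h3, map_mul, hω, h2, one_smul, one_mul, map_mul]

variable (ρ : Representation ℂ E V) (T : Representation ℂ Y V) (α : Y →* MulAut E)

theorem Representation.mul_isoProj_of_semilinear (hT : ∀ y e, T y * ρ e = ρ (α y e) * T y)
    (δ : E → ℂ) (y : Y) : T y * ρ.isoProj δ = ρ.isoProj (fun e => δ ((α y)⁻¹ e)) * T y := by
  rw [isoProj, isoProj, mul_smul_comm, smul_mul_assoc, Finset.mul_sum, Finset.sum_mul, map_one]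
  congr 1
  refine Fintype.sum_equiv (α y).toEquiv _ _ fun m => ?_
  rw [mul_smul_comm, smul_mul_assoc, hT]
  congr 2
  exact (MulAut.inv_apply_self E (α y) m⁻¹).symm.trans (by rw [map_inv (α y)]; rfl)

theorem Representation.finrank_mul_sum_stabilizer (hT : ∀ y e, T y * ρ e = ρ (α y e) * T y)
    (hirr : ∀ A : V →ₗ[ℂ] V, (∀ y, T y * A = A * T y) → ∃ c : ℂ, A = c • 1)
    {s : Multiset (E → ℂ)} (hs : ∀ δ ∈ s, IsIrrChar E δ) (e : ρ.character = s.sum) {δ : E → ℂ}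
    (hδ : δ ∈ s) (b b' : E) :
    (Module.finrank ℂ V : ℂ) *
        ∑ y, (if (fun e => δ ((α y)⁻¹ e)) = δ then δ (α y b * b') else 0) =
      Nat.card Y * s.count δ * δ b * δ b' := by
  have h := hs δ hδ
  have hc0 : (s.count δ : ℂ) ≠ 0 := Nat.cast_ne_zero.mpr (Multiset.count_pos.mpr hδ).ne'
  obtain ⟨c, hc⟩ := hirr (∑ y, T y * (ρ b * ρ.isoProj δ) * T y⁻¹) (T.average_comm T _)
  have hinv : ∀ y, T y⁻¹ * T y = 1 := fun y => by rw [← map_mul, inv_mul_cancel, map_one]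
  have hinv' : ∀ y, T y * T y⁻¹ = 1 := fun y => by rw [← map_mul, mul_inv_cancel, map_one]
  have h1 := congrArg (LinearMap.trace ℂ V) hc
  rw [map_sum, Finset.sum_congr rfl fun y _ => show _ = s.count δ * δ b by
      rw [LinearMap.trace_mul_comm, ← mul_assoc, hinv, one_mul, LinearMap.trace_mul_comm,
        ρ.trace_isoProj_mul hs e h], map_smul, LinearMap.trace_one, Finset.sum_const,
    Finset.card_univ, ← Nat.card_eq_fintype_card, nsmul_eq_mul, smul_eq_mul] at h1
  have h2 := congrArg (fun A => LinearMap.trace ℂ V (A * (ρ b' * ρ.isoProj δ))) hc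
  simp only [Finset.sum_mul, map_sum, smul_mul_assoc, one_mul, map_smul, smul_eq_mul] at h2
  rw [LinearMap.trace_mul_comm ℂ (ρ b'), ρ.trace_isoProj_mul hs e h] at h2
  have h3 : ∀ y, LinearMap.trace ℂ V (T y * (ρ b * ρ.isoProj δ) * T y⁻¹ * (ρ b' * ρ.isoProj δ)) =
      s.count δ * (if (fun e => δ ((α y)⁻¹ e)) = δ then δ (α y b * b') else 0) := fun y => by
    have hδ' : IsIrrChar E (fun e => δ ((α y)⁻¹ e)) := h.comp_mulEquiv (α y)⁻¹
    have : T y * (ρ b * ρ.isoProj δ) * T y⁻¹ * (ρ b' * ρ.isoProj δ) =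
        ρ (α y b * b') * (ρ.isoProj (fun e => δ ((α y)⁻¹ e)) * ρ.isoProj δ) := by
      rw [← mul_assoc (T y), hT, mul_assoc (ρ _) (T y), ρ.mul_isoProj_of_semilinear T α hT,
        ← mul_assoc (ρ _), mul_assoc _ (T y) (T y⁻¹), hinv', mul_one, map_mul,
        mul_assoc, mul_assoc, ← mul_assoc _ (ρ b'), ← ρ.isoProj_comm hδ', mul_assoc]
    rw [this, ρ.isoProj_mul hδ' h]
    split_ifs with hh
    · rw [hh, LinearMap.trace_mul_comm, ρ.trace_isoProj_mul hs e h]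
    · simp
  rw [Finset.sum_congr rfl fun y _ => h3 y, ← Finset.mul_sum] at h2
  apply mul_left_cancel₀ hc0
  linear_combination (Module.finrank ℂ V : ℂ) * h2 - (s.count δ : ℂ) * δ b' * h1

/-- The stabilizer of the function `δ` under the action `α`. -/
def autStabilizer (δ : E → ℂ) : Subgroup Y where
  carrier := {y | ∀ e, δ (α y e) = δ e}
  one_mem' e := by simp
  mul_mem' {y z} hy hz e := by rw [map_mul, MulAut.mul_apply, hy, hz]
  inv_mem' {y} hy e := by rw [← hy]; simp

theorem mem_autStabilizer {δ : E → ℂ} {y : Y} : y ∈ autStabilizer α δ ↔ ∀ e, δ (α y e) = δ e :=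
  Iff.rfl

theorem comp_inv_eq_iff {δ : E → ℂ} {y : Y} :
    (fun e => δ ((α y)⁻¹ e)) = δ ↔ y ∈ autStabilizer α δ := by
  rw [← inv_mem_iff, mem_autStabilizer, funext_iff, map_inv]

theorem Representation.index_autStabilizer_dvd (hT : ∀ y e, T y * ρ e = ρ (α y e) * T y)
    (hirr : ∀ A : V →ₗ[ℂ] V, (∀ y, T y * A = A * T y) → ∃ c : ℂ, A = c • 1)
    {s : Multiset (E → ℂ)} (hs : ∀ δ ∈ s, IsIrrChar E δ) (e : ρ.character = s.sum) {δ : E → ℂ}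
    (hδ : δ ∈ s) : (autStabilizer α δ).index ∣ Module.finrank ℂ V := by
  have h := hs δ hδ
  have h1 := ρ.finrank_mul_sum_stabilizer T α hT hirr hs e hδ 1 1
  simp only [comp_inv_eq_iff, map_one, mul_one] at h1
  rw [← Finset.sum_filter, Finset.sum_const, nsmul_eq_mul] at h1
  obtain ⟨d, hd⟩ := h.1.exists_nat
  have h2 : (Finset.univ.filter fun y => y ∈ autStabilizer α δ).card =
      Nat.card (autStabilizer α δ) := by
    rw [Nat.card_eq_fintype_card, Fintype.card_subtype]
  have h3 : (Nat.card (autStabilizer α δ) : ℂ) ≠ 0 := Nat.card_cast_ne_zero _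
  rw [h2, ← Subgroup.card_mul_index (autStabilizer α δ)] at h1
  refine ⟨s.count δ * d, ?_⟩
  have h0 := h.map_one_ne_zero
  have : (Module.finrank ℂ V : ℂ) = (autStabilizer α δ).index * (s.count δ * d) := by
    apply mul_left_cancel₀ (mul_ne_zero h3 h0)
    push_cast at h1
    rw [← hd]
    linear_combination h1
  exact_mod_cast this

theorem Subgroup.le_of_coprime_index {G : Type} [Group G] [Finite G] (Q S : Subgroup G) [Q.Normal]
    (h : (Nat.card Q).Coprime S.index) : Q ≤ S := by
  rw [← Subgroup.relIndex_eq_one]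
  have h1 := Subgroup.card_mul_relIndex' (inf_le_right : S ⊓ Q ≤ Q)
  have h2 := Subgroup.card_mul_relIndex' (inf_le_left : S ⊓ Q ≤ S)
  have h3 := Subgroup.card_mul_relIndex' (le_sup_right : Q ≤ S ⊔ Q)
  have h4 := Subgroup.card_mul_relIndex' (le_sup_left : S ≤ S ⊔ Q)
  rw [Subgroup.inf_relIndex_right] at h1
  rw [Subgroup.inf_relIndex_left] at h2
  rw [Subgroup.relIndex_sup_right, ← h1] at h3
  have h5 : S.relIndex Q = S.relIndex (S ⊔ Q) := by
    refine Nat.eq_of_mul_eq_mul_left (Nat.card_pos (α := S)) ?_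
    rw [h4, ← h3, ← h2]
    ring
  exact Nat.eq_one_of_dvd_coprimes h (Subgroup.relIndex_dvd_card S Q)
    (h5 ▸ Subgroup.relIndex_dvd_index_of_le le_sup_left)

theorem Representation.map_mul_inv_eq_one_of_coprime
    (hT : ∀ y e, T y * ρ e = ρ (α y e) * T y)
    (hirr : ∀ A : V →ₗ[ℂ] V, (∀ y, T y * A = A * T y) → ∃ c : ℂ, A = c • 1)
    (hE : commutator E ≤ Subgroup.center E) (hodd : Odd (Nat.card E)) (Q : Subgroup Y) [Q.Normal]
    (hQE : (Nat.card Q).Coprime (Nat.card E)) (hQV : (Nat.card Q).Coprime (Module.finrank ℂ V))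
    (hgen : Subgroup.closure {e | ∃ m, ∃ x ∈ Q, e = m * (α x m)⁻¹} = ⊤) {x : Y} (hx : x ∈ Q)
    (m : E) : ρ (m * (α x m)⁻¹) = 1 := by
  obtain ⟨s, hs, e⟩ := (ρ.isCharacter_character).exists_multiset
  have hinv : ∀ δ ∈ s, ∀ y ∈ Q, ∀ e, δ (α y e) = δ e := fun δ hδ y hy =>
    Subgroup.le_of_coprime_index Q _ (hQV.coprime_dvd_right
      (ρ.index_autStabilizer_dvd T α hT hirr hs e hδ)) hy
  have hscal : ∀ δ ∈ s, ∀ m, ∀ y ∈ Q, δ (m * (α y m)⁻¹) ≠ 0 := by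
    intro δ hδ m y hy h0
    have h := hs δ hδ
    obtain ⟨W, _, _, _, τ, rfl, _⟩ := h.exists_rep
    set b := m * (α y m)⁻¹ with hb
    set F : E → E := fun u => palindrome fun z : Q => α z u with hF
    have hFc : F b ∈ Subgroup.center E := by
      apply hE
      rw [← Abelianization.ker_of, MonoidHom.mem_ker, hF]
      dsimp only
      rw [map_palindrome, palindrome_eq_sq]
      have : ∏ z : Q, Abelianization.of (α (z : Y) b) = 1 := by
        simp only [hb, map_mul, map_inv, Finset.prod_mul_distrib, Finset.prod_inv_distrib]
        rw [mul_inv_eq_one]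
        refine (Fintype.prod_equiv (Equiv.mulRight (⟨y, hy⟩ : Q)) _ _ fun z => ?_).symm
        simp
      rw [this, one_pow]
    have hterm : ∀ w ∈ autStabilizer α τ.character,
        τ.character (α w b * b⁻¹) = 0 ∨ τ.character (α w b * b⁻¹) = τ.character 1 := by
      intro w hw
      by_cases h1 : τ.character (α w b * b⁻¹) = 0
      · exact Or.inl h1
      right
      set g := α w b * b⁻¹ with hg
      obtain ⟨ω, hω⟩ := τ.exists_scalar_of_ne_zero h hE h1
      have hnt : Nontrivial W := by
        by_contra hW
        rw [not_nontrivial_iff_subsingleton] at hW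
        exact h1 (by rw [Representation.character, Subsingleton.elim (τ g) 0, map_zero])
      have hsm : ∀ c d : ℂ, c • (1 : Module.End ℂ W) = d • 1 → c = d := fun c d hcd =>
        smul_left_injective ℂ (one_ne_zero (α := Module.End ℂ W)) hcd
      have hFw : α w (F b) = F (g * b) := by
        have h2 := map_palindrome (α w).toMonoidHom (fun z : Q => α z b)
        have h3 := palindrome_comp_equiv hE (fun z : Q => α z (g * b))
          (MulAut.conjNormal (H := Q) w).toEquiv
        refine h2.trans (Eq.trans ?_ h3)
        congr 1
        ext z
        simp [hg, MulAut.conjNormal_apply]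
      have h4 : τ (F (g * b)) = ω ^ (2 * Fintype.card Q) • τ (F b) := by
        have := τ.palindrome_smul (fun z : Q => α z b) (fun z : Q => α z g) ω fun z =>
          τ.scalar_of_invariant h (α z).toMonoidHom (hinv _ hδ z z.2) hω
        simpa only [hF, map_mul] using this
      rw [Subgroup.mem_center_iff] at hFc
      obtain ⟨c, hc⟩ := τ.exists_eq_smul (τ (F b)) fun n => by
        rw [← map_mul, hFc, map_mul]
      have h9 : τ (α w (F b)) = c • 1 := τ.scalar_of_invariant h (α w).toMonoidHom hw hc
      rw [← hFw, h9, hc, smul_smul] at h4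
      have hc0 : c ≠ 0 := by
        rintro rfl
        have : τ (F b * (F b)⁻¹) = 0 := by rw [map_mul, hc, zero_smul, zero_mul]
        rw [mul_inv_cancel, map_one] at this
        exact one_ne_zero this
      have h5 : ω ^ (2 * Fintype.card Q) = 1 :=
        mul_right_cancel₀ hc0 ((hsm _ _ h4).symm.trans (one_mul c).symm)
      have h6 : ω ^ Nat.card E = 1 := by
        apply hsm
        calc ω ^ Nat.card E • (1 : Module.End ℂ W) = (ω • 1) ^ Nat.card E := by
              rw [smul_pow, one_pow]
          _ = τ (g ^ Nat.card E) := by rw [map_pow, hω]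
          _ = _ := by rw [pow_card_eq_one', map_one, one_smul]
      have h7 : ω = 1 := by
        have h8 : (2 * Fintype.card Q).Coprime (Nat.card E) := by
          rw [← Nat.card_eq_fintype_card]
          exact Nat.Coprime.mul_left (Nat.coprime_two_left.mpr hodd) hQE
        have := pow_gcd_eq_one.mpr ⟨h5, h6⟩
        rwa [h8, pow_one] at this
      rw [Representation.character, Representation.character, hω, h7, one_smul, map_one τ]
    have h1 := ρ.finrank_mul_sum_stabilizer T α hT hirr hs e hδ b b⁻¹
    rw [h0, mul_zero, zero_mul] at h1
    simp only [comp_inv_eq_iff] at h1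
    have hc0 : (s.count τ.character : ℂ) ≠ 0 :=
      Nat.cast_ne_zero.mpr (Multiset.count_pos.mpr hδ).ne'
    have hV : (Module.finrank ℂ V : ℂ) ≠ 0 := fun hV => by
      have h2 := ρ.finrank_mul_sum_stabilizer T α hT hirr hs e hδ 1 1
      rw [hV, zero_mul] at h2
      exact mul_ne_zero (mul_ne_zero (mul_ne_zero (Nat.card_cast_ne_zero Y) hc0)
        h.map_one_ne_zero) h.map_one_ne_zero h2.symm
    have h2 := (mul_eq_zero.mp h1).resolve_left hV
    have h3 : ∀ w, (if w ∈ autStabilizer α τ.character then τ.character (α w b * b⁻¹) else 0) =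
        if w ∈ autStabilizer α τ.character ∧ τ.character (α w b * b⁻¹) ≠ 0
          then τ.character 1 else 0 := by
      intro w
      by_cases hw : w ∈ autStabilizer α τ.character
      · rcases hterm w hw with h4 | h4
        · simp [h4]
        · simp [hw, h4]
      · simp [hw]
    rw [Finset.sum_congr rfl fun w _ => h3 w, ← Finset.sum_filter, Finset.sum_const,
      nsmul_eq_mul] at h2
    have h4 := (mul_eq_zero.mp h2).resolve_right h.map_one_ne_zero
    rw [Nat.cast_eq_zero, Finset.card_eq_zero, Finset.filter_eq_empty_iff] at h4
    refine h4 (Finset.mem_univ 1) ⟨one_mem _, ?_⟩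
    simpa using h.map_one_ne_zero
  apply ρ.eq_one_of_char_pow
  intro i
  have happ : ∀ g, s.sum g = (s.map fun δ => δ g).sum := fun g =>
    map_multiset_sum (Pi.evalAddMonoidHom (fun _ : E => ℂ) g) s
  rw [e, happ, happ]
  refine congrArg _ (Multiset.map_congr rfl fun δ hδ => ?_)
  have h := hs δ hδ
  obtain ⟨W, _, _, _, τ, rfl, _⟩ := h.exists_rep
  have hall : ∀ g, ∃ ω : ℂ, τ g = ω • 1 := by
    intro g
    have hg : g ∈ Subgroup.closure {e | ∃ m, ∃ x ∈ Q, e = m * (α x m)⁻¹} :=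
      hgen ▸ Subgroup.mem_top g
    induction hg using Subgroup.closure_induction with
    | mem g hg =>
      obtain ⟨m, y, hy, rfl⟩ := hg
      exact τ.exists_scalar_of_ne_zero h hE (hscal _ hδ m y hy)
    | one => exact ⟨1, by simp⟩
    | mul a b _ _ ha hb =>
      obtain ⟨ω, hω⟩ := ha
      obtain ⟨ω', hω'⟩ := hb
      exact ⟨ω * ω', by rw [map_mul, hω, hω', smul_mul_smul_comm, one_mul]⟩
    | inv a _ ha =>
      obtain ⟨ω, hω⟩ := ha
      refine τ.exists_eq_smul _ fun n => ?_
      have hc : Commute (τ a) (τ n) := by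
        rw [hω]
        exact (Commute.one_left _).smul_left _
      calc τ n * τ a⁻¹ = τ a⁻¹ * (τ a * τ n) * τ a⁻¹ := by
            rw [← mul_assoc, ← map_mul τ a⁻¹ a, inv_mul_cancel, map_one, one_mul]
        _ = τ a⁻¹ * τ n := by
            rw [hc.eq, mul_assoc, mul_assoc, ← map_mul τ a a⁻¹, mul_inv_cancel, map_one, mul_one]
  obtain ⟨ω, hω⟩ := hall m
  have h1 : τ (α x m) = τ m := by
    rw [hω]
    exact τ.scalar_of_invariant h (α x).toMonoidHom (hinv _ hδ x hx) hω
  have h2 : τ (m * (α x m)⁻¹) = 1 := by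
    have h3 : τ (α x m * (α x m)⁻¹) = 1 := by rw [mul_inv_cancel, map_one]
    rw [map_mul, h1] at h3
    rw [map_mul, h3]
  rw [Representation.character, Representation.character, map_pow, h2, one_pow, map_one τ]

end Core

section Sylow

variable {A : Type} [Group A] [Finite A]

theorem Subgroup.exists_conj_mem_of_isPGroup {p : ℕ} [Fact p.Prime] {K R R' : Subgroup A}
    (hRK : R ≤ K) (hR : IsPGroup p R) (hp : ¬p ∣ R.relIndex K) (hR'K : R' ≤ K)
    (hR' : IsPGroup p R') : ∃ k ∈ K, ∀ x ∈ R', k * x * k⁻¹ ∈ R := by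
  have h1 : IsPGroup p (R.subgroupOf K) := hR.of_equiv (Subgroup.subgroupOfEquivOfLe hRK).symm
  have h2 : IsPGroup p (R'.subgroupOf K) := hR'.of_equiv (Subgroup.subgroupOfEquivOfLe hR'K).symm
  obtain ⟨P, hP⟩ := h2.exists_le_sylow
  obtain ⟨k, hk⟩ := MulAction.exists_smul_eq K P (h1.toSylow hp)
  refine ⟨k, k.2, fun x hx => ?_⟩
  have h3 : (⟨x, hR'K hx⟩ : K) ∈ (P : Subgroup K) := hP (Subgroup.mem_subgroupOf.mpr hx)
  have h4 : k * ⟨x, hR'K hx⟩ * k⁻¹ ∈ ((k • P : Sylow p K) : Subgroup K) := by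
    exact Subgroup.smul_mem_pointwise_smul _ (MulAut.conj k) _ h3
  rw [hk] at h4
  exact Subgroup.mem_subgroupOf.mp h4

theorem Subgroup.frattini {p : ℕ} [Fact p.Prime] {K R S : Subgroup A} (hRK : R ≤ K)
    (hR : IsPGroup p R) (hp : ¬p ∣ R.relIndex K) (hKS : K ≤ S) (hS : S ≤ normalizer ↑K) :
    S ≤ K ⊔ (S ⊓ normalizer ↑R) := by
  intro s hs
  have h1 : R.map (MulAut.conj s).toMonoidHom ≤ K := by
    rintro _ ⟨x, hx, rfl⟩
    exact (Subgroup.mem_normalizer_iff.mp (hS hs) x).mp (hRK hx)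
  obtain ⟨k, hk, h2⟩ := Subgroup.exists_conj_mem_of_isPGroup hRK hR hp h1 (hR.map _)
  have h3 : k * s ∈ normalizer (R : Set A) := by
    refine Subgroup.mem_normalizer_fintype fun x hx => ?_
    have := h2 _ ⟨x, hx, rfl⟩
    convert this using 1
    simp [mul_assoc]
  have h4 : s = k⁻¹ * (k * s) := by group
  rw [h4]
  exact Subgroup.mul_mem_sup (inv_mem hk) ⟨mul_mem (hKS hk) hs, h3⟩

theorem Subgroup.relIndex_sup_dvd_card {N Q : Subgroup A} (hQ : Q ≤ normalizer ↑N) :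
    Q.relIndex (N ⊔ Q) ∣ Nat.card N := by
  have h1 : (N.subgroupOf (N ⊔ Q)).Normal :=
    (Subgroup.normal_subgroupOf_iff_le_normalizer le_sup_left).mpr (sup_le le_normalizer hQ)
  have h2 := Subgroup.card_sup_dvd' (Q.subgroupOf (N ⊔ Q)) (N.subgroupOf (N ⊔ Q))
  rw [← Subgroup.subgroupOf_sup le_sup_right le_sup_left, sup_comm Q N, Subgroup.subgroupOf_self,
    Subgroup.card_top, Nat.card_congr (Subgroup.subgroupOfEquivOfLe le_sup_left).toEquiv,
    Nat.card_congr (Subgroup.subgroupOfEquivOfLe le_sup_right).toEquiv,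
    ← Subgroup.card_mul_relIndex' (le_sup_right : Q ≤ N ⊔ Q), mul_comm] at h2
  exact Nat.dvd_of_mul_dvd_mul_right Nat.card_pos h2

theorem Subgroup.exists_sylow_normalized {p q : ℕ} [Fact p.Prime] [Fact q.Prime] {N Q : Subgroup A}
    (hQN : Q ≤ normalizer ↑N) (hQ : IsPGroup q Q) (hq : ¬q ∣ Nat.card N) :
    ∃ P ≤ N, IsPGroup p P ∧ ¬p ∣ P.relIndex N ∧ Q ≤ normalizer ↑P := by
  let f : Q →* MulAut N := N.normalizerMonoidHom.comp (Subgroup.inclusion hQN)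
  let _ : MulAction (MulAut N) (Sylow p N) := Sylow.pointwiseMulAction
  let _ : MulAction Q (Sylow p N) := MulAction.compHom _ f
  have h1 : ¬q ∣ Nat.card (Sylow p N) := fun h =>
    hq (h.trans ((default : Sylow p N).card_dvd_index.trans (Subgroup.index_dvd_card _)))
  obtain ⟨P, hP⟩ := hQ.nonempty_fixed_point_of_prime_not_dvd_card _ h1
  have h2 : (P : Subgroup N).map N.subtype ≤ N := Subgroup.map_subtype_le _
  refine ⟨_, h2, P.2.map _, ?_, ?_⟩
  · have : ((P : Subgroup N).map N.subtype).relIndex N = (P : Subgroup N).index := by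
      rw [Subgroup.relIndex, Subgroup.subgroupOf, Subgroup.comap_map_eq_self_of_injective
        N.subtype_injective]
    rw [this]
    exact P.not_dvd_index
  · rw [Subgroup.le_normalizer_iff]
    rintro x hx _ ⟨n, hn, rfl⟩
    have h3 : (f ⟨x, hx⟩) • P = P := hP ⟨x, hx⟩
    have h4 : f ⟨x, hx⟩ n ∈ (P : Subgroup N) := by
      have h5 : f ⟨x, hx⟩ • n ∈ (((f ⟨x, hx⟩) • P : Sylow p N) : Subgroup N) :=
        Subgroup.smul_mem_pointwise_smul _ (f ⟨x, hx⟩) _ hn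
      rwa [h3] at h5
    exact ⟨_, h4, rfl⟩

theorem Subgroup.sup_inf_normalizer_eq {p q : ℕ} [Fact p.Prime] [Fact q.Prime]
    {S N Q P : Subgroup A} (hN : N ≤ S) (hQS : Q ≤ S) (hSN : S ≤ normalizer ↑N)
    (hSQ : S ≤ normalizer ↑(N ⊔ Q)) (hQ : IsPGroup q Q) (hq : ¬q ∣ Nat.card N) (hPN : P ≤ N)
    (hP : IsPGroup p P) (hp : ¬p ∣ P.relIndex N) (hQP : Q ≤ normalizer ↑P) :
    N ⊔ (S ⊓ normalizer ↑P ⊓ normalizer ↑Q) = S := by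
  have h0 : Q ≤ S ⊓ normalizer ↑P ⊓ normalizer ↑Q := le_inf (le_inf hQS hQP) le_normalizer
  refine le_antisymm (sup_le hN (inf_le_left.trans inf_le_left)) ?_
  refine (Subgroup.frattini hPN hP hp hN hSN).trans (sup_le le_sup_left ?_)
  have hS' : S ⊓ normalizer ↑P ≤ normalizer ↑((N ⊔ Q) ⊓ normalizer (P : Set A)) := by
    rw [Subgroup.le_normalizer_iff]
    rintro s ⟨hs, hsP⟩ x ⟨hx, hxP⟩
    exact ⟨(Subgroup.mem_normalizer_iff.mp (hSQ hs) x).mp hx,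
      Subgroup.mul_mem _ (Subgroup.mul_mem _ hsP hxP) (Subgroup.inv_mem _ hsP)⟩
  have h1 : ¬q ∣ Q.relIndex ((N ⊔ Q) ⊓ normalizer (P : Set A)) := fun h => by
    refine hq (h.trans (Dvd.dvd.trans ?_ (Subgroup.relIndex_sup_dvd_card (hQS.trans hSN))))
    exact Dvd.intro _ (Subgroup.relIndex_mul_relIndex _ _ _ (le_inf le_sup_right hQP) inf_le_left)
  refine (Subgroup.frattini (le_inf le_sup_right hQP) hQ h1
    (inf_le_inf_right _ (sup_le hN hQS)) hS').trans (sup_le ?_ le_sup_right)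
  exact inf_le_left.trans (sup_le le_sup_left (h0.trans le_sup_right))

end Sylow

section Centralizing

open scoped commutatorElement

variable {A : Type} [Group A] [Finite A] {V : Type} [AddCommGroup V] [Module ℂ V]
  [FiniteDimensional ℂ V]

/-- `ρ` restricted to the subgroup `Y` satisfies the conclusion of Schur's lemma. -/
def Representation.IrreducibleOn (ρ : Representation ℂ A V) (Y : Subgroup A) : Prop :=
  ∀ T : V →ₗ[ℂ] V, (∀ y ∈ Y, ρ y * T = T * ρ y) → ∃ c : ℂ, T = c • 1

/-- A `q`-group `Q` and a normal `q'`-subgroup `N` of odd order of a group `S` with `N ⊔ Q` normal,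
such that `ρ` has degree prime to `q` and is irreducible on every supplement of `N` in `S`. -/
structure Representation.CoprimeConfig (ρ : Representation ℂ A V) (q : ℕ) (S N Q : Subgroup A) :
    Prop where
  left_le : N ≤ S
  right_le : Q ≤ S
  isPGroup : IsPGroup q Q
  le_left : S ≤ Subgroup.normalizer ↑N
  le_sup : S ≤ Subgroup.normalizer ↑(N ⊔ Q)
  odd : Odd (Nat.card N)
  not_dvd : ¬q ∣ Nat.card N
  not_dvd_finrank : ¬q ∣ Module.finrank ℂ V
  irr : ∀ Y ≤ S, N ⊔ Y = S → ρ.IrreducibleOn Y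

variable {ρ : Representation ℂ A V} {q : ℕ} {S N Q : Subgroup A}

theorem Representation.CoprimeConfig.descend (h : ρ.CoprimeConfig q S N Q) {Y M : Subgroup A}
    (hQY : Q ≤ Y) (hYQ : Y ≤ Subgroup.normalizer ↑Q) (hNY : N ⊔ Y = S) (hM : M ≤ N)
    (hYM : Y ≤ Subgroup.normalizer ↑M) : ρ.CoprimeConfig q (M ⊔ Y) M Q where
  left_le := le_sup_left
  right_le := hQY.trans le_sup_right
  isPGroup := h.isPGroup
  le_left := sup_le Subgroup.le_normalizer hYM
  le_sup := sup_le (le_sup_left.trans Subgroup.le_normalizer)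
    ((le_inf hYM hYQ).trans (Subgroup.normalizer_inf_normalizer_le_normalizer_sup _ _))
  odd := h.odd.of_dvd_nat (Subgroup.card_dvd_of_le hM)
  not_dvd hd := h.not_dvd (hd.trans (Subgroup.card_dvd_of_le hM))
  not_dvd_finrank := h.not_dvd_finrank
  irr Y' hY' hMY' := by
    have h1 : M ⊔ Y ≤ S := hNY ▸ sup_le_sup_right hM Y
    refine h.irr Y' (hY'.trans h1) ?_
    rw [← hNY, ← sup_eq_left.mpr hM, sup_assoc, hMY', sup_assoc]

theorem Representation.CoprimeConfig.map_commutator_eq_one [Fact q.Prime]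
    (h : ρ.CoprimeConfig q S N Q) {Y : Subgroup A} (hQY : Q ≤ Y)
    (hYQ : Y ≤ Subgroup.normalizer ↑Q) (hNY : N ⊔ Y = S) (hN : ⁅⁅N, N⁆, N⁆ = ⊥) (hNQ : ⁅N, Q⁆ = N) :
    ∀ n ∈ N, ∀ x ∈ Q, ρ (n * x * n⁻¹ * x⁻¹) = 1 := by
  have hYS : Y ≤ S := hNY ▸ le_sup_right
  have hYN : Y ≤ Subgroup.normalizer ↑N := hYS.trans h.le_left
  have := Fintype.ofFinite N
  have := Fintype.ofFinite Y
  let α : Y →* MulAut N := N.normalizerMonoidHom.comp (Subgroup.inclusion hYN)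
  have hα : ∀ (y : Y) (n : N), ((α y n : N) : A) = y * n * (y : A)⁻¹ := fun y n => rfl
  have hQn : (Q.subgroupOf Y).Normal := (Subgroup.normal_subgroupOf_iff_le_normalizer hQY).mpr hYQ
  have hcard : Nat.card (Q.subgroupOf Y) = Nat.card Q :=
    Nat.card_congr (Subgroup.subgroupOfEquivOfLe hQY).toEquiv
  obtain ⟨k, hk⟩ := IsPGroup.iff_card.mp h.isPGroup
  have hcop : ∀ m, ¬q ∣ m → (Nat.card (Q.subgroupOf Y)).Coprime m := fun m hm => by
    rw [hcard, hk]
    exact Nat.Coprime.pow_left _ ((Nat.Prime.coprime_iff_not_dvd Fact.out).mpr hm)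
  intro n hn x hx
  have key := Representation.map_mul_inv_eq_one_of_coprime (ρ.comp N.subtype) (ρ.comp Y.subtype) α
    (fun y e => by
      simp only [MonoidHom.comp_apply, Subgroup.coe_subtype, hα, ← map_mul]
      simp [mul_assoc])
    (fun T hT => h.irr Y hYS hNY T fun y hy => hT ⟨y, hy⟩)
    (by
      rw [commutator_def, Subgroup.commutator_le]
      intro a _ b _
      rw [Subgroup.mem_center_iff]
      intro c
      have h1 : ⁅(a : A), (b : A)⁆ ∈ ⁅N, N⁆ := Subgroup.commutator_mem_commutator a.2 b.2
      have h2 := Subgroup.mem_centralizer_iff.mp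
        (Subgroup.commutator_eq_bot_iff_le_centralizer.mp hN h1) c c.2
      exact Subtype.ext h2)
    h.odd (Q.subgroupOf Y) (hcop _ h.not_dvd) (hcop _ h.not_dvd_finrank)
    (by
      rw [eq_top_iff, ← Subgroup.map_subtype_le_map_subtype, ← MonoidHom.range_eq_map,
        Subgroup.range_subtype]
      conv_lhs => rw [← hNQ, Subgroup.commutator_def]
      rw [Subgroup.closure_le]
      rintro _ ⟨m, hm, y, hy, rfl⟩
      refine ⟨_, Subgroup.subset_closure ⟨⟨m, hm⟩, ⟨y, hQY hy⟩, hy, rfl⟩, ?_⟩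
      simp [hα, commutatorElement_def, mul_assoc])
    (x := ⟨x, hQY hx⟩) hx ⟨n, hn⟩
  have h3 : n * x * n⁻¹ * x⁻¹ = N.subtype (⟨n, hn⟩ * (α ⟨x, hQY hx⟩ ⟨n, hn⟩)⁻¹) := by
    simp [hα, mul_assoc]
  rw [h3]
  exact key

theorem Representation.CoprimeConfig.commute [Fact q.Prime]
    (hρ : Function.Injective ρ) (h : ρ.CoprimeConfig q S N Q) :
    ∀ n ∈ N, ∀ x ∈ Q, n * x = x * n := by
  induction hn : Nat.card N using Nat.strong_induction_on generalizing S N with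
  | _ k ih =>
  subst hn
  have hQN : Q ≤ Subgroup.normalizer ↑N := h.right_le.trans h.le_left
  have hdesc : ∀ Y M : Subgroup A, Q ≤ Y → Y ≤ Subgroup.normalizer ↑Q → N ⊔ Y = S → M < N →
      Y ≤ Subgroup.normalizer ↑M → ∀ n ∈ M, ∀ x ∈ Q, n * x = x * n :=
    fun Y M hQY hYQ hNY hM hYM => ih _ (Set.ncard_lt_ncard hM (Set.toFinite _))
      (h.descend hQY hYQ hNY hM.le hYM) rfl
  have hcen : ∀ M : Subgroup A, M ≤ Subgroup.centralizer ↑Q ↔ ∀ n ∈ M, ∀ x ∈ Q, n * x = x * n :=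
    fun M => ⟨fun hM n hn x hx => (Subgroup.mem_centralizer_iff.mp (hM hn) x hx).symm,
      fun hM n hn => Subgroup.mem_centralizer_iff.mpr fun x hx => (hM n hn x hx).symm⟩
  by_cases hp : ∃ p : ℕ, p.Prime ∧ IsPGroup p N
  · obtain ⟨p, hp, hNp⟩ := hp
    have : Fact p.Prime := ⟨hp⟩
    have hsup := Subgroup.sup_inf_normalizer_eq h.left_le h.right_le h.le_left h.le_sup h.isPGroup
      h.not_dvd le_rfl hNp (by rw [Subgroup.relIndex_self]; exact hp.not_dvd_one) hQN
    set Y := S ⊓ Subgroup.normalizer (N : Set A) ⊓ Subgroup.normalizer (Q : Set A) with hY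
    have hYQ : Y ≤ Subgroup.normalizer (Q : Set A) := inf_le_right
    have hYN : Y ≤ Subgroup.normalizer (N : Set A) := inf_le_left.trans inf_le_right
    have hQY : Q ≤ Y := le_inf (le_inf h.right_le hQN) Subgroup.le_normalizer
    have hconj : ∀ y : A, ∀ H K : Subgroup A, y ∈ Subgroup.normalizer (H : Set A) →
        y ∈ Subgroup.normalizer (K : Set A) → ∀ k ∈ ⁅H, K⁆, y * k * y⁻¹ ∈ ⁅H, K⁆ := by
      intro y H K hyH hyK
      change ⁅H, K⁆ ≤ (⁅H, K⁆).comap (MulAut.conj y).toMonoidHom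
      rw [Subgroup.commutator_le]
      intro a ha b hb
      rw [Subgroup.mem_comap, map_commutatorElement]
      exact Subgroup.commutator_mem_commutator ((Subgroup.mem_normalizer_iff.mp hyH a).mp ha)
        ((Subgroup.mem_normalizer_iff.mp hyK b).mp hb)
    have hle : ⁅N, Q⁆ ≤ N := by
      rw [Subgroup.commutator_le]
      intro a ha b hb
      rw [commutatorElement_def, mul_assoc, mul_assoc, ← mul_assoc b]
      exact mul_mem ha ((Subgroup.mem_normalizer_iff.mp (hQN hb) _).mp (inv_mem ha))
    rcases hle.lt_or_eq with hlt | heq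
    · have hL := hdesc Y _ hQY hYQ hsup hlt (Subgroup.le_normalizer_iff.mpr fun y hy =>
        hconj y N Q (hYN hy) (hYQ hy))
      intro n hn x hx
      set c := ⁅n, x⁆ with hc
      have hcL : c ∈ ⁅N, Q⁆ := Subgroup.commutator_mem_commutator hn hx
      have hcx : Commute c x := hL c hcL x hx
      have h1 : c * x = n * x * n⁻¹ := by rw [hc, commutatorElement_def]; group
      have h2 : c ^ Nat.card Q = 1 := by
        have h3 : x ^ Nat.card Q = 1 := by
          have := pow_card_eq_one' (x := (⟨x, hx⟩ : Q))
          exact congrArg Subtype.val this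
        have h4 := congrArg (· ^ Nat.card Q) h1
        simp only [conj_pow, hcx.mul_pow, h3, mul_one, mul_inv_cancel] at h4
        exact h4
      have h3 : c ^ Nat.card N = 1 := congrArg Subtype.val
        (pow_card_eq_one' (x := (⟨c, hle hcL⟩ : N)))
      have h4 : (Nat.card Q).Coprime (Nat.card N) := by
        obtain ⟨k, hk⟩ := IsPGroup.iff_card.mp h.isPGroup
        rw [hk]
        exact Nat.Coprime.pow_left _ ((Nat.Prime.coprime_iff_not_dvd Fact.out).mpr h.not_dvd)
      have h5 := pow_gcd_eq_one.mpr ⟨h2, h3⟩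
      rw [h4, pow_one] at h5
      exact commutatorElement_eq_one_iff_mul_comm.mp h5
    · rcases eq_or_ne N ⊥ with rfl | hN
      · intro n hn x _
        rw [Subgroup.mem_bot.mp hn, one_mul, mul_one]
      have hD : ⁅N, N⁆ < N := by
        have : Nontrivial N := (Subgroup.nontrivial_iff_ne_bot N).mpr hN
        have := hNp.isNilpotent
        have h1 := Group.IsSolvable.commutator_lt_top_of_nontrivial N
        have h2 := Subgroup.map_subtype_commutator N
        refine lt_of_le_of_ne ?_ fun h3 => h1.ne ?_
        · rw [← h2]; exact Subgroup.map_subtype_le _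
        · rw [h3] at h2
          rw [eq_top_iff, ← Subgroup.map_subtype_le_map_subtype, h2, ← MonoidHom.range_eq_map,
            Subgroup.range_subtype]
      have hDQ := (hcen _).mpr (hdesc Y _ hQY hYQ hsup hD (Subgroup.le_normalizer_iff.mpr
        fun y hy => hconj y N N (hYN hy) (hYN hy)))
      rw [← Subgroup.commutator_eq_bot_iff_le_centralizer] at hDQ
      have h3 : ⁅⁅N, Q⁆, ⁅N, N⁆⁆ = ⊥ := by
        apply Subgroup.commutator_commutator_eq_bot_of_rotate
        · rw [Subgroup.commutator_comm Q, hDQ, Subgroup.commutator_bot_left]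
        · rw [eq_bot_iff, ← hDQ]
          refine Subgroup.commutator_mono ?_ le_rfl
          exact Subgroup.commutator_mono hD.le le_rfl
      rw [heq, Subgroup.commutator_comm] at h3
      intro n hn x hx
      have h4 := h.map_commutator_eq_one hQY hYQ hsup h3 heq n hn x hx
      rw [← map_one ρ] at h4
      exact commutatorElement_eq_one_iff_mul_comm.mp (hρ h4)
  · push Not at hp
    rw [← hcen]
    have hone : (Subgroup.centralizer (Q : Set A)).relIndex N = 1 := by
      by_contra h1
      obtain ⟨p, hpp, hpd⟩ := Nat.exists_prime_and_dvd h1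
      have : Fact p.Prime := ⟨hpp⟩
      obtain ⟨P, hPN, hP, hpP, hQP⟩ :=
        Subgroup.exists_sylow_normalized (p := p) hQN h.isPGroup h.not_dvd
      have hsup := Subgroup.sup_inf_normalizer_eq h.left_le h.right_le h.le_left h.le_sup h.isPGroup
        h.not_dvd hPN hP hpP hQP
      have hlt : P < N := lt_of_le_of_ne hPN fun h2 => hp p hpp (h2 ▸ hP)
      have h2 := (hcen _).mpr (hdesc _ P (le_inf (le_inf h.right_le hQP) Subgroup.le_normalizer)
        inf_le_right hsup hlt (inf_le_left.trans inf_le_right))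
      exact hpP (hpd.trans (Subgroup.relIndex_dvd_of_le_left _ h2))
    exact Subgroup.relIndex_eq_one.mp hone

end Centralizing

section Linear

variable {σ : Set ℕ} {E G : Type} [Group E] [Group G]

theorem Representation.exists_smul_of_finrank_eq_one {V : Type} [AddCommGroup V] [Module ℂ V]
    (hV : Module.finrank ℂ V = 1) (T : V →ₗ[ℂ] V) : ∃ c : ℂ, T = c • 1 := by
  refine ⟨(LinearEquiv.smul_id_of_finrank_eq_one hV).symm T, ?_⟩
  conv_lhs => rw [← (LinearEquiv.smul_id_of_finrank_eq_one hV).apply_symm_apply T]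
  rfl

/-- A representation of degree one has its character as determinant. -/
theorem Representation.det_eq_character {V : Type} [AddCommGroup V] [Module ℂ V]
    [FiniteDimensional ℂ V] (ρ : Representation ℂ G V) (h : ρ.character 1 = 1) (g : G) :
    LinearMap.det (ρ g) = ρ.character g := by
  have hV : Module.finrank ℂ V = 1 := by
    rw [Representation.char_one] at h
    exact_mod_cast h
  obtain ⟨c, hc⟩ := exists_smul_of_finrank_eq_one hV (ρ g)
  have : ρ.character g = LinearMap.trace ℂ V (ρ g) := rfl
  rw [this, hc, LinearMap.det_smul, map_one, hV, map_smul]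
  simp [hV]

theorem IsCharacter.map_mul_of_linear {χ : G → ℂ} (h : IsCharacter G χ) (h1 : χ 1 = 1) (x y : G) :
    χ (x * y) = χ x * χ y := by
  obtain ⟨V, _, _, _, ρ, rfl⟩ := h.exists_rep
  simp only [← ρ.det_eq_character h1, map_mul]

theorem IsCharacter.map_pow_of_linear {χ : G → ℂ} (h : IsCharacter G χ) (h1 : χ 1 = 1) (x : G)
    (n : ℕ) : χ (x ^ n) = χ x ^ n := by
  induction n with
  | zero => simpa using h1
  | succ n ih => rw [pow_succ, h.map_mul_of_linear h1, ih, pow_succ]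

open scoped commutatorElement in
theorem IsCharacter.map_commutatorElement_of_linear {χ : G → ℂ} (h : IsCharacter G χ) (h1 : χ 1 = 1)
    (x y : G) : χ ⁅x, y⁆ = 1 := by
  obtain ⟨V, _, _, _, ρ, rfl⟩ := h.exists_rep
  simp only [← ρ.det_eq_character h1, commutatorElement_def, map_mul]
  have hx : LinearMap.det (ρ x) * LinearMap.det (ρ x⁻¹) = 1 := by
    rw [← map_mul, ← map_mul, mul_inv_cancel, map_one, map_one]
  have hy : LinearMap.det (ρ y) * LinearMap.det (ρ y⁻¹) = 1 := by
    rw [← map_mul, ← map_mul, mul_inv_cancel, map_one, map_one]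
  linear_combination hy * (LinearMap.det (ρ x) * LinearMap.det (ρ x⁻¹)) + hx

/-- A partial character of `σ'`-degree which is not a sum has only linear constituents on normal
`σ`-subgroups. -/
theorem IsLocChar.constituent_linear [Finite G] [Fintype E] {ι : E →* G} {a : G →* MulAut E}
    (ha : ∀ g e, ι (a g e) = g * ι e * g⁻¹) (hE : IsPiNumber σ (Nat.card E)) {φ : G → ℂ}
    (hφ : IsLocChar σ G φ)
    (hind : ∀ φ₁ φ₂, IsLocChar σ G φ₁ → IsLocChar σ G φ₂ → φ = φ₁ + φ₂ → φ₁ = 0 ∨ φ₂ = 0)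
    {d : ℕ} (hd : φ 1 = d) (hdσ : IsPiNumber σᶜ d) {s : Multiset (E → ℂ)}
    (hs : ∀ δ ∈ s, IsIrrChar E δ) (e : (fun x => φ (ι x)) = s.sum) :
    ∀ δ ∈ s, δ 1 = 1 := by
  intro δ hδ
  have := Fintype.ofFinite G
  let O : Finset (E → ℂ) := Finset.univ.image fun g x => δ (a g x)
  have hO : ∀ δ' ∈ O, IsIrrChar E δ' ∧ δ' 1 = δ 1 := by
    intro δ' h
    obtain ⟨g, -, rfl⟩ := Finset.mem_image.1 h
    exact ⟨(hs δ hδ).comp_mulEquiv (a g), by simp⟩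
  obtain ⟨hF, hF'⟩ := hφ.split ha hE O (fun δ' h => (hO δ' h).1) (by
    intro g δ' h
    obtain ⟨g', -, rfl⟩ := Finset.mem_image.1 h
    exact Finset.mem_image.2 ⟨g' * g, Finset.mem_univ _, by ext x; simp⟩)
  obtain ⟨d₁, hd₁⟩ := (hs δ hδ).1.exists_nat
  have hsum : (∑ δ' ∈ O, isoPart ι δ' φ) 1 = ((∑ δ' ∈ O, s.count δ' : ℕ) : ℂ) * d₁ := by
    rw [Finset.sum_apply, Nat.cast_sum, Finset.sum_mul]
    refine Finset.sum_congr rfl fun δ' h => ?_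
    rw [← map_one ι, isoPart_apply_map hφ hE hs e (hO δ' h).1, (hO δ' h).2, hd₁]
  have hδO : δ ∈ O := Finset.mem_image.2 ⟨1, Finset.mem_univ _, by ext x; simp⟩
  have hpos : (∑ δ' ∈ O, s.count δ') ≠ 0 := by
    have h1 := Finset.single_le_sum (f := fun δ' => s.count δ') (fun _ _ => Nat.zero_le _) hδO
    have h2 := Multiset.count_pos.2 hδ
    lia
  have hd₁0 : (d₁ : ℂ) ≠ 0 := hd₁ ▸ (hs δ hδ).map_one_ne_zero
  rcases hind _ _ hF hF' (by simp) with h | h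
  · exfalso
    rw [h] at hsum
    exact mul_ne_zero (Nat.cast_ne_zero.2 hpos) hd₁0 hsum.symm
  · have h1 := congrFun (sub_eq_zero.1 h) 1
    rw [hd, hsum] at h1
    have h2 : d = (∑ δ' ∈ O, s.count δ') * d₁ := by exact_mod_cast h1
    have h3 : d₁ = 1 := (hE.of_dvd ((hs δ hδ).degree_dvd hd₁)).eq_one
      (hdσ.of_dvd (h2 ▸ Dvd.intro_left _ rfl))
    rw [hd₁, h3, Nat.cast_one]

open scoped commutatorElement in
theorem IsLocChar.map_commutatorElement_pow [Finite G] [Fintype E] {ι : E →* G}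
    {a : G →* MulAut E}
    (ha : ∀ g e, ι (a g e) = g * ι e * g⁻¹) (hE : IsPiNumber σ (Nat.card E)) {φ : G → ℂ}
    (hφ : IsLocChar σ G φ)
    (hind : ∀ φ₁ φ₂, IsLocChar σ G φ₁ → IsLocChar σ G φ₂ → φ = φ₁ + φ₂ → φ₁ = 0 ∨ φ₂ = 0)
    {d : ℕ} (hd : φ 1 = d) (hdσ : IsPiNumber σᶜ d) (x y : E) (i : ℕ) :
    φ (ι ⁅x, y⁆ ^ i) = φ 1 := by
  obtain ⟨s, hs, e⟩ := (hφ.comp_hom hE ι).exists_multiset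
  have hlin := hφ.constituent_linear ha hE hind hd hdσ hs e
  have h1 : φ (ι ⁅x, y⁆ ^ i) = s.sum (⁅x, y⁆ ^ i) := by simp only [← e, map_pow]
  have h2 : φ 1 = s.sum 1 := by simp only [← e, map_one]
  rw [h1, h2, Pi.multiset_sum_apply, Pi.multiset_sum_apply]
  congr 1
  refine Multiset.map_congr rfl fun δ hδ => ?_
  have hc := (hs δ hδ).1
  have h := hlin δ hδ
  rw [hc.map_pow_of_linear h, hc.map_commutatorElement_of_linear h, one_pow, h]

end Linear

section FaithfulCase

variable {σ : Set ℕ} {G : Type} [Group G]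

theorem IsCharacter.multiset_sum {s : Multiset (G → ℂ)} (h : ∀ δ ∈ s, IsCharacter G δ) :
    IsCharacter G s.sum :=
  Multiset.sum_induction _ s (fun _ _ h h' => h.add h') isCharacter_zero h

theorem isConstituent_of_mem {χ : G → ℂ} {s : Multiset (G → ℂ)} (hs : ∀ δ ∈ s, IsIrrChar G δ)
    (e : χ = s.sum) {δ : G → ℂ} (hδ : δ ∈ s) : IsConstituent δ χ := by
  obtain ⟨t, rfl⟩ := Multiset.exists_cons_of_mem hδ
  refine ⟨hs δ hδ, t.sum, Or.inr ?_, by rw [e, Multiset.sum_cons]⟩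
  exact IsCharacter.multiset_sum fun ε hε => (hs ε (Multiset.mem_cons_of_mem hε)).1

theorem IsIPiChar.eq_zero_or_eq_zero [Finite G] (hG : IsSep σ G) {φ : G → ℂ}
    (h : IsIPiChar σ G φ) (φ₁ φ₂ : G → ℂ) (h₁ : IsLocChar σ G φ₁) (h₂ : IsLocChar σ G φ₂)
    (e : φ = φ₁ + φ₂) : φ₁ = 0 ∨ φ₂ = 0 := by
  by_contra! hne
  exact h.2 ⟨φ₁, φ₂, IsPartialChar.of_isSep hG h₁ hne.1, IsPartialChar.of_isSep hG h₂ hne.2, e⟩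

theorem Subgroup.card_map_mk' (N K : Subgroup G) [N.Normal] :
    Nat.card (K.map (QuotientGroup.mk' N)) = N.relIndex K := by
  have h := Subgroup.index_ker ((QuotientGroup.mk' N).comp K.subtype)
  rw [MonoidHom.range_comp, K.range_subtype] at h
  rw [← h, Subgroup.relIndex, ← MonoidHom.comap_ker, QuotientGroup.ker_mk']
  rfl

theorem Subgroup.normal_of_mul_comm_sup [Finite G] {N Q : Subgroup G} [N.Normal]
    (hNQ : (N ⊔ Q).Normal) (hcop : (Nat.card N).Coprime (Nat.card Q))
    (hcomm : ∀ n ∈ N, ∀ x ∈ Q, n * x = x * n) : Q.Normal := by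
  refine ⟨fun x hx g => ?_⟩
  obtain ⟨n, hn, y, hy, e⟩ := Subgroup.mem_sup_of_normal_left.1
    (hNQ.conj_mem x (Subgroup.mem_sup_right hx) g)
  have h1 : (g * x * g⁻¹) ^ Nat.card Q = 1 := by
    rw [conj_pow, orderOf_dvd_iff_pow_eq_one.1 (Subgroup.orderOf_dvd_natCard Q hx), mul_one, mul_inv_cancel]
  rw [← e, (show Commute n y from hcomm n hn y hy).mul_pow, orderOf_dvd_iff_pow_eq_one.1 (Subgroup.orderOf_dvd_natCard Q hy),
    mul_one] at h1
  have h2 : n ^ Nat.card N = 1 :=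
    orderOf_dvd_iff_pow_eq_one.1 (Subgroup.orderOf_dvd_natCard N hn)
  have h3 : n = 1 := by
    have := pow_gcd_eq_one.2 ⟨h2, h1⟩
    rwa [hcop, pow_one] at this
  rw [← e, h3, one_mul]
  exact hy

open scoped commutatorElement in
/-- If the commutators of `K` lie in `N`, then `N Q` is normal for a Sylow subgroup `Q` of `K`. -/
theorem Subgroup.normal_sup_of_sylow [Finite G] {q : ℕ} [Fact q.Prime] {N K Q : Subgroup G}
    [N.Normal] [K.Normal] (hQK : Q ≤ K) (hQ : IsPGroup q Q) (hq : ¬ q ∣ Q.relIndex K)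
    (hK : ∀ x ∈ K, ∀ y ∈ K, ⁅x, y⁆ ∈ N) : (N ⊔ Q).Normal := by
  have key : ∀ g : G, ∀ x ∈ Q, g * x * g⁻¹ ∈ N ⊔ Q := by
    intro g x hx
    obtain ⟨k, hk, h⟩ := Subgroup.exists_conj_mem_of_isPGroup (R' := Q.map (MulAut.conj g).toMonoidHom)
      hQK hQ hq
      (by
        rintro _ ⟨y, hy, rfl⟩
        exact (inferInstance : K.Normal).conj_mem y (hQK hy) g) (hQ.map _)
    have h1 := h _ ⟨x, hx, rfl⟩
    set y := k * (MulAut.conj g).toMonoidHom x * k⁻¹ with hy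
    have h2 : g * x * g⁻¹ = ⁅k⁻¹, y⁆ * y := by
      rw [commutatorElement_def, hy]
      simp [mul_assoc]
    rw [h2]
    exact Subgroup.mul_mem _ (Subgroup.mem_sup_left (hK _ (K.inv_mem hk) _ (hQK h1)))
      (Subgroup.mem_sup_right h1)
  refine ⟨fun x hx g => ?_⟩
  obtain ⟨n, hn, y, hy, rfl⟩ := Subgroup.mem_sup_of_normal_left.1 hx
  have : g * (n * y) * g⁻¹ = (g * n * g⁻¹) * (g * y * g⁻¹) := by group
  rw [this]
  exact Subgroup.mul_mem _
    (Subgroup.mem_sup_left ((inferInstance : N.Normal).conj_mem n hn g)) (key g y hy)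

variable {V : Type} [AddCommGroup V] [Module ℂ V] [FiniteDimensional ℂ V]
  {ρ : Representation ℂ G V}

open scoped commutatorElement in
/-- A `σ`-section above a normal `σ'`-subgroup `N` is abelian. -/
theorem commutatorElement_mem_of_isIPiChar [Finite G] (hG : IsSep σ G) (hρ : Function.Injective ρ)
    (hV : IsPiNumber σᶜ (Module.finrank ℂ V))
    (h : IsIPiChar σ G (piRestrict σ ρ.character)) {N K : Subgroup G} [N.Normal] [K.Normal]
    (hN : IsPiNumber σᶜ (Nat.card N)) (hNK : IsPiNumber σ (N.relIndex K)) :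
    ∀ x ∈ K, ∀ y ∈ K, ⁅x, y⁆ ∈ N := by
  intro x hx y hy
  have := Fintype.ofFinite G
  have hker : IsPiNumber σᶜ (Nat.card (QuotientGroup.mk' N).ker) := by
    rwa [QuotientGroup.ker_mk']
  obtain ⟨φ, hφ, hφβ, hind⟩ := h.exists_quotient hG ρ.isCharacter_character
    (QuotientGroup.mk' N) (QuotientGroup.mk'_surjective N) hker
  have hE : IsPiNumber σ (Nat.card (K.map (QuotientGroup.mk' N))) := by
    rwa [Subgroup.card_map_mk']
  have : (K.map (QuotientGroup.mk' N)).Normal :=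
    Subgroup.Normal.map inferInstance _ (QuotientGroup.mk'_surjective N)
  have hφ1 : φ 1 = (Module.finrank ℂ V : ℕ) := by
    rw [← map_one (QuotientGroup.mk' N), ← hφβ 1 isPiElt_one, Representation.char_one]
  let x' : K.map (QuotientGroup.mk' N) := ⟨QuotientGroup.mk' N x, x, hx, rfl⟩
  let y' : K.map (QuotientGroup.mk' N) := ⟨QuotientGroup.mk' N y, y, hy, rfl⟩
  have := Fintype.ofFinite (K.map (QuotientGroup.mk' N))
  have hw := hφ.map_commutatorElement_pow (ι := (K.map (QuotientGroup.mk' N)).subtype)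
    (a := MulAut.conjNormal) (fun g e => MulAut.conjNormal_apply g e) hE hind hφ1 hV x' y'
  obtain ⟨g, hg, hgw⟩ := exists_piElt_map_eq (QuotientGroup.mk' N) (QuotientGroup.mk'_surjective N)
    hker (isPiElt_of_mem hE ⁅x', y'⁆.2)
  have h1 : ρ g = 1 := ρ.eq_one_of_char_pow g fun i => by
    have h3 := hφβ (g ^ i) (hg.pow i)
    rw [map_pow, hgw] at h3
    rw [h3, Representation.char_one, ← hφ1]
    exact hw i
  have h2 : g = 1 := hρ (h1.trans (map_one ρ).symm)
  have h3 : QuotientGroup.mk' N ⁅x, y⁆ = 1 := by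
    have h4 : QuotientGroup.mk' N ⁅x, y⁆ = (⁅x', y'⁆ : K.map (QuotientGroup.mk' N)) := by
      rw [map_commutatorElement]
      rfl
    rw [h4, ← hgw, h2, map_one]
  rwa [← MonoidHom.mem_ker, QuotientGroup.ker_mk'] at h3

theorem Representation.eq_bot_of_constituents [Finite G] (hG : IsSep σ G)
    (hρ : Function.Injective ρ)
    (hV : IsPiNumber σᶜ (Module.finrank ℂ V))
    (h : IsIPiChar σ G (piRestrict σ ρ.character))
    (hD : ∀ Q : Subgroup G, Q.Normal → ∀ δ, IsConstituent δ (resChar Q ρ.character) → δ 1 = 1 →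
      ∃ n : ℕ, IsPiNumber σᶜ n ∧ ∀ x, δ x ^ n = 1)
    {Q : Subgroup G} [hQn : Q.Normal] (hQ : IsPiNumber σ (Nat.card Q)) : Q = ⊥ := by
  have := Fintype.ofFinite G
  have hφ := (ρ.isCharacter_character).isLocChar (σ := σ)
  obtain ⟨s, hs, e⟩ := (hφ.comp_hom hQ Q.subtype).exists_multiset
  have hlin := hφ.constituent_linear (ι := Q.subtype) (a := MulAut.conjNormal)
    (fun g x => MulAut.conjNormal_apply g x) hQ (h.eq_zero_or_eq_zero hG)
    (d := Module.finrank ℂ V) (by rw [piRestrict_one, Representation.char_one]) hV hs e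
  have e' : resChar Q ρ.character = s.sum := by
    rw [← e]
    ext x
    exact (if_pos (isPiElt_of_mem hQ x.2)).symm
  have hone : ∀ δ ∈ s, ∀ x, δ x = 1 := by
    intro δ hδ x
    obtain ⟨n, hn, h1⟩ := hD Q hQn δ (isConstituent_of_mem hs e' hδ) (hlin δ hδ)
    have h2 : δ x ^ Nat.card Q = 1 := by
      rw [← (hs δ hδ).1.map_pow_of_linear (hlin δ hδ), pow_card_eq_one', hlin δ hδ]
    have h3 := pow_gcd_eq_one.2 ⟨h2, h1 x⟩
    rwa [hQ.coprime hn, pow_one] at h3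
  have hconst : ∀ x ∈ Q, ρ.character x = ρ.character 1 := by
    have : ∀ x : Q, s.sum x = s.sum 1 := fun x => by
      rw [Pi.multiset_sum_apply, Pi.multiset_sum_apply]
      congr 1
      exact Multiset.map_congr rfl fun δ hδ => by rw [hone δ hδ, hone δ hδ]
    intro x hx
    have h1 := this ⟨x, hx⟩
    rwa [← e'] at h1
  rw [Subgroup.eq_bot_iff_forall]
  intro x hx
  exact hρ ((ρ.eq_one_of_char_pow x fun i => hconst _ (Q.pow_mem hx i)).trans (map_one ρ).symm)

theorem Representation.finrank_eq_one_of_isIPiChar [Finite G] (h2 : 2 ∈ σ) (hG : IsSep σ G)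
    (hρ : Function.Injective ρ)
    (hV : IsPiNumber σᶜ (Module.finrank ℂ V))
    (h : IsIPiChar σ G (piRestrict σ ρ.character))
    (hD : ∀ Q : Subgroup G, Q.Normal → ∀ δ, IsConstituent δ (resChar Q ρ.character) → δ 1 = 1 →
      ∃ n : ℕ, IsPiNumber σᶜ n ∧ ∀ x, δ x ^ n = 1) :
    Module.finrank ℂ V = 1 := by
  have := Fintype.ofFinite G
  have hβ := ρ.isCharacter_character
  obtain ⟨N, -, hN, hNn, hmax⟩ := exists_max_normal σᶜ (⊤ : Subgroup G)
  have hNn : N.Normal := ⟨fun n hn g => hNn g (Subgroup.mem_top g) n hn⟩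
  by_cases hNT : N = ⊤
  · have h1 := h.isIrrChar_resChar hG hβ hN (Y := ⊥) (by simp [hNT])
    have h3 := h1.degree_dvd (d := Module.finrank ℂ V) (by simp [resChar])
    simpa using h3
  exfalso
  obtain ⟨K, hKn, hNK, hK | hK⟩ := hG.exists_normal_lt N hNT
  swap
  · refine hNK.not_ge (hmax K le_top ?_ fun g _ k hk => hKn.conj_mem k hk g)
    rw [← Subgroup.card_mul_relIndex' hNK.le]
    exact hN.mul hK
  have hidx : N.relIndex K ≠ 1 := fun h1 => hNK.not_ge (Subgroup.relIndex_eq_one.1 h1)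
  obtain ⟨q, hq, hqK⟩ := Nat.exists_prime_and_dvd hidx
  have hqσ : q ∈ σ := hK q hq hqK
  have : Fact q.Prime := ⟨hq⟩
  have hcomm := commutatorElement_mem_of_isIPiChar hG hρ hV h hN hK
  obtain ⟨P⟩ : Nonempty (Sylow q K) := inferInstance
  set Q : Subgroup G := (P : Subgroup K).map K.subtype with hQdef
  have hQK : Q ≤ K := Subgroup.map_subtype_le _
  have hQ : IsPGroup q Q := P.2.map _
  have hQi : ¬ q ∣ Q.relIndex K := by
    have : Q.subgroupOf K = P := Subgroup.comap_map_eq_self_of_injective K.subtype_injective _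
    rw [Subgroup.relIndex, this]
    exact P.not_dvd_index
  have hNQ := Subgroup.normal_sup_of_sylow hQK hQ hQi hcomm
  have hnd : ∀ {m : ℕ}, IsPiNumber σᶜ m → ¬ q ∣ m := fun hm hd => hm q hq hd hqσ
  have hconf : ρ.CoprimeConfig q ⊤ N Q :=
    { left_le := le_top
      right_le := le_top
      isPGroup := hQ
      le_left := by rw [Subgroup.normalizer_eq_top]
      le_sup := by rw [Subgroup.normalizer_eq_top]
      odd := by
        rw [← Nat.not_even_iff_odd, even_iff_two_dvd]
        exact fun hd => hN 2 Nat.prime_two hd h2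
      not_dvd := hnd hN
      not_dvd_finrank := hnd hV
      irr := fun Y _ hY T hT => by
        have := Representation.isIrreducible_of_isIrrChar (ρ.comp Y.subtype)
          (h.isIrrChar_resChar hG hβ hN hY)
        exact Representation.exists_eq_smul (ρ.comp Y.subtype) T fun y => hT y y.2 }
  have hQσ : IsPiNumber σ (Nat.card Q) := by
    obtain ⟨n, hn⟩ := IsPGroup.iff_card.1 hQ
    rw [hn]
    intro r hr hrq
    rwa [(Nat.prime_dvd_prime_iff_eq hr hq).1 (hr.dvd_of_dvd_pow hrq)]
  have hQn : Q.Normal := Subgroup.normal_of_mul_comm_sup hNQ (hQσ.coprime hN).symm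
    (hconf.commute hρ)
  have hQ1 : Q = ⊥ := Representation.eq_bot_of_constituents hG hρ hV h hD hQσ
  rw [hQ1, Subgroup.relIndex_bot_left] at hQi
  exact hQi (hqK.trans (Subgroup.relIndex_dvd_card N K))

end FaithfulCase

section Special

variable {σ : Set ℕ} {G H : Type} [Group G] [Group H]

theorem IsCharacter.isIrrChar_of_linear {χ : G → ℂ} (h : IsCharacter G χ) (h1 : χ 1 = 1) :
    IsIrrChar G χ := by
  refine ⟨h, fun h0 => by simp [h0] at h1, ?_⟩
  rintro ⟨χ₁, χ₂, hc₁, h₁, hc₂, h₂, rfl⟩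
  obtain ⟨m, hm⟩ := hc₁.exists_nat
  obtain ⟨n, hn⟩ := hc₂.exists_nat
  have hm0 : m ≠ 0 := fun h0 => h₁ (hc₁.eq_zero_of_map_one (by rw [hm, h0, Nat.cast_zero]))
  have hn0 : n ≠ 0 := fun h0 => h₂ (hc₂.eq_zero_of_map_one (by rw [hn, h0, Nat.cast_zero]))
  rw [Pi.add_apply, hm, hn] at h1
  have : m + n = 1 := by exact_mod_cast h1
  lia

theorem Subgroup.Normal.isSubnormalSubgroup {M : Subgroup G} (h : M.Normal) :
    IsSubnormalSubgroup M :=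
  ⟨1, ![M, ⊤], rfl, rfl, fun i => by
    fin_cases i
    exact ⟨le_top, h.subgroupOf ⊤⟩⟩

theorem HasPiDetOrder.exists_pow_eq_one {θ : G → ℂ} (h : HasPiDetOrder σ G θ) (h1 : θ 1 = 1) :
    ∃ n : ℕ, IsPiNumber σ n ∧ ∀ x, θ x ^ n = 1 := by
  obtain ⟨V, hV, hn⟩ := h
  have hθ : ∀ g, θ g = LinearMap.det (V.ρ g) := fun g => by
    have h2 : ∀ g, Representation.character V.ρ g = θ g := fun g => (hV g).symm
    rw [Representation.det_eq_character V.ρ ((h2 1).trans h1), h2]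
  refine ⟨_, hn, fun x => ?_⟩
  have := congrFun (pow_orderOf_eq_one fun g : G => LinearMap.det (V.ρ g)) x
  rwa [Pi.pow_apply, ← hθ, Pi.one_apply] at this

/-- Linear constituents of a special character on a normal subgroup of a quotient have `σ`-order. -/
theorem IsPiSpecial.exists_pow_eq_one {β : G → ℂ} (h : IsPiSpecial σ G β) (f : G →* H)
    {γ : H → ℂ} (hγ : ∀ g, β g = γ (f g)) (hf : Function.Surjective f) {Q : Subgroup H}
    (hQ : Q.Normal) {δ : Q → ℂ} (hδ : IsConstituent δ (resChar Q γ)) (h1 : δ 1 = 1) :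
    ∃ n : ℕ, IsPiNumber σ n ∧ ∀ x, δ x ^ n = 1 := by
  let r : Q.comap f →* Q := f.subgroupComap Q
  obtain ⟨hirr, ξ, hξ, e⟩ := hδ
  have hr : (fun m => δ (r m)) 1 = 1 := by simp [h1]
  obtain ⟨n, hn, hx⟩ := (h.2.2 (Q.comap f) (hQ.comap f).isSubnormalSubgroup (fun m => δ (r m))
    ⟨(hirr.1.comp r).isIrrChar_of_linear hr, fun m => ξ (r m),
      hξ.imp (fun h0 => by rw [h0]; rfl) fun h0 => h0.comp r, by
        ext m
        exact (hγ m).trans (congrFun e (r m))⟩).exists_pow_eq_one hr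
  refine ⟨n, hn, fun x => ?_⟩
  obtain ⟨g, hg⟩ := hf x
  have := hx ⟨g, show f g ∈ Q from hg ▸ x.2⟩
  rwa [show r ⟨g, show f g ∈ Q from hg ▸ x.2⟩ = x from Subtype.ext hg] at this

theorem IsIPiChar.of_comp {β : G → ℂ} (h : IsIPiChar σ G (piRestrict σ β)) (f : G →* H)
    {γ : H → ℂ} (hγc : IsCharacter H γ) (hγ : ∀ g, β g = γ (f g)) :
    IsIPiChar σ H (piRestrict σ γ) := by
  refine ⟨⟨γ, hγc, ?_, rfl⟩, ?_⟩
  · rintro rfl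
    refine h.1.map_one_ne_zero ?_
    rw [piRestrict_one, hγ, Pi.zero_apply]
  · rintro ⟨φ₁, φ₂, ⟨χ₁, hc₁, h₁, rfl⟩, ⟨χ₂, hc₂, h₂, rfl⟩, e⟩
    refine h.2 ⟨_, _, ⟨_, hc₁.comp f, ?_, rfl⟩, ⟨_, hc₂.comp f, ?_, rfl⟩, ?_⟩
    · exact fun h0 => h₁ (hc₁.eq_zero_of_map_one (by simpa using congrFun h0 1))
    · exact fun h0 => h₂ (hc₂.eq_zero_of_map_one (by simpa using congrFun h0 1))
    · ext g
      by_cases hg : IsPiElt σ g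
      · have := congrFun e (f g)
        simp only [piRestrict, Pi.add_apply, if_pos (hg.map f), if_pos hg, hγ] at this ⊢
        exact this
      · simp [piRestrict, hg]

theorem IsPiSpecial.map_one_eq_one [Finite G] (h2 : 2 ∈ σ) (hG : IsSep σ G) {β : G → ℂ}
    (hβ : IsPiSpecial σᶜ G β) (h : IsIPiChar σ G (piRestrict σ β)) : β 1 = 1 := by
  obtain ⟨V, _, _, _, ρ, rfl⟩ := hβ.1.1.exists_rep
  let f := QuotientGroup.mk' (MonoidHom.ker ρ)
  have hf : Function.Surjective f := QuotientGroup.mk'_surjective _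
  obtain ⟨τ, hτ⟩ := Representation.exists_of_surjective f hf ρ fun k hk => by
    rwa [QuotientGroup.ker_mk', MonoidHom.mem_ker] at hk
  have hχ : ∀ g, ρ.character g = τ.character (f g) := fun g => by
    simp only [Representation.character, hτ]
  have hinj : Function.Injective τ := by
    intro a b hab
    obtain ⟨x, rfl⟩ := hf a
    obtain ⟨y, rfl⟩ := hf b
    rw [hτ, hτ] at hab
    refine QuotientGroup.eq.2 ?_
    rw [MonoidHom.mem_ker, map_mul, ← hab, ← map_mul, inv_mul_cancel, map_one]
  obtain ⟨n, hn, hnσ⟩ := hβ.2.1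
  rw [Representation.char_one] at hn ⊢
  have := Representation.finrank_eq_one_of_isIPiChar h2 (hG.of_surjective f hf) hinj
    (by rwa [show Module.finrank ℂ V = n by exact_mod_cast hn])
    (h.of_comp f τ.isCharacter_character hχ)
    fun Q hQ δ hδ h1 => hβ.exists_pow_eq_one f hχ hf hQ hδ h1
  rw [this, Nat.cast_one]

theorem IsIPiChar.of_mul {α β : G → ℂ} (hα : IsCharacter G α) (hβ : IsCharacter G β)
    (h : IsIPiChar σ G (piRestrict σ (α * β))) : IsIPiChar σ G (piRestrict σ β) := by
  have h0 := h.1.map_one_ne_zero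
  rw [piRestrict_one, Pi.mul_apply, mul_ne_zero_iff] at h0
  refine ⟨⟨β, hβ, fun h1 => h0.2 (congrFun h1 1), rfl⟩, ?_⟩
  rintro ⟨φ₁, φ₂, ⟨χ₁, hc₁, h₁, rfl⟩, ⟨χ₂, hc₂, h₂, rfl⟩, e⟩
  have key : ∀ {χ : G → ℂ}, IsCharacter G χ → χ ≠ 0 → α * χ ≠ 0 := fun hc hχ he =>
    hχ (hc.eq_zero_of_map_one ((mul_eq_zero.1 (congrFun he 1)).resolve_left h0.1))
  refine h.2 ⟨_, _, ⟨_, hα.mul hc₁, key hc₁ h₁, rfl⟩, ⟨_, hα.mul hc₂, key hc₂ h₂, rfl⟩, ?_⟩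
  ext g
  have := congrFun e g
  by_cases hg : IsPiElt σ g
  · simp only [piRestrict, Pi.add_apply, Pi.mul_apply, if_pos hg] at this ⊢
    rw [this, mul_add]
  · simp [piRestrict, hg]

theorem piRestrict_indChar [Fintype G] (U : Subgroup G) (ψ : U → ℂ) :
    piRestrict σ (indChar U ψ) = indChar U (piRestrict σ ψ) := by
  ext g
  by_cases hg : IsPiElt σ g
  · simp only [piRestrict, if_pos hg, indChar]
    congr 1
    refine Finset.sum_congr rfl fun x _ => ?_
    by_cases hx : x * g * x⁻¹ ∈ U
    · rw [dif_pos hx, dif_pos hx, if_pos]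
      exact isPiElt_coe.1 (isPiElt_conj.2 hg)
    · rw [dif_neg hx, dif_neg hx]
  · simp only [piRestrict, if_neg hg, indChar]
    rw [Finset.sum_eq_zero, mul_zero]
    intro x _
    by_cases hx : x * g * x⁻¹ ∈ U
    · rw [dif_pos hx, if_neg]
      exact fun h => hg (isPiElt_conj.1 (isPiElt_coe.2 h))
    · rw [dif_neg hx]

theorem indChar_add [Fintype G] (U : Subgroup G) (ψ ψ' : U → ℂ) :
    indChar U (ψ + ψ') = indChar U ψ + indChar U ψ' := by
  ext g
  simp only [indChar, Pi.add_apply]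
  rw [← mul_add, ← Finset.sum_add_distrib]
  congr 1
  refine Finset.sum_congr rfl fun x _ => ?_
  split_ifs <;> simp

theorem IsCharacter.indChar_ne_zero [Fintype G] {U : Subgroup G} {ψ : U → ℂ}
    (h : IsCharacter U ψ) (h0 : ψ ≠ 0) : _root_.indChar U ψ ≠ 0 := by
  intro he
  refine h0 (h.eq_zero_of_map_one ?_)
  have h1 := congrFun he 1
  have h2 : ∀ x : G, (if h : x * 1 * x⁻¹ ∈ U then ψ ⟨x * 1 * x⁻¹, h⟩ else 0) = ψ 1 := fun x => by
    have hx : x * 1 * x⁻¹ = 1 := by group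
    rw [dif_pos (show x * 1 * x⁻¹ ∈ U by rw [hx]; exact U.one_mem)]
    exact congrArg ψ (Subtype.ext hx)
  simp only [_root_.indChar, h2, Finset.sum_const, nsmul_eq_mul, Pi.zero_apply,
    Finset.card_univ] at h1
  rcases mul_eq_zero.1 h1 with h3 | h3
  · exact absurd (inv_eq_zero.1 h3) (Nat.card_cast_ne_zero U)
  · refine (mul_eq_zero.1 h3).resolve_left ?_
    rw [← Nat.card_eq_fintype_card]
    exact Nat.card_cast_ne_zero G

theorem IsIPiChar.of_indChar [Fintype G] {U : Subgroup G} {ψ : U → ℂ} (hψ : IsIrrChar U ψ)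
    (h : IsIPiChar σ G (piRestrict σ (indChar U ψ))) : IsIPiChar σ U (piRestrict σ ψ) := by
  refine ⟨⟨ψ, hψ.1, hψ.2.1, rfl⟩, ?_⟩
  rintro ⟨φ₁, φ₂, ⟨χ₁, hc₁, h₁, rfl⟩, ⟨χ₂, hc₂, h₂, rfl⟩, e⟩
  exact h.2 ⟨_, _, ⟨_, hc₁.indChar, hc₁.indChar_ne_zero h₁, rfl⟩,
    ⟨_, hc₂.indChar, hc₂.indChar_ne_zero h₂, rfl⟩, by
      rw [piRestrict_indChar, e, indChar_add, piRestrict_indChar, piRestrict_indChar]⟩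

end Special

/-- **Theorem (Statement 11).** Let `π` be a set of primes with `2 ∈ π` and let `G` be a
finite `π`-separable group.  Let `χ ∈ Irr(G)` with `χ^o ∈ I_π(G)`.  If `U ≤ G` and
`ψ ∈ Irr(U)` is `π`-factored and induces `χ`, then the `π'`-special factor of `ψ` is
linear, and every Hall `π'`-subgroup `Q` of `U` is a vertex subgroup of `χ^o`. -/
theorem piPrime_factor_linear_and_vertex
    (π : Set ℕ) (h2 : 2 ∈ π)
    (G : Type) [Group G] [Fintype G] (hG : IsPiSeparable π G)
    (χ : G → ℂ) (hχ : IsIrrChar G χ) (hχo : IsIPiChar π G (piRestrict π χ))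
    (U : Subgroup G) (ψ : ↥U → ℂ) (hψirr : IsIrrChar ↥U ψ)
    (hψfac : IsPiFactored π ↥U ψ) (hind : indChar U ψ = χ) :
    (∀ α β : ↥U → ℂ, IsPiSpecial π ↥U α → IsPiSpecial πᶜ ↥U β → ψ = α * β → β 1 = 1) ∧
    ∀ Q : Subgroup G, Q ≤ U → IsPiNumber πᶜ (Nat.card ↥Q) →
      IsPiNumber π ((Q.subgroupOf U).index) →
      IsVertexSubgroup π (piRestrict π χ) Q := by
  have hψo : IsIPiChar π U (piRestrict π ψ) := IsIPiChar.of_indChar hψirr (hind.symm ▸ hχo)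
  have hlin : ∀ α β : U → ℂ, IsPiSpecial π U α → IsPiSpecial πᶜ U β → ψ = α * β → β 1 = 1 := by
    rintro α β hα hβ rfl
    exact hβ.map_one_eq_one h2 (hG.isSep.subgroup U) (hψo.of_mul hα.1.1 hβ.1.1)
  refine ⟨hlin, fun Q hQU hQ hQi => ?_⟩
  obtain ⟨α, β, hα, hβ, rfl⟩ := hψfac
  obtain ⟨n, hn, hnπ⟩ := hα.2.1
  refine ⟨U, piRestrict π (α * β), hQU, hQ, hQi, hψo, ⟨n, ?_, hnπ⟩, ?_⟩
  · rw [piRestrict_one, Pi.mul_apply, hlin α β hα hβ rfl, mul_one, hn]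
  · rw [← piRestrict_indChar, hind]
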